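/- arXiv:1007.1359 — 3 statements merged into one kernel-verified Lean document; each statement's English description precedes it below -/
import Mathlib

section
/- For every r > 0, c(B_r) = c(C_{r,1}) = π r², where B_r = {z ∈ Z : ‖z‖ < r} and C_{r,1} = {z = Σ_j p_j φ_j^+ + q_j φ_j^- ∈ Z : p_1² + q_1² < r²}; moreover, for every bounded nonempty open set O ⊂ Z one has 0 < c(O) < +∞, where c is Kuksin's symplectic capacity on Z. -/
open scoped RealInnerProductSpace BigOperators ENNReal NNReal
open Metric

noncomputable section

namespace Kuksin

variable {Z : Type*} [NormedAddCommGroup Z] [InnerProductSpace ℝ Z] [CompleteSpace Z]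

/-- The family `b (j, true) = φ_j^+`, `b (j, false) = φ_j^-` (indexed by `j : ℕ`,
standing for `j ≥ 1`) is a Hilbert basis of `Z`. -/
def IsHilbertBasis (b : ℕ × Bool → Z) : Prop :=
  Orthonormal ℝ b ∧ (Submodule.span ℝ (Set.range b)).topologicalClosure = ⊤

/-- The operator `J` acts by `J φ_j^± = ∓ φ_j^∓`. -/
def IsJ (b : ℕ × Bool → Z) (J : Z →L[ℝ] Z) : Prop :=
  ∀ j : ℕ, J (b (j, true)) = - b (j, false) ∧ J (b (j, false)) = b (j, true)

/-- The orthogonal projector `Π^n` onto `Z^n = span {φ_j^± : j < n}`. -/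
def proj (b : ℕ × Bool → Z) (n : ℕ) (z : Z) : Z :=
  ∑ j ∈ Finset.range n, (⟪b (j, true), z⟫ • b (j, true) + ⟪b (j, false), z⟫ • b (j, false))

/-- A (global-in-time) trajectory of the Hamiltonian vector field `X_{f_n} = J ∇ f_n` of
`f_n = f|_{O ∩ Z^n}` on `O^n = O ∩ Z^n`  (the gradient of the restriction of `f` to `Z^n`
is `Π^n ∇f`). -/
def IsTrajectory (b : ℕ × Bool → Z) (J : Z →L[ℝ] Z) (O : Set Z) (f : Z → ℝ) (n : ℕ)
    (z : ℝ → Z) : Prop :=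
  (∀ t : ℝ, z t ∈ O) ∧ (∀ t : ℝ, proj b n (z t) = z t) ∧
  (∀ t : ℝ, HasDerivAt z (J (proj b n (gradient f (z t)))) t)

/-- A fast trajectory: a nonconstant periodic trajectory of period `≤ 1`. -/
def IsFastTrajectory (b : ℕ × Bool → Z) (J : Z →L[ℝ] Z) (O : Set Z) (f : Z → ℝ) (n : ℕ)
    (z : ℝ → Z) : Prop :=
  IsTrajectory b J O f n z ∧ (∃ t₁ t₂ : ℝ, z t₁ ≠ z t₂) ∧
  (∃ T : ℝ, 0 < T ∧ T ≤ 1 ∧ ∀ t : ℝ, z (t + T) = z t)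

/-- `f` is an `m`-admissible function on the open set `O`. -/
def IsAdmissible (O : Set Z) (m : ℝ) (f : Z → ℝ) : Prop :=
  0 < m ∧ ContDiffOn ℝ (⊤ : ℕ∞) f O ∧ (∀ z ∈ O, 0 ≤ f z ∧ f z ≤ m) ∧
  (∃ U : Set Z, IsOpen U ∧ U.Nonempty ∧ U ⊆ O ∧ ∀ z ∈ U, f z = 0) ∧
  (∀ z ∈ frontier O, f z = m) ∧
  Bornology.IsBounded {z ∈ O | f z < m} ∧
  (∃ d : ℝ, 0 < d ∧ ∀ x ∈ {z ∈ O | f z < m}, ∀ y ∈ frontier O, d ≤ dist x y)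

/-- An `m`-admissible function `f` is fast if for all large enough `n` the Hamiltonian
vector field `X_{f_n}` has a fast trajectory. -/
def IsFastFunction (b : ℕ × Bool → Z) (J : Z →L[ℝ] Z) (O : Set Z) (f : Z → ℝ) : Prop :=
  ∃ n₀ : ℕ, ∀ n ≥ n₀, ∃ z : ℝ → Z, IsFastTrajectory b J O f n z

/-- The set of thresholds `m*` such that every `m`-admissible function with `m > m*` is fast. -/
def capSet (b : ℕ × Bool → Z) (J : Z →L[ℝ] Z) (O : Set Z) : Set ℝ :=
  {m' | 0 ≤ m' ∧ ∀ m : ℝ, ∀ f : Z → ℝ, m' < m → IsAdmissible O m f → IsFastFunction b J O f}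

/-- Kuksin's symplectic capacity of an open set `O ⊆ Z` (with value in `[0, ∞]`). -/
def cap (b : ℕ × Bool → Z) (J : Z →L[ℝ] Z) (O : Set Z) : ℝ≥0∞ :=
  sInf (ENNReal.ofReal '' capSet b J O)


set_option linter.unusedSectionVars false

section parta

section brouwer
open MeasureTheory Polynomial

variable {E : Type*} [NormedAddCommGroup E] [InnerProductSpace ℝ E] [FiniteDimensional ℝ E]

lemma det_poly (M : E →L[ℝ] E) : ∃ P : ℝ[X], P.natDegree ≤ Module.finrank ℝ E ∧
    ∀ t : ℝ, P.eval t = (ContinuousLinearMap.id ℝ E + t • M).det := by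
  classical
  let bs := Module.finBasis ℝ E
  let A := LinearMap.toMatrix bs bs (M : E →ₗ[ℝ] E)
  refine ⟨Matrix.det ((X : ℝ[X]) • A.map C + (1 : Matrix _ _ ℝ).map C), ?_, ?_⟩
  · simpa using natDegree_det_X_add_C_le A 1
  · intro t
    rw [← Polynomial.coe_evalRingHom, RingHom.map_det]
    have : (ContinuousLinearMap.id ℝ E + t • M).det = LinearMap.det (LinearMap.id + t • (M : E →ₗ[ℝ] E)) := by
      rfl
    rw [this, ← LinearMap.det_toMatrix bs]
    congr 1
    ext i j
    simp only [A, Matrix.one_apply, Matrix.add_apply, LinearMap.toMatrix_apply, map_add,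
      RingHom.mapMatrix_apply, Matrix.map_apply, Matrix.smul_apply, smul_eq_mul,
      Polynomial.coe_evalRingHom, LinearMap.add_apply, LinearMap.smul_apply, Finsupp.add_apply,
      LinearMap.id_apply, Module.Basis.repr_self, map_smul, Finsupp.smul_apply, eval_mul,
      eval_X, eval_C, Finsupp.single_apply]
    rw [add_comm]
    simp only [eq_comm]

lemma det_pos_small (M : E →L[ℝ] E) (t : ℝ) (ht : 0 ≤ t) (h : t * ‖M‖ < 1) :
    0 < (ContinuousLinearMap.id ℝ E + t • M).det := by
  by_contra hneg
  push Not at hneg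
  have hc : ContinuousOn (fun s : ℝ => (ContinuousLinearMap.id ℝ E + s • M).det) (Set.Icc 0 t) := by
    apply Continuous.continuousOn
    exact ContinuousLinearMap.continuous_det.comp (by fun_prop)
  have hm := intermediate_value_Icc' ht hc
  obtain ⟨s, hs, h0⟩ := hm ⟨hneg, by simp [ContinuousLinearMap.det]⟩
  have hs1 : ‖s • M‖ < 1 := by
    rw [norm_smul, Real.norm_eq_abs, abs_of_nonneg hs.1]
    exact lt_of_le_of_lt (mul_le_mul_of_nonneg_right hs.2 (norm_nonneg _)) h
  have hinj : LinearMap.ker ((ContinuousLinearMap.id ℝ E + s • M : E →L[ℝ] E) : E →ₗ[ℝ] E) = ⊥ := by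
    rw [LinearMap.ker_eq_bot']
    intro x hx
    have hx' : x + (s • M) x = 0 := by simpa using hx
    by_contra hne
    have h1 : ‖x‖ = ‖(s • M) x‖ := by
      rw [eq_neg_of_add_eq_zero_left hx', norm_neg, ← eq_neg_of_add_eq_zero_left hx']
    have h2 := (s • M).le_opNorm x
    have h3 : 0 < ‖x‖ := norm_pos_iff.mpr hne
    nlinarith
  have : IsUnit (LinearMap.det ((ContinuousLinearMap.id ℝ E + s • M : E →L[ℝ] E) : E →ₗ[ℝ] E)) := by
    exact (LinearMap.isUnit_iff_isUnit_det _).mp ((LinearMap.isUnit_iff_ker_eq_bot _).mpr hinj)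
  exact this.ne_zero h0

lemma det_zero_of_norm_const (r : E → E) (hr : ContDiff ℝ 1 r) (R : ℝ) (hR : 0 < R)
    (hn : ∀ x, ‖r x‖ = R) (x : E) : (fderiv ℝ r x).det = 0 := by
  by_contra hne
  have hu : IsUnit (LinearMap.det ((fderiv ℝ r x : E →L[ℝ] E) : E →ₗ[ℝ] E)) := by
    exact isUnit_iff_ne_zero.mpr hne
  have hu2 := (LinearMap.isUnit_iff_isUnit_det _).mpr hu
  have hr2 := (LinearMap.isUnit_iff_range_eq_top _).mp hu2
  have hd : HasFDerivAt r (fderiv ℝ r x) x := (hr.differentiable (by simp) x).hasFDerivAt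
  have h1 := hd.norm_sq
  have h2 : HasFDerivAt (fun y => ‖r y‖ ^ 2) (0 : E →L[ℝ] ℝ) x := by
    simp only [hn]
    exact hasFDerivAt_const _ _
  have h3 := h1.unique h2
  obtain ⟨v, hv⟩ : r x ∈ LinearMap.range ((fderiv ℝ r x : E →L[ℝ] E) : E →ₗ[ℝ] E) := by
    rw [hr2]; trivial
  have h4 := congrArg (fun L : E →L[ℝ] ℝ => L v) h3
  simp at h4
  have hv' : (fderiv ℝ r x) v = r x := hv
  rw [hv'] at h4
  simp at h4
  have := hn x
  rw [h4] at this
  simp at this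
  linarith

lemma no_retraction (r : E → E) (hr : ContDiff ℝ 1 r) (R : ℝ) (hR : 0 < R)
    (hn : ∀ x, ‖r x‖ = R) (hid : ∀ x, ‖x‖ = R → r x = x) : False := by
  classical
  borelize E
  let μ : Measure E := Measure.addHaar
  -- Lipschitz constant
  have hcd : Continuous (fderiv ℝ r) := hr.continuous_fderiv (by simp)
  obtain ⟨K, hK0, hK⟩ : ∃ K : ℝ, 0 < K ∧ ∀ x ∈ closedBall (0:E) R,
      ‖fderiv ℝ r x - ContinuousLinearMap.id ℝ E‖ ≤ K := by
    obtain ⟨K, hK⟩ := (isCompact_closedBall (0:E) R).exists_bound_of_continuousOn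
      (f := fun x => fderiv ℝ r x - ContinuousLinearMap.id ℝ E) (by fun_prop)
    exact ⟨max K 1, by positivity, fun x hx => (hK x hx).trans (le_max_left _ _)⟩
  have hdiff : ∀ x, HasFDerivAt (fun x => r x - x) (fderiv ℝ r x - ContinuousLinearMap.id ℝ E) x :=
    fun x => ((hr.differentiable (by simp) x).hasFDerivAt).sub (hasFDerivAt_id x)
  have hlip0 : ∀ x ∈ closedBall (0:E) R, ∀ y ∈ closedBall (0:E) R,
      ‖(r y - y) - (r x - x)‖ ≤ K * ‖y - x‖ := by
    intro x hx y hy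
    exact (convex_closedBall (0:E) R).norm_image_sub_le_of_norm_hasFDerivWithin_le
      (f := fun x => r x - x) (fun z _ => (hdiff z).hasFDerivWithinAt) hK hx hy
  let g : E → E := fun x => if ‖x‖ ≤ R then r x - x else 0
  have hgin : ∀ x, ‖x‖ ≤ R → g x = r x - x := fun x hx => if_pos hx
  have hgout : ∀ x, R ≤ ‖x‖ → g x = 0 := by
    intro x hx
    by_cases h : ‖x‖ ≤ R
    · rw [hgin x h, hid x (le_antisymm h hx), sub_self]
    · exact if_neg h
  have hmix : ∀ x y, ‖x‖ ≤ R → R ≤ ‖y‖ → ‖g x‖ ≤ K * ‖y - x‖ := by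
    intro x y hx hy
    have hc : ContinuousOn (fun s : ℝ => ‖x + s • (y - x)‖) (Set.Icc 0 1) := by fun_prop
    obtain ⟨s, hs, hsR⟩ := intermediate_value_Icc (zero_le_one) hc
      (show R ∈ Set.Icc _ _ from ⟨by simpa using hx, by simpa using hy⟩)
    simp only at hsR
    set z := x + s • (y - x) with hz
    have h1 := hlip0 z (by simp [hsR]) x (by simpa using hx)
    rw [hid z hsR, sub_self, sub_zero] at h1
    rw [hgin x hx]
    refine h1.trans (mul_le_mul_of_nonneg_left ?_ hK0.le)
    have : x - z = -(s • (y - x)) := by rw [hz]; abel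
    rw [this, norm_neg, norm_smul, Real.norm_eq_abs, abs_of_nonneg hs.1]
    exact mul_le_of_le_one_left (norm_nonneg _) hs.2
  have hglip : ∀ x y, ‖g x - g y‖ ≤ K * ‖x - y‖ := by
    intro x y
    rcases le_total ‖x‖ R with hx | hx <;> rcases le_total ‖y‖ R with hy | hy
    · rw [hgin x hx, hgin y hy]
      exact hlip0 y (by simpa using hy) x (by simpa using hx)
    · rw [hgout y hy, sub_zero, norm_sub_rev]; exact hmix x y hx hy
    · rw [hgout x hx, zero_sub, norm_neg]; exact hmix y x hy hx
    · rw [hgout x hx, hgout y hy]; simp; positivity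
  -- small time volumes
  have hvol : ∀ t : ℝ, 0 ≤ t → t < 1 → t * K < 1 →
      ∫ x in ball (0:E) R, (ContinuousLinearMap.id ℝ E +
        t • (fderiv ℝ r x - ContinuousLinearMap.id ℝ E)).det ∂μ = μ.real (ball (0:E) R) := by
    intro t ht ht1 htK
    let ψ : E → E := fun x => x + t • g x
    have hinj : Function.Injective ψ := by
      intro x y hxy
      by_contra hne
      have h3 : 0 < ‖x - y‖ := norm_pos_iff.mpr (sub_ne_zero.mpr hne)
      have h1 : x - y = - (t • (g x - g y)) := by
        have : x + t • g x = y + t • g y := hxy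
        rw [smul_sub]
        have h5 : x = y + t • g y - t • g x := eq_sub_of_add_eq this
        nth_rewrite 1 [h5]
        abel
      have h2 : ‖x - y‖ ≤ t * (K * ‖x - y‖) := by
        calc ‖x - y‖ = t * ‖g x - g y‖ := by
              conv_lhs => rw [h1]
              rw [norm_neg, norm_smul, Real.norm_eq_abs, abs_of_nonneg ht]
          _ ≤ _ := mul_le_mul_of_nonneg_left (hglip x y) ht
      nlinarith
    have hsurj : Function.Surjective ψ := by
      intro y
      have hcon : ContractingWith (Real.toNNReal (t * K)) (fun x => y - t • g x) := by
        refine ⟨by rw [Real.toNNReal_lt_one]; exact htK, LipschitzWith.of_dist_le_mul fun x z => ?_⟩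
        rw [dist_eq_norm, dist_eq_norm, sub_sub_sub_cancel_left, ← smul_sub, norm_smul,
          Real.norm_eq_abs, abs_of_nonneg ht, norm_sub_rev]
        rw [Real.coe_toNNReal _ (by positivity), mul_assoc]
        exact mul_le_mul_of_nonneg_left (hglip x z) ht
      refine ⟨ContractingWith.fixedPoint _ hcon, ?_⟩
      have := hcon.fixedPoint_isFixedPt
      rw [Function.IsFixedPt] at this
      have h2 := sub_eq_iff_eq_add.mp this
      exact h2.symm
    have himg : ψ '' ball 0 R = ball 0 R := by
      ext y
      constructor
      · rintro ⟨x, hx, rfl⟩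
        simp only [mem_ball, dist_zero_right] at hx ⊢
        have : ψ x = (1 - t) • x + t • r x := by
          simp only [ψ, hgin x hx.le]; module
        rw [this]
        calc _ ≤ ‖(1-t) • x‖ + ‖t • r x‖ := norm_add_le _ _
          _ = (1-t) * ‖x‖ + t * R := by
              rw [norm_smul, norm_smul, hn, Real.norm_eq_abs, Real.norm_eq_abs, abs_of_nonneg ht,
                abs_of_nonneg (by linarith)]
          _ < R := by nlinarith
      · intro hy
        obtain ⟨x, rfl⟩ := hsurj y
        refine ⟨x, ?_, rfl⟩
        by_contra hx
        simp only [mem_ball, dist_zero_right, not_lt] at hx hy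
        simp only [ψ, hgout x hx, smul_zero, add_zero] at hy
        linarith
    have hder : ∀ x ∈ ball (0:E) R, HasFDerivWithinAt ψ (ContinuousLinearMap.id ℝ E +
        t • (fderiv ℝ r x - ContinuousLinearMap.id ℝ E)) (ball 0 R) x := by
      intro x hx
      have h1 : HasFDerivWithinAt (fun x => x + t • (r x - x)) (ContinuousLinearMap.id ℝ E +
        t • (fderiv ℝ r x - ContinuousLinearMap.id ℝ E)) (ball 0 R) x :=
        ((hasFDerivAt_id x).add ((hdiff x).const_smul t)).hasFDerivWithinAt
      refine h1.congr (fun y hy => ?_) ?_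
      · simp only [mem_ball, dist_zero_right] at hy
        simp only [ψ, hgin y hy.le]
      · simp only [mem_ball, dist_zero_right] at hx
        simp only [ψ, hgin x hx.le]
    have hcv := lintegral_abs_det_fderiv_eq_addHaar_image μ measurableSet_ball hder hinj.injOn
    rw [himg] at hcv
    have hpos : ∀ x ∈ ball (0:E) R, 0 < (ContinuousLinearMap.id ℝ E +
        t • (fderiv ℝ r x - ContinuousLinearMap.id ℝ E)).det := by
      intro x hx
      apply det_pos_small _ _ ht
      exact lt_of_le_of_lt (mul_le_mul_of_nonneg_left (hK x (ball_subset_closedBall hx)) ht) htK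
    rw [integral_eq_lintegral_of_nonneg_ae]
    · rw [measureReal_def, ← hcv]
      congr 1
      apply setLIntegral_congr_fun measurableSet_ball
      intro x hx
      simp only
      rw [abs_of_pos (hpos x hx)]
    · filter_upwards [ae_restrict_mem measurableSet_ball] with x hx
      exact (hpos x hx).le
    · apply Continuous.aestronglyMeasurable
      exact ContinuousLinearMap.continuous_det.comp (by fun_prop)
  -- Lagrange interpolation
  let d := Module.finrank ℝ E
  let t0 : ℝ := 1 / ((d + 1) * (K + 1))
  let v : ℕ → ℝ := fun i => i * t0
  have ht0 : 0 < t0 := by positivity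
  have hv : Set.InjOn v (Finset.range (d+1)) := by
    intro i _ j _ hij
    have : (i:ℝ) = j := mul_right_cancel₀ ht0.ne' hij
    exact_mod_cast this
  have hvsmall : ∀ i ∈ Finset.range (d+1), 0 ≤ v i ∧ v i < 1 ∧ v i * K < 1 := by
    intro i hi
    have hi' : (i:ℝ) < d + 1 := by exact_mod_cast Finset.mem_range.mp hi
    have h1 : v i * (K + 1) < 1 := by
      have : v i * (K+1) = i / (d+1) := by simp only [v, t0]; field_simp
      rw [this, div_lt_one (by positivity)]; exact hi'
    have h0 : 0 ≤ v i := by positivity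
    refine ⟨h0, ?_, ?_⟩ <;> nlinarith
  have hdet : ∀ x, (fderiv ℝ r x).det = ∑ i ∈ Finset.range (d+1),
      (ContinuousLinearMap.id ℝ E + v i • (fderiv ℝ r x - ContinuousLinearMap.id ℝ E)).det *
        (Lagrange.basis (Finset.range (d+1)) v i).eval 1 := by
    intro x
    obtain ⟨P, hPd, hP⟩ := det_poly (fderiv ℝ r x - ContinuousLinearMap.id ℝ E)
    have h1 := hP 1
    rw [one_smul, add_sub_cancel] at h1
    rw [← h1]
    have hlt : P.degree < (Finset.range (d+1)).card := by
      rw [Finset.card_range]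
      exact lt_of_le_of_lt (degree_le_natDegree) (by exact_mod_cast Nat.lt_succ_of_le hPd)
    conv_lhs => rw [Lagrange.eq_interpolate hv hlt]
    rw [Lagrange.interpolate_apply, eval_finsetSum]
    simp [hP]
  have hI : ∫ x in ball (0:E) R, (fderiv ℝ r x).det ∂μ = μ.real (ball (0:E) R) := by
    simp only [hdet]
    rw [integral_finsetSum]
    · have : ∀ i ∈ Finset.range (d+1), ∫ x in ball (0:E) R, (ContinuousLinearMap.id ℝ E +
          v i • (fderiv ℝ r x - ContinuousLinearMap.id ℝ E)).det *
          (Lagrange.basis (Finset.range (d+1)) v i).eval 1 ∂μ =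
          μ.real (ball (0:E) R) * (Lagrange.basis (Finset.range (d+1)) v i).eval 1 := by
        intro i hi
        rw [integral_mul_const, hvol _ (hvsmall i hi).1 (hvsmall i hi).2.1 (hvsmall i hi).2.2]
      rw [Finset.sum_congr rfl this, ← Finset.mul_sum, ← eval_finsetSum,
        Lagrange.sum_basis hv (by simp)]
      simp
    · intro i _
      have hcont : Continuous (fun x => (ContinuousLinearMap.id ℝ E +
          v i • (fderiv ℝ r x - ContinuousLinearMap.id ℝ E)).det *
          (Lagrange.basis (Finset.range (d+1)) v i).eval 1) :=
        (ContinuousLinearMap.continuous_det.comp (by fun_prop)).mul continuous_const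
      exact (hcont.continuousOn.integrableOn_compact (isCompact_closedBall (0:E) R)).mono_set
        ball_subset_closedBall
  have h0 : ∫ x in ball (0:E) R, (fderiv ℝ r x).det ∂μ = 0 := by
    simp [det_zero_of_norm_const r hr R hR hn]
  rw [h0] at hI
  have hp : 0 < μ.real (ball (0:E) R) := by
    rw [measureReal_def]
    exact ENNReal.toReal_pos (measure_ball_pos μ _ hR).ne' measure_ball_lt_top.ne
  linarith

theorem brouwer_bounded (w : E → E) (hw : Continuous w) (M : ℝ) (hM : ∀ x, ‖w x‖ ≤ M) :
    ∃ x, w x = x := by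
  by_contra hno
  push Not at hno
  have hM0 : 0 ≤ M := (norm_nonneg _).trans (hM 0)
  obtain ⟨η, hη0, hη1, hη⟩ : ∃ η : ℝ, 0 < η ∧ η ≤ 1 ∧ ∀ x ∈ closedBall (0:E) (M+3),
      η ≤ ‖w x - x‖ := by
    obtain ⟨x0, _, hx0⟩ := (isCompact_closedBall (0:E) (M+3)).exists_isMinOn
      ⟨0, by simp; linarith⟩ (f := fun x => ‖w x - x‖) (by fun_prop)
    refine ⟨min ‖w x0 - x0‖ 1, lt_min (norm_pos_iff.mpr (sub_ne_zero.mpr (hno x0))) one_pos,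
      min_le_right _ _, fun x hx => (min_le_left _ _).trans (hx0 hx)⟩
  have hdense := ContinuousMap.dense_setOfPred_contDiff (E := E) (F := E)
  obtain ⟨w', hw', hclose⟩ : ∃ w' : E → E, ContDiff ℝ 1 w' ∧ ∀ x ∈ closedBall (0:E) (M+3),
      ‖w' x - w x‖ < η := by
    have hu : UniformContinuousOn w (cthickening 1 (closedBall (0:E) (M+3))) :=
      (isCompact_closedBall (0:E) (M+3)).cthickening.uniformContinuousOn_of_continuous
        hw.continuousOn
    rcases Metric.uniformContinuousOn_iff.mp hu (η / 2) (half_pos hη0) with ⟨δ, hδ, hfδ⟩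
    rcases hw.exists_contDiff_dist_le_of_forall_mem_ball_dist_le (lt_min one_pos hδ) with ⟨g, hgc, hg⟩
    refine ⟨g, hgc.of_le (by exact_mod_cast le_top), fun x hx => ?_⟩
    rw [← dist_eq_norm]
    refine (hg _ _ fun y hy ↦ ?_).trans_lt (half_lt_self hη0)
    rw [mem_ball, lt_min_iff] at hy
    exact hfδ _ (mem_cthickening_of_dist_le _ x _ _ hx hy.1.le) _
      (self_subset_cthickening _ hx) hy.2 |>.le
  let χ : ContDiffBump (0:E) := ⟨M+1, M+2, by linarith, by linarith⟩
  let u : E → E := fun x => x - χ x • w' x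
  have hu : ContDiff ℝ 1 u := contDiff_id.sub ((χ.contDiff).smul hw')
  have hout : ∀ x, M + 2 ≤ ‖x‖ → u x = x := by
    intro x hx
    have : χ x = 0 := χ.zero_of_le_dist (by simpa using hx)
    simp [u, this]
  have hne : ∀ x, u x ≠ 0 := by
    intro x hx
    rcases le_or_gt (M+2) ‖x‖ with h | h
    · rw [hout x h] at hx
      rw [hx] at h; simp at h; linarith
    · have hxm : x ∈ closedBall (0:E) (M+3) := by simp; linarith
      have h1 := hclose x hxm
      have h2 := hη x hxm
      have h3 : x = χ x • w' x := sub_eq_zero.mp hx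
      have h4 : ‖w' x‖ ≤ M + 1 := by
        have := norm_add_le (w' x - w x) (w x)
        rw [sub_add_cancel] at this
        have := hM x
        linarith
      have h5 : ‖x‖ ≤ M + 1 := by
        rw [h3, norm_smul, Real.norm_eq_abs, abs_of_nonneg χ.nonneg]
        exact (mul_le_of_le_one_left (norm_nonneg _) χ.le_one).trans h4
      have h6 : χ x = 1 := χ.one_of_mem_closedBall (by simpa using h5)
      rw [h6, one_smul] at h3
      rw [← h3, norm_sub_rev] at h1
      linarith
  refine no_retraction (fun x => ((M+2) / ‖u x‖) • u x) ?_ (M+2) (by linarith) ?_ ?_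
  · refine ContDiff.smul ?_ hu
    exact contDiff_const.div (hu.norm ℝ hne) (fun x => norm_ne_zero_iff.mpr (hne x))
  · intro x
    have := norm_pos_iff.mpr (hne x)
    rw [norm_smul, Real.norm_eq_abs, abs_of_nonneg (by positivity)]
    field_simp
  · intro x hx
    simp only [hout x hx.ge, hx]
    rw [div_self (by linarith), one_smul]

end brouwer

end parta

section partb

theorem minimax {V : Type*} [NormedAddCommGroup V] [InnerProductSpace ℝ V] [FiniteDimensional ℝ V]
    (Φ : V → ℝ) (g : V → V) (hΦ : Continuous Φ) (hg : Continuous g) (L : ℝ) (hL : 0 < L)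
    (hdesc : ∀ x h, Φ (x + h) ≤ Φ x + ⟪g x, h⟫ + L / 2 * ‖h‖ ^ 2)
    (R : ℝ) (hco : ∀ x, R ≤ ‖x‖ → 1 ≤ ‖g x‖)
    (Pm : V →L[ℝ] V) (hP : ∀ x, Pm (Pm x) = Pm x) (e : V) (hPe : Pm e = 0)
    (l : V →L[ℝ] ℝ) (hle : l e = 1) (hlP : ∀ x, l (Pm x) = 0)
    (ν : V → ℝ) (hνc : Continuous ν) (hν : ∀ y s, Pm y = y → 0 ≤ s → ν (y + s • e) = s)
    (α β : ℝ) (hα : 0 < α) (hβ : 0 < β)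
    (hΓ : ∀ x, Pm x = 0 → ν x = α → β ≤ Φ x) (τ : ℝ)
    (hbd : ∀ y s, Pm y = y → 0 ≤ s → (s = 0 ∨ τ ≤ ‖y‖ ∨ τ ≤ s) → Φ (y + s • e) ≤ 0) :
    ∃ x, g x = 0 ∧ β ≤ Φ x := by
  by_contra hno
  push Not at hno
  -- lower bound for the gradient
  obtain ⟨δ, hδ, hgδ⟩ : ∃ δ : ℝ, 0 < δ ∧ ∀ x, β ≤ Φ x → δ ≤ ‖g x‖ := by
    let S : Set V := closedBall 0 R ∩ {x | β ≤ Φ x}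
    have hS : IsCompact S := (isCompact_closedBall 0 R).inter_right (isClosed_le continuous_const hΦ)
    rcases S.eq_empty_or_nonempty with h | h
    · refine ⟨1, one_pos, fun x hx => hco x ?_⟩
      by_contra hlt
      have : x ∈ S := ⟨by simp; linarith, hx⟩
      rw [h] at this; exact this
    · obtain ⟨x0, hx0, hmin⟩ := hS.exists_isMinOn h (f := fun x => ‖g x‖) (by fun_prop)
      have h0 : 0 < ‖g x0‖ := by
        rw [norm_pos_iff]
        intro h0
        have := hno x0 h0
        have := hx0.2
        simp at this
        linarith
      refine ⟨min ‖g x0‖ 1, lt_min h0 one_pos, fun x hx => ?_⟩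
      rcases le_or_gt R ‖x‖ with h1 | h1
      · exact (min_le_right _ _).trans (hco x h1)
      · exact (min_le_left _ _).trans (hmin ⟨by simp; linarith, hx⟩)
  let χ : ℝ → ℝ := fun c => max 0 (min 1 (c / β))
  have hχ0 : ∀ c, 0 ≤ χ c := fun c => le_max_left _ _
  have hχ1 : ∀ c, χ c ≤ 1 := fun c => max_le zero_le_one (min_le_left _ _)
  have hχneg : ∀ c, c ≤ 0 → χ c = 0 := fun c hc =>
    max_eq_left ((min_le_right _ _).trans (div_nonpos_of_nonpos_of_nonneg hc hβ.le))
  have hχbig : ∀ c, β ≤ c → χ c = 1 := by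
    intro c hc
    have : 1 ≤ c / β := by rw [le_div_iff₀ hβ]; linarith
    simp [χ, min_eq_left this]
  have hχc : Continuous χ := by fun_prop
  let T : V → V := fun x => x - (χ (Φ x) / L) • g x
  have hTc : Continuous T := by fun_prop
  have hTfix : ∀ x, Φ x ≤ 0 → T x = x := by
    intro x hx; simp [T, hχneg _ hx]
  have hTd : ∀ x, Φ (T x) ≤ Φ x - χ (Φ x) / (2 * L) * ‖g x‖ ^ 2 := by
    intro x
    have h := hdesc x (-((χ (Φ x) / L) • g x))
    rw [← sub_eq_add_neg] at h
    refine h.trans ?_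
    rw [inner_neg_right, inner_smul_right, real_inner_self_eq_norm_sq, norm_neg, norm_smul,
      Real.norm_eq_abs, abs_of_nonneg (div_nonneg (hχ0 _) hL.le)]
    set c := χ (Φ x)
    have hc0 : 0 ≤ c := hχ0 _
    have hc1 : c ≤ 1 := hχ1 _
    have : L / 2 * (c / L * ‖g x‖) ^ 2 = c * (c / (2 * L) * ‖g x‖ ^ 2) := by field_simp
    rw [this]
    have h2 : c / L * ‖g x‖ ^ 2 = 2 * (c / (2 * L) * ‖g x‖ ^ 2) := by field_simp
    rw [h2]
    have h3 : 0 ≤ c / (2 * L) * ‖g x‖ ^ 2 := by positivity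
    nlinarith
  have hTle : ∀ x, Φ (T x) ≤ Φ x := by
    intro x
    have h1 := hTd x
    have h2 : 0 ≤ χ (Φ x) / (2 * L) * ‖g x‖ ^ 2 := by
      have := hχ0 (Φ x); positivity
    linarith
  let κ : ℝ := δ ^ 2 / (2 * L)
  have hκ : 0 < κ := by positivity
  have hiter : ∀ (k : ℕ) x, Φ (T^[k] x) < β ∨ Φ (T^[k] x) ≤ Φ x - k * κ := by
    intro k
    induction k with
    | zero => intro x; right; simp
    | succ k ih =>
      intro x
      rw [Function.iterate_succ_apply']
      set z := T^[k] x with hz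
      rcases ih x with h | h
      · left; exact (hTle z).trans_lt h
      · rcases lt_or_ge (Φ z) β with h1 | h1
        · left; exact (hTle z).trans_lt h1
        · right
          have h2 := hTd z
          rw [hχbig _ h1] at h2
          have h3 := hgδ z h1
          have h4 : κ ≤ 1 / (2 * L) * ‖g z‖ ^ 2 := by
            have : δ ^ 2 ≤ ‖g z‖ ^ 2 := pow_le_pow_left₀ hδ.le h3 2
            simp only [κ]
            rw [one_div_mul_eq_div]
            gcongr
          push_cast
          linarith
  -- the linking
  obtain ⟨M, hM⟩ : ∃ M : ℝ, ∀ (y : V) (s : ℝ), Pm y = y → 0 ≤ s → Φ (y + s • e) ≤ M := by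
    have hcpt : IsCompact ((closedBall (0:V) τ) ×ˢ (Set.Icc (0:ℝ) τ)) :=
      (isCompact_closedBall _ _).prod isCompact_Icc
    obtain ⟨M, hM⟩ := hcpt.exists_bound_of_continuousOn (f := fun p : V × ℝ => Φ (p.1 + p.2 • e))
      (by fun_prop)
    refine ⟨max M 0, fun y s hy hs => ?_⟩
    by_cases h : τ ≤ ‖y‖ ∨ τ ≤ s
    · exact (hbd y s hy hs (Or.inr h)).trans (le_max_right _ _)
    · push Not at h
      refine le_trans (le_trans (le_abs_self _) (hM (y, s) ⟨by simp; linarith, hs, h.2.le⟩))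
        (le_max_left _ _)
  obtain ⟨K, hK⟩ := exists_nat_gt ((M - β) / κ)
  rw [div_lt_iff₀ hκ] at hK
  let ψ : V → V := T^[K]
  have hψc : Continuous ψ := hTc.iterate K
  have hψfix : ∀ x, Φ x ≤ 0 → ψ x = x := fun x hx =>
    Function.iterate_fixed (hTfix x hx) K
  have hψlow : ∀ (y : V) (s : ℝ), Pm y = y → 0 ≤ s → Φ (ψ (y + s • e)) < β := by
    intro y s hy hs
    rcases hiter K (y + s • e) with h | h
    · exact h
    · have := hM y s hy hs
      exact lt_of_le_of_lt h (by linarith)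
  let k : V × ℝ → V := fun p => p.1 + p.2 • e - Pm (ψ (p.1 + p.2 • e))
    - (ν (ψ (p.1 + p.2 • e))) • e + α • e
  have hkc : Continuous k := by fun_prop
  have hkout : ∀ y s, Pm y = y → 0 ≤ s → (s = 0 ∨ τ ≤ ‖y‖ ∨ τ ≤ s) → k (y, s) = α • e := by
    intro y s hy hs h
    have h1 := hψfix _ (hbd y s hy hs h)
    simp only [k, h1, hν y s hy hs, map_add, map_smul, hPe, hy]
    simp
  let w : V → V := fun x => k (Pm x, max (l x) 0)
  have hwc : Continuous w := by fun_prop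
  obtain ⟨B, hB⟩ : ∃ B : ℝ, ∀ x, ‖w x‖ ≤ B := by
    have hcpt : IsCompact ((closedBall (0:V) τ) ×ˢ (Set.Icc (0:ℝ) τ)) :=
      (isCompact_closedBall _ _).prod isCompact_Icc
    obtain ⟨M, hM⟩ := hcpt.exists_bound_of_continuousOn (f := k) (by fun_prop)
    refine ⟨max M ‖α • e‖, fun x => ?_⟩
    by_cases h : τ ≤ ‖Pm x‖ ∨ τ ≤ max (l x) 0
    · simp only [w]
      rw [hkout _ _ (hP x) (le_max_right _ _) (Or.inr h)]
      exact le_max_right _ _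
    · push Not at h
      exact (hM _ ⟨by simp; linarith, le_max_right _ _, h.2.le⟩).trans (le_max_left _ _)
  obtain ⟨x, hx⟩ := brouwer_bounded w hwc B hB
  set y := Pm x with hy
  set s := max (l x) 0 with hs
  have hPy : Pm y = y := hP x
  have hs0 : 0 ≤ s := le_max_right _ _
  have hxk : k (y, s) = x := hx
  have h1 : Pm (ψ (y + s • e)) = 0 := by
    have := congrArg Pm hxk
    simp only [k, map_add, map_sub, map_smul, hPe, hPy, hP, smul_zero, add_zero, sub_zero] at this
    rw [← hy] at this
    simpa using this
  have h2 : s - ν (ψ (y + s • e)) + α = l x := by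
    have := congrArg l hxk
    simp only [k, map_add, map_sub, map_smul, hle, hlP] at this
    have h3 : l y = 0 := hlP x
    simpa [h3] using this
  have h3 : ν (ψ (y + s • e)) = α := by
    rcases le_or_gt 0 (l x) with h | h
    · rw [hs, max_eq_left h] at h2 ⊢
      linarith
    · have hs00 : s = 0 := max_eq_right h.le
      have h4 := hψfix _ (hbd y s hPy hs0 (Or.inl hs00))
      rw [h4, hν y s hPy hs0] at h2
      linarith
  have := hψlow y s hPy hs0
  have := hΓ _ h1 h3
  linarith


end partb

section partc

structure HS (E : Type*) [NormedAddCommGroup E] [InnerProductSpace ℝ E] where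
  J : E →L[ℝ] E
  P : E →L[ℝ] E
  J2 : ∀ x, J (J x) = -x
  Js : ∀ x y, ⟪J x, y⟫ = -⟪x, J y⟫
  PP : ∀ x, P (P x) = P x
  Ps : ∀ x y, ⟪P x, y⟫ = ⟪x, P y⟫
  PJ : ∀ x, P (J x) = J (P x)
  e1 : E
  e1n : ‖e1‖ = 1
  Pe1 : P e1 = e1
  b1 : ℝ
  b2 : ℝ
  b1l : 2 * Real.pi < b1
  b1u : b1 < 4 * Real.pi
  b2l : 0 < b2
  b2u : b2 < 2 * Real.pi
  G : E → ℝ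
  G' : E → E
  hG : ∀ z, HasFDerivAt G (innerSL ℝ (G' z)) z
  LG : ℝ
  LG0 : 0 < LG
  hLG : ∀ z w, ‖G' z - G' w‖ ≤ LG * ‖z - w‖
  CG : ℝ
  CG0 : 0 < CG
  hCG : ∀ z, ‖G' z‖ ≤ CG
  ρ : ℝ
  ρ0 : 0 < ρ
  Hnn : ∀ z, 0 ≤ (1/2) * ⟪b1 • P z + b2 • (z - P z), z⟫ + G z
  Hz : ∀ z, ‖z‖ < ρ → (1/2) * ⟪b1 • P z + b2 • (z - P z), z⟫ + G z = 0

namespace HS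
variable {E : Type*} [NormedAddCommGroup E] [InnerProductSpace ℝ E] [FiniteDimensional ℝ E]
  (S : HS E)

def B : E →L[ℝ] E := S.b1 • S.P + S.b2 • (ContinuousLinearMap.id ℝ E - S.P)

lemma B_apply (z : E) : S.B z = S.b1 • S.P z + S.b2 • (z - S.P z) := by simp [B]

def H (z : E) : ℝ := (1/2) * ⟪S.B z, z⟫ + S.G z
def H' (z : E) : E := S.B z + S.G' z

lemma H_nonneg (z : E) : 0 ≤ S.H z := by unfold H; rw [B_apply]; exact S.Hnn z
lemma H_zero (z : E) (h : ‖z‖ < S.ρ) : S.H z = 0 := by unfold H; rw [B_apply]; exact S.Hz z h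

lemma G_diff : Differentiable ℝ S.G := fun z => (S.hG z).differentiableAt
lemma G_cont : Continuous S.G := S.G_diff.continuous
lemma G'_cont : Continuous S.G' := by
  have : LipschitzWith (Real.toNNReal S.LG) S.G' := LipschitzWith.of_dist_le_mul fun x y => by
    rw [dist_eq_norm, dist_eq_norm, Real.coe_toNNReal _ S.LG0.le]; exact S.hLG x y
  exact this.continuous
lemma H_cont : Continuous S.H := by
  have := S.G_cont
  unfold H; fun_prop
lemma H'_cont : Continuous S.H' := by
  have := S.G'_cont
  unfold H'; fun_prop

lemma Bs (x y : E) : ⟪S.B x, y⟫ = ⟪x, S.B y⟫ := by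
  simp only [B_apply, inner_add_left, inner_add_right, inner_smul_left, inner_smul_right,
    inner_sub_left, inner_sub_right, S.Ps]
  simp

lemma BJ (x : E) : S.B (S.J x) = S.J (S.B x) := by
  simp only [B_apply, map_add, map_smul, map_sub, S.PJ]

lemma G_taylor (z h : E) : |S.G (z + h) - S.G z - ⟪S.G' z, h⟫| ≤ S.LG * ‖h‖ ^ 2 := by
  have h1 := (convex_segment z (z+h)).norm_image_sub_le_of_norm_hasFDerivWithin_le'
    (f := S.G) (f' := fun w => innerSL ℝ (S.G' w)) (C := S.LG * ‖h‖)
    (φ := innerSL ℝ (S.G' z)) (x := z) (y := z + h)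
    (fun w _ => (S.hG w).hasFDerivWithinAt) ?_ (left_mem_segment ℝ _ _)
    (right_mem_segment ℝ _ _)
  · simp only [add_sub_cancel_left, innerSL_apply_apply, Real.norm_eq_abs] at h1
    rw [pow_two, ← mul_assoc]
    exact h1
  · intro w hw
    rw [← map_sub, innerSL_apply_norm]
    refine (S.hLG w z).trans (mul_le_mul_of_nonneg_left ?_ S.LG0.le)
    rw [segment_eq_image'] at hw
    obtain ⟨θ, hθ, rfl⟩ := hw
    simp only [add_sub_cancel_left, norm_smul, Real.norm_eq_abs, abs_of_nonneg hθ.1]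
    exact mul_le_of_le_one_left (norm_nonneg _) hθ.2

lemma G_zero : S.G 0 = 0 := by
  have := S.Hz 0 (by simpa using S.ρ0)
  simpa using this

lemma G_bound (z : E) : |S.G z| ≤ S.CG * ‖z‖ := by
  have h1 := (convex_univ (𝕜 := ℝ) (E := E)).norm_image_sub_le_of_norm_hasFDerivWithin_le
    (f := S.G) (f' := fun w => innerSL ℝ (S.G' w)) (C := S.CG)
    (fun w _ => (S.hG w).hasFDerivWithinAt) (fun w _ => by
      rw [innerSL_apply_norm]; exact S.hCG w) (Set.mem_univ 0) (Set.mem_univ z)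
  simpa [S.G_zero] using h1

lemma B_lower (z : E) : S.b2 * ‖z‖ ^ 2 ≤ ⟪S.B z, z⟫ := by
  have h1 : ⟪S.B z, z⟫ = (S.b1 - S.b2) * ‖S.P z‖ ^ 2 + S.b2 * ‖z‖ ^ 2 := by
    rw [B_apply, ← real_inner_self_eq_norm_sq z, ← real_inner_self_eq_norm_sq (S.P z), S.Ps (z) (S.P z), S.PP]
    simp only [inner_add_left, inner_smul_left, inner_sub_left, S.Ps]
    simp; ring
  have := S.b1l
  have := S.b2u
  rw [h1]
  nlinarith [sq_nonneg ‖S.P z‖]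

/-- spectral gap -/
lemma gap : ∃ δ : ℝ, 0 < δ ∧ ∀ (k : ℤ) (z : E), δ * ‖z‖ ≤ ‖(2 * Real.pi * k) • z - S.B z‖ := by
  have hpi := Real.pi_pos
  have b1l := S.b1l
  have b1u := S.b1u
  have b2l := S.b2l
  have b2u := S.b2u
  let δ := min (min (S.b1 - 2 * Real.pi) (4 * Real.pi - S.b1)) (min S.b2 (2 * Real.pi - S.b2))
  have hδ : 0 < δ := by
    simp only [δ, lt_min_iff]; refine ⟨⟨?_, ?_⟩, ?_, ?_⟩ <;> linarith
  have hδ1 : δ ≤ S.b1 - 2 * Real.pi := (min_le_left _ _).trans (min_le_left _ _)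
  have hδ2 : δ ≤ 4 * Real.pi - S.b1 := (min_le_left _ _).trans (min_le_right _ _)
  have hδ3 : δ ≤ S.b2 := (min_le_right _ _).trans (min_le_left _ _)
  have hδ4 : δ ≤ 2 * Real.pi - S.b2 := (min_le_right _ _).trans (min_le_right _ _)
  refine ⟨δ, hδ, fun k z => ?_⟩
  have h1 : δ ^ 2 ≤ (2 * Real.pi * k - S.b1) ^ 2 := by
    rcases le_or_gt k 1 with h | h
    · have : (k:ℝ) ≤ 1 := by exact_mod_cast h
      have : δ ≤ S.b1 - 2 * Real.pi * k := by nlinarith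
      nlinarith
    · have : (2:ℝ) ≤ k := by exact_mod_cast h
      have : δ ≤ 2 * Real.pi * k - S.b1 := by nlinarith
      nlinarith
  have h2 : δ ^ 2 ≤ (2 * Real.pi * k - S.b2) ^ 2 := by
    rcases le_or_gt k 0 with h | h
    · have : (k:ℝ) ≤ 0 := by exact_mod_cast h
      have : δ ≤ S.b2 - 2 * Real.pi * k := by nlinarith
      nlinarith
    · have : (1:ℝ) ≤ k := by exact_mod_cast h
      have : δ ≤ 2 * Real.pi * k - S.b2 := by nlinarith
      nlinarith
  have horth : ⟪S.P z, z - S.P z⟫ = 0 := by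
    rw [inner_sub_right, S.Ps, S.Ps, S.PP, sub_self]
  have hz : ‖z‖ ^ 2 = ‖S.P z‖ ^ 2 + ‖z - S.P z‖ ^ 2 := by
    have := norm_add_sq_real (S.P z) (z - S.P z)
    rw [horth, add_sub_cancel] at this
    linarith
  have hD : (2 * Real.pi * k) • z - S.B z =
      (2 * Real.pi * k - S.b1) • S.P z + (2 * Real.pi * k - S.b2) • (z - S.P z) := by
    rw [B_apply]; module
  have hn : ‖(2 * Real.pi * k) • z - S.B z‖ ^ 2 =
      (2 * Real.pi * k - S.b1) ^ 2 * ‖S.P z‖ ^ 2 + (2 * Real.pi * k - S.b2) ^ 2 * ‖z - S.P z‖ ^ 2 := by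
    rw [hD, norm_add_sq_real, inner_smul_left, inner_smul_right, horth, norm_smul, norm_smul,
      mul_pow, mul_pow, Real.norm_eq_abs, Real.norm_eq_abs, sq_abs, sq_abs]
    simp
  apply le_of_sq_le_sq _ (norm_nonneg _) 
  rw [mul_pow, hn, hz]
  nlinarith [sq_nonneg ‖S.P z‖, sq_nonneg ‖z - S.P z‖]

/-! rotations -/
def rot (θ : ℝ) : E →L[ℝ] E := Real.cos θ • ContinuousLinearMap.id ℝ E + Real.sin θ • S.J

lemma rot_apply (θ : ℝ) (x : E) : S.rot θ x = Real.cos θ • x + Real.sin θ • S.J x := by simp [rot]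

lemma rot_zero (x : E) : S.rot 0 x = x := by simp [rot_apply]

lemma rot_add (a b : ℝ) (x : E) : S.rot (a + b) x = S.rot a (S.rot b x) := by
  simp only [rot_apply, Real.cos_add, Real.sin_add, map_add, map_smul, S.J2]
  module

lemma rot_inner (θ : ℝ) (x y : E) : ⟪S.rot θ x, y⟫ = ⟪x, S.rot (-θ) y⟫ := by
  simp only [rot_apply, inner_add_left, inner_add_right, inner_smul_left, inner_smul_right, S.Js,
    Real.cos_neg, Real.sin_neg]
  simp

lemma rot_norm (θ : ℝ) (x : E) : ‖S.rot θ x‖ = ‖x‖ := by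
  have : ‖S.rot θ x‖ ^ 2 = ‖x‖ ^ 2 := by
    rw [← real_inner_self_eq_norm_sq, ← real_inner_self_eq_norm_sq, rot_inner, ← rot_add]
    simp [rot_zero]
  exact (pow_left_inj₀ (norm_nonneg _) (norm_nonneg _) two_ne_zero).mp this

lemma rot_period (k : ℤ) (t : ℝ) : S.rot (2 * Real.pi * k * (t + 1)) = S.rot (2 * Real.pi * k * t) := by
  have : 2 * Real.pi * k * (t + 1) = 2 * Real.pi * k * t + k * (2 * Real.pi) := by ring
  unfold rot
  rw [this, Real.cos_add_int_mul_two_pi, Real.sin_add_int_mul_two_pi]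

lemma rot_hasDeriv (c t : ℝ) (x : E) :
    HasDerivAt (fun t => S.rot (c * t) x) (c • S.J (S.rot (c * t) x)) t := by
  simp only [rot_apply, map_add, map_smul, S.J2]
  have h1 : HasDerivAt (fun t : ℝ => c * t) c t := by simpa using (hasDerivAt_id t).const_mul c
  have := (h1.cos.smul_const x).add (h1.sin.smul_const (S.J x))
  refine this.congr_deriv ?_
  module

lemma rot_cont : Continuous (fun p : ℝ × E => S.rot p.1 p.2) := by
  simp only [rot_apply]; fun_prop

lemma rot_cont' {X : Type*} [TopologicalSpace X] {a : X → ℝ} {f : X → E} (ha : Continuous a)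
    (hf : Continuous f) : Continuous (fun x => S.rot (a x) (f x)) := by
  simp only [rot_apply]; fun_prop

lemma B_rot (θ : ℝ) (x : E) : S.B (S.rot θ x) = S.rot θ (S.B x) := by
  simp only [rot_apply, map_add, map_smul, BJ]

lemma rot_integral (k : ℤ) (hk : k ≠ 0) (x : E) : ∫ t in (0:ℝ)..1, S.rot (2 * Real.pi * k * t) x = 0 := by
  have hne : (2 * Real.pi * k : ℝ) ≠ 0 := by
    have : (k:ℝ) ≠ 0 := by exact_mod_cast hk
    have := Real.pi_pos.ne'
    positivity
  have hd : ∀ t ∈ Set.uIcc (0:ℝ) 1, HasDerivAt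
      (fun t => S.rot (2 * Real.pi * k * t) (-(2 * Real.pi * k : ℝ)⁻¹ • S.J x))
      (S.rot (2 * Real.pi * k * t) x) t := by
    intro t _
    convert S.rot_hasDeriv (2 * Real.pi * k) t (-(2 * Real.pi * k : ℝ)⁻¹ • S.J x) using 1
    simp only [rot_apply, map_add, map_smul, S.J2, map_neg, neg_smul, smul_neg, smul_add, smul_smul]
    field_simp
    simp [add_comm]
  rw [intervalIntegral.integral_eq_sub_of_hasDerivAt hd]
  · have := S.rot_period k 0
    simp only [zero_add] at this
    rw [this, sub_self]
  · exact (S.rot_cont' (by fun_prop) continuous_const).intervalIntegrable _ _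

end HS

end partc

section partd
namespace HS
variable {E : Type*} [NormedAddCommGroup E] [InnerProductSpace ℝ E] [FiniteDimensional ℝ E]
  (S : HS E) {ι : Type*} [Fintype ι] (k : ι → ℤ)

def ev (x : ι → E) (t : ℝ) : E := ∑ i, S.rot (2 * Real.pi * k i * t) (x i)

def co (F : ℝ → E) (l : ℤ) : E := ∫ t in (0:ℝ)..1, S.rot (-(2 * Real.pi * l * t)) (F t)

lemma ev_cont (x : ι → E) : Continuous (S.ev k x) := by
  unfold ev
  exact continuous_finsetSum _ fun i _ => S.rot_cont' (by fun_prop) continuous_const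

lemma ev_cont2 {X : Type*} [TopologicalSpace X] {x : X → ι → E} {t : X → ℝ}
    (hx : ∀ i, Continuous (fun a => x a i)) (ht : Continuous t) :
    Continuous (fun a => S.ev k (x a) (t a)) := by
  unfold ev
  exact continuous_finsetSum _ fun i _ => S.rot_cont' (by fun_prop) (hx i)

lemma ev_add (x y : ι → E) (t : ℝ) : S.ev k (fun i => x i + y i) t = S.ev k x t + S.ev k y t := by
  simp [ev, Finset.sum_add_distrib]

lemma ev_B (x : ι → E) (t : ℝ) : S.B (S.ev k x t) = S.ev k (fun i => S.B (x i)) t := by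
  simp [ev, map_sum, B_rot]

lemma ev_period (x : ι → E) (t : ℝ) : S.ev k x (t + 1) = S.ev k x t := by
  simp only [ev, rot_period]

lemma ev_hasDeriv (x : ι → E) (t : ℝ) :
    HasDerivAt (S.ev k x) (S.ev k (fun i => (2 * Real.pi * k i) • S.J (x i)) t) t := by
  have := HasDerivAt.fun_sum (u := Finset.univ) (fun i _ => S.rot_hasDeriv (2 * Real.pi * k i) t (x i))
  refine this.congr_deriv ?_
  unfold ev
  refine Finset.sum_congr rfl fun i _ => ?_
  simp only [rot_apply, map_add, map_smul]

lemma ev_norm_le (x : ι → E) (t : ℝ) : ‖S.ev k x t‖ ≤ ∑ i, ‖x i‖ := by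
  unfold ev
  refine (norm_sum_le _ _).trans (le_of_eq ?_)
  simp [rot_norm]

lemma inner_ev (F : ℝ → E) (hF : Continuous F) (y : ι → E) :
    ∫ t in (0:ℝ)..1, ⟪F t, S.ev k y t⟫ = ∑ i, ⟪S.co F (k i), y i⟫ := by
  have h1 : ∀ t, ⟪F t, S.ev k y t⟫ = ∑ i, ⟪y i, S.rot (-(2 * Real.pi * k i * t)) (F t)⟫ := by
    intro t
    unfold ev
    rw [inner_sum]
    refine Finset.sum_congr rfl fun i _ => ?_
    rw [real_inner_comm, rot_inner]
  have hc : ∀ i, Continuous (fun t => S.rot (-(2 * Real.pi * k i * t)) (F t)) := fun i =>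
    S.rot_cont' (by fun_prop) hF
  simp only [h1]
  rw [intervalIntegral.integral_finsetSum]
  · refine Finset.sum_congr rfl fun i _ => ?_
    have := ContinuousLinearMap.intervalIntegral_comp_comm (innerSL ℝ (y i))
      ((hc i).intervalIntegrable (μ := MeasureTheory.volume) 0 1)
    simp only [innerSL_apply_apply] at this
    rw [this, real_inner_comm]
    rfl
  · intro i _
    exact (continuous_const.inner (hc i)).intervalIntegrable _ _

lemma co_ev (hk : Function.Injective k) (x : ι → E) (i : ι) : S.co (S.ev k x) (k i) = x i := by
  classical
  unfold co ev
  have h1 : ∀ t : ℝ, S.rot (-(2 * Real.pi * k i * t)) (∑ j, S.rot (2 * Real.pi * k j * t) (x j)) =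
      ∑ j, S.rot (2 * Real.pi * ((k j - k i : ℤ) : ℝ) * t) (x j) := by
    intro t
    rw [map_sum]
    refine Finset.sum_congr rfl fun j _ => ?_
    rw [← rot_add]
    congr 2
    push_cast; ring
  simp only [h1]
  rw [intervalIntegral.integral_finsetSum]
  · rw [Finset.sum_eq_single i]
    · simp [rot_zero]
    · intro j _ hj
      exact S.rot_integral _ (sub_ne_zero.mpr fun h => hj (hk h)) _
    · simp
  · intro j _
    exact (S.rot_cont' (by fun_prop) continuous_const).intervalIntegrable _ _

lemma inner_ev_ev (hk : Function.Injective k) (x y : ι → E) :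
    ∫ t in (0:ℝ)..1, ⟪S.ev k x t, S.ev k y t⟫ = ∑ i, ⟪x i, y i⟫ := by
  rw [S.inner_ev k _ (S.ev_cont k x)]
  simp only [S.co_ev k hk]

lemma norm_ev (hk : Function.Injective k) (x : ι → E) :
    ∫ t in (0:ℝ)..1, ‖S.ev k x t‖ ^ 2 = ∑ i, ‖x i‖ ^ 2 := by
  have := S.inner_ev_ev k hk x x
  simpa only [real_inner_self_eq_norm_sq] using this

lemma int_le_one {f : ℝ → ℝ} {c : ℝ} (hf : Continuous f) (h : ∀ t, f t ≤ c) :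
    ∫ t in (0:ℝ)..1, f t ≤ c := by
  have := intervalIntegral.integral_mono (μ := MeasureTheory.volume) (zero_le_one (α := ℝ)) (hf.intervalIntegrable 0 1)
    (continuous_const.intervalIntegrable 0 1) h
  simpa using this

lemma int_mono {f g : ℝ → ℝ} (hf : Continuous f) (hg : Continuous g) (h : ∀ t, f t ≤ g t) :
    ∫ t in (0:ℝ)..1, f t ≤ ∫ t in (0:ℝ)..1, g t :=
  intervalIntegral.integral_mono (zero_le_one) (hf.intervalIntegrable 0 1)
    (hg.intervalIntegrable 0 1) h

lemma norm_co (hk : Function.Injective k) (F : ℝ → E) (hF : Continuous F) :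
    ∑ i, ‖S.co F (k i)‖ ^ 2 ≤ ∫ t in (0:ℝ)..1, ‖F t‖ ^ 2 := by
  have h1 := S.inner_ev k F hF (fun i => S.co F (k i))
  simp only [real_inner_self_eq_norm_sq] at h1
  have h2 := S.norm_ev k hk (fun i => S.co F (k i))
  have hc := S.ev_cont k (fun i => S.co F (k i))
  have h3 : ∫ t in (0:ℝ)..1, ⟪F t, S.ev k (fun i => S.co F (k i)) t⟫ ≤
      ∫ t in (0:ℝ)..1, ((1/2) * ‖F t‖ ^ 2 + (1/2) * ‖S.ev k (fun i => S.co F (k i)) t‖ ^ 2) := by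
    refine int_mono (by fun_prop) (by fun_prop) fun t => ?_
    have := real_inner_le_norm (F t) (S.ev k (fun i => S.co F (k i)) t)
    nlinarith [sq_nonneg (‖F t‖ - ‖S.ev k (fun i => S.co F (k i)) t‖)]
  rw [intervalIntegral.integral_add, intervalIntegral.integral_const_mul,
    intervalIntegral.integral_const_mul, h2, h1] at h3
  · linarith
  · exact Continuous.intervalIntegrable (by fun_prop) _ _
  · exact Continuous.intervalIntegrable (by fun_prop) _ _

lemma int_norm_ev (hk : Function.Injective k) (x : ι → E) :
    ∫ t in (0:ℝ)..1, ‖S.ev k x t‖ ≤ Real.sqrt (∑ i, ‖x i‖ ^ 2) := by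
  set A := Real.sqrt (∑ i, ‖x i‖ ^ 2) with hA
  have hA2 : A ^ 2 = ∑ i, ‖x i‖ ^ 2 := Real.sq_sqrt (Finset.sum_nonneg fun i _ => by positivity)
  have hA0 : 0 ≤ A := Real.sqrt_nonneg _
  have hc := S.ev_cont k x
  rcases hA0.eq_or_lt with h0 | h0
  · have : ∀ i, x i = 0 := by
      intro i
      have h1 : ∑ i, ‖x i‖ ^ 2 = 0 := by rw [← hA2, ← h0]; simp
      rw [Finset.sum_eq_zero_iff_of_nonneg (fun i _ => by positivity)] at h1
      simpa using h1 i (Finset.mem_univ i)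
    have h2 : ∀ t, S.ev k x t = 0 := by intro t; simp [ev, this]
    simp [h2, hA0]
  · have h1 : ∫ t in (0:ℝ)..1, ‖S.ev k x t‖ ≤
        ∫ t in (0:ℝ)..1, (A / 2 + (1 / (2 * A)) * ‖S.ev k x t‖ ^ 2) := by
      refine int_mono (by fun_prop) (by fun_prop) fun t => ?_
      have : A / 2 + (1 / (2 * A)) * ‖S.ev k x t‖ ^ 2 - ‖S.ev k x t‖ =
        (1 / (2 * A)) * (A - ‖S.ev k x t‖) ^ 2 := by field_simp; ring
      have h3 : 0 ≤ (1 / (2 * A)) * (A - ‖S.ev k x t‖) ^ 2 := by positivity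
      linarith
    rw [intervalIntegral.integral_add, intervalIntegral.integral_const_mul, S.norm_ev k hk, ← hA2] at h1
    · simp only [intervalIntegral.integral_const] at h1
      have : 1 / (2 * A) * A ^ 2 = A / 2 := by field_simp
      rw [this] at h1
      simp at h1
      linarith
    · exact Continuous.intervalIntegrable (by fun_prop) _ _
    · exact Continuous.intervalIntegrable (by fun_prop) _ _

/-- modulus of continuity -/
lemma ev_modulus (hk : Function.Injective k) (x : ι → E) (C : ℝ)
    (hC : ∑ i, ‖(2 * Real.pi * k i) • x i‖ ^ 2 ≤ C) (ε : ℝ) (hε : 0 < ε) (s t : ℝ)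
    (hs : 0 ≤ s) (hst : s ≤ t) (ht : t ≤ 1) :
    ‖S.ev k x t - S.ev k x s‖ ≤ ε * C + (t - s) / ε := by
  set y : ι → E := fun i => (2 * Real.pi * k i) • S.J (x i) with hy
  have hJn : ∀ z, ‖S.J z‖ = ‖z‖ := by
    intro z
    have : ‖S.J z‖ ^ 2 = ‖z‖ ^ 2 := by
      rw [← real_inner_self_eq_norm_sq, ← real_inner_self_eq_norm_sq, S.Js, S.J2]; simp
    exact (pow_left_inj₀ (norm_nonneg _) (norm_nonneg _) two_ne_zero).mp this
  have hyn : ∑ i, ‖y i‖ ^ 2 ≤ C := by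
    refine le_trans (le_of_eq ?_) hC
    refine Finset.sum_congr rfl fun i _ => ?_
    simp only [hy, norm_smul, hJn]
  have hc := S.ev_cont k y
  have h1 : ∫ u in s..t, S.ev k y u = S.ev k x t - S.ev k x s :=
    intervalIntegral.integral_eq_sub_of_hasDerivAt (fun u _ => S.ev_hasDeriv k x u)
      (hc.intervalIntegrable _ _)
  rw [← h1]
  refine (intervalIntegral.norm_integral_le_integral_norm hst).trans ?_
  have h2 : ∫ u in s..t, ‖S.ev k y u‖ ≤ ∫ u in s..t, (1 / ε + ε * ‖S.ev k y u‖ ^ 2) := by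
    refine intervalIntegral.integral_mono hst ?_ ?_ fun u => ?_
    · exact Continuous.intervalIntegrable (by fun_prop) _ _
    · exact Continuous.intervalIntegrable (by fun_prop) _ _
    · have h5 : 1 / ε + ε * ‖S.ev k y u‖ ^ 2 - ‖S.ev k y u‖ =
        (1 / (2 * ε)) * (1 - ε * ‖S.ev k y u‖) ^ 2 + 1 / (2 * ε) + ε / 2 * ‖S.ev k y u‖ ^ 2 := by
          field_simp; ring
      have h3 : 0 ≤ (1 / (2 * ε)) * (1 - ε * ‖S.ev k y u‖) ^ 2 + 1 / (2 * ε) + ε / 2 * ‖S.ev k y u‖ ^ 2 := by positivity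
      simp only
      linarith
  refine h2.trans ?_
  rw [intervalIntegral.integral_add, intervalIntegral.integral_const_mul]
  · simp only [intervalIntegral.integral_const, smul_eq_mul]
    have h3 : ∫ u in s..t, ‖S.ev k y u‖ ^ 2 ≤ ∫ u in (0:ℝ)..1, ‖S.ev k y u‖ ^ 2 := by
      apply intervalIntegral.integral_mono_interval hs hst ht
      · filter_upwards with u; positivity
      · exact Continuous.intervalIntegrable (by fun_prop) _ _
    rw [S.norm_ev k hk] at h3
    have h4 : ε * ∫ u in s..t, ‖S.ev k y u‖ ^ 2 ≤ ε * C :=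
      mul_le_mul_of_nonneg_left (h3.trans hyn) hε.le
    have : (t - s) * (1 / ε) = (t - s) / ε := by ring
    linarith
  · exact Continuous.intervalIntegrable (by fun_prop) _ _
  · exact Continuous.intervalIntegrable (by fun_prop) _ _

end HS

end partd

section parte
namespace HS
variable {E : Type*} [NormedAddCommGroup E] [InnerProductSpace ℝ E] [FiniteDimensional ℝ E]
  (S : HS E) {ι : Type} [Fintype ι] (k : ι → ℤ)

def Phi (x : ι → E) : ℝ := (∑ i, (Real.pi * k i * ‖x i‖ ^ 2 - (1/2) * ⟪S.B (x i), x i⟫))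
    - ∫ t in (0:ℝ)..1, S.G (S.ev k x t)

def gr (x : ι → E) (i : ι) : E := (2 * Real.pi * k i) • x i - S.B (x i)
    - S.co (fun t => S.G' (S.ev k x t)) (k i)

lemma Gev_cont (x : ι → E) : Continuous (fun t => S.G (S.ev k x t)) := S.G_cont.comp (S.ev_cont k x)
lemma G'ev_cont (x : ι → E) : Continuous (fun t => S.G' (S.ev k x t)) := S.G'_cont.comp (S.ev_cont k x)
lemma Hev_cont (x : ι → E) : Continuous (fun t => S.H (S.ev k x t)) := S.H_cont.comp (S.ev_cont k x)

lemma Phi_eq (hk : Function.Injective k) (x : ι → E) :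
    S.Phi k x = (∑ i, Real.pi * k i * ‖x i‖ ^ 2) - ∫ t in (0:ℝ)..1, S.H (S.ev k x t) := by
  have h1 : ∫ t in (0:ℝ)..1, S.H (S.ev k x t) =
      (1/2) * (∑ i, ⟪S.B (x i), x i⟫) + ∫ t in (0:ℝ)..1, S.G (S.ev k x t) := by
    unfold H
    have hc := S.ev_cont k x
    rw [intervalIntegral.integral_add, intervalIntegral.integral_const_mul]
    · congr 2
      simp only [ev_B]
      exact S.inner_ev_ev k hk _ _
    · exact Continuous.intervalIntegrable (by fun_prop) _ _
    · exact (S.Gev_cont k x).intervalIntegrable _ _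
  rw [h1, Phi, Finset.sum_sub_distrib, Finset.mul_sum]
  ring

lemma Phi_desc (hk : Function.Injective k) (N : ℝ) (hN : ∀ i, (k i : ℝ) ≤ N) (x h : ι → E) :
    S.Phi k (fun i => x i + h i) ≤ S.Phi k x + ∑ i, ⟪S.gr k x i, h i⟫
      + (Real.pi * N + S.LG) * ∑ i, ‖h i‖ ^ 2 := by
  have hI : ∫ t in (0:ℝ)..1, (S.G (S.ev k x t) + ⟪S.G' (S.ev k x t), S.ev k h t⟫
      - S.LG * ‖S.ev k h t‖ ^ 2) ≤ ∫ t in (0:ℝ)..1, S.G (S.ev k (fun i => x i + h i) t) := by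
    have c1 := S.ev_cont k x
    have c2 := S.ev_cont k h
    have c3 := S.Gev_cont k x
    have c4 := S.G'ev_cont k x
    refine int_mono (by fun_prop) (S.Gev_cont k _) fun t => ?_
    rw [ev_add]
    have := (abs_le.mp (S.G_taylor (S.ev k x t) (S.ev k h t))).1
    linarith
  have hJ : ∫ t in (0:ℝ)..1, (S.G (S.ev k x t) + ⟪S.G' (S.ev k x t), S.ev k h t⟫
      - S.LG * ‖S.ev k h t‖ ^ 2) = (∫ t in (0:ℝ)..1, S.G (S.ev k x t))
      + ∑ i, ⟪S.co (fun t => S.G' (S.ev k x t)) (k i), h i⟫ - S.LG * ∑ i, ‖h i‖ ^ 2 := by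
    have c1 := S.ev_cont k x
    have c2 := S.ev_cont k h
    have c3 := S.Gev_cont k x
    have c4 := S.G'ev_cont k x
    rw [intervalIntegral.integral_sub, intervalIntegral.integral_add,
      intervalIntegral.integral_const_mul, S.norm_ev k hk, S.inner_ev k _ c4]
    all_goals exact Continuous.intervalIntegrable (by fun_prop) _ _
  have hS : ∀ i, Real.pi * k i * ‖x i + h i‖ ^ 2 - (1/2) * ⟪S.B (x i + h i), x i + h i⟫ ≤
      (Real.pi * k i * ‖x i‖ ^ 2 - (1/2) * ⟪S.B (x i), x i⟫) +
      (⟪S.gr k x i, h i⟫ + ⟪S.co (fun t => S.G' (S.ev k x t)) (k i), h i⟫)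
      + Real.pi * N * ‖h i‖ ^ 2 := by
    intro i
    have h1 := S.B_lower (h i)
    have h2 : 0 ≤ S.b2 * ‖h i‖ ^ 2 := mul_nonneg S.b2l.le (sq_nonneg _)
    have h3 : Real.pi * k i * ‖h i‖ ^ 2 ≤ Real.pi * N * ‖h i‖ ^ 2 := by
      have := Real.pi_pos
      have := hN i
      gcongr
    have h4 : ⟪S.B (h i), x i⟫ = ⟪S.B (x i), h i⟫ := by rw [S.Bs, real_inner_comm]
    simp only [gr, inner_sub_left, inner_smul_left, map_add, inner_add_left, inner_add_right,
      norm_add_sq_real, h4]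
    simp
    linarith
  have hS2 := Finset.sum_le_sum (s := Finset.univ) fun i _ => hS i
  simp only [Finset.sum_add_distrib, ← Finset.mul_sum] at hS2
  unfold Phi
  have : (Real.pi * N + S.LG) * ∑ i, ‖h i‖ ^ 2 =
    Real.pi * N * ∑ i, ‖h i‖ ^ 2 + S.LG * ∑ i, ‖h i‖ ^ 2 := by ring
  linarith

lemma co_cont_param {X : Type*} [TopologicalSpace X] [FirstCountableTopology X] {x : X → ι → E}
    (hx : ∀ i, Continuous (fun a => x a i)) (l : ℤ) :
    Continuous (fun a => S.co (fun t => S.G' (S.ev k (x a) t)) l) := by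
  unfold co
  apply intervalIntegral.continuous_parametric_intervalIntegral_of_continuous'
  refine S.rot_cont' (by fun_prop) ?_
  refine S.G'_cont.comp (S.ev_cont2 k (x := fun p : X × ℝ => x p.1) (fun i => (hx i).comp continuous_fst) continuous_snd)

lemma gr_cont {X : Type*} [TopologicalSpace X] [FirstCountableTopology X] {x : X → ι → E}
    (hx : ∀ i, Continuous (fun a => x a i)) (i : ι) : Continuous (fun a => S.gr k (x a) i) := by
  have := S.co_cont_param k hx (k i)
  have := hx i
  unfold gr
  fun_prop

lemma Phi_cont {X : Type*} [TopologicalSpace X] [FirstCountableTopology X] {x : X → ι → E}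
    (hx : ∀ i, Continuous (fun a => x a i)) : Continuous (fun a => S.Phi k (x a)) := by
  have : Continuous (fun a => ∫ t in (0:ℝ)..1, S.G (S.ev k (x a) t)) := by
    apply intervalIntegral.continuous_parametric_intervalIntegral_of_continuous'
    exact S.G_cont.comp (S.ev_cont2 k (x := fun p : X × ℝ => x p.1)
      (fun i => (hx i).comp continuous_fst) continuous_snd)
  unfold Phi
  fun_prop

lemma co_bound (hk : Function.Injective k) (x : ι → E) :
    ∑ i, ‖S.co (fun t => S.G' (S.ev k x t)) (k i)‖ ^ 2 ≤ S.CG ^ 2 := by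
  refine (S.norm_co k hk _ (S.G'ev_cont k x)).trans ?_
  have c4 := S.G'ev_cont k x
  refine int_le_one (by fun_prop) fun t => ?_
  have := S.hCG (S.ev k x t)
  gcongr

def CH : ℝ := ‖S.B‖ / 2 + S.CG / S.ρ

lemma CH_pos : 0 < S.CH := by
  have := S.CG0; have := S.ρ0
  unfold CH
  have := norm_nonneg S.B
  positivity

lemma H_le (z : E) : S.H z ≤ S.CH * ‖z‖ ^ 2 := by
  rcases lt_or_ge ‖z‖ S.ρ with h | h
  · rw [S.H_zero z h]
    have := S.CH_pos
    positivity
  · have h1 := (abs_le.mp (S.G_bound z)).2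
    have h2 : ⟪S.B z, z⟫ ≤ ‖S.B‖ * ‖z‖ * ‖z‖ :=
      (real_inner_le_norm _ _).trans (mul_le_mul_of_nonneg_right (S.B.le_opNorm z) (norm_nonneg _))
    have h3 : S.CG * ‖z‖ ≤ S.CG / S.ρ * ‖z‖ ^ 2 := by
      have := S.ρ0; have := S.CG0
      have : S.CG / S.ρ * ‖z‖ ^ 2 = S.CG * ‖z‖ * (‖z‖ / S.ρ) := by field_simp
      rw [this]
      have h5 : 1 ≤ ‖z‖ / S.ρ := by rwa [one_le_div S.ρ0]
      exact le_mul_of_one_le_right (by positivity) h5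
    unfold H CH
    nlinarith

lemma Phi_low (hk : Function.Injective k) (K : ℕ) (hK : 0 < K) (hKC : 4 * S.CH ≤ Real.pi / 2 * K)
    (α : ℝ) (hα : 0 < α) (hαK : K * α ≤ S.ρ / 2) (x : ι → E) (hx : ∀ i, k i ≤ 0 → x i = 0)
    (hxα : ∑ i, (k i : ℝ) * ‖x i‖ ^ 2 = α ^ 2) : Real.pi / 2 * α ^ 2 ≤ S.Phi k x := by
  classical
  have hnn : ∀ i, 0 ≤ (k i : ℝ) * ‖x i‖ ^ 2 := by
    intro i
    rcases le_or_gt (k i) 0 with h | h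
    · simp [hx i h]
    · have : (0:ℝ) < k i := by exact_mod_cast h
      positivity
  have hxi : ∀ i, ‖x i‖ ≤ α := by
    intro i
    rcases le_or_gt (k i) 0 with h | h
    · simp [hx i h, hα.le]
    · have h1 : (1:ℝ) ≤ k i := by exact_mod_cast h
      have h2 := Finset.single_le_sum (fun j _ => hnn j) (Finset.mem_univ i)
      rw [hxα] at h2
      have h3 : ‖x i‖ ^ 2 ≤ α ^ 2 := by nlinarith [sq_nonneg ‖x i‖]
      exact (pow_le_pow_iff_left₀ (norm_nonneg _) hα.le two_ne_zero).mp h3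
  set u : ι → E := fun i => if k i ≤ K then x i else 0 with hu
  set w : ι → E := fun i => if k i ≤ K then 0 else x i with hw
  have huw : ∀ t, S.ev k x t = S.ev k u t + S.ev k w t := by
    intro t
    rw [← ev_add]
    congr 1
    funext i
    by_cases h : k i ≤ K <;> simp [hu, hw, h]
  have hun : ∀ t, ‖S.ev k u t‖ ≤ S.ρ / 2 := by
    intro t
    refine (S.ev_norm_le k u t).trans (le_trans ?_ hαK)
    set s := Finset.univ.filter (fun i => 1 ≤ k i ∧ k i ≤ K) with hs
    have h1 : ∑ i, ‖u i‖ ≤ ∑ i ∈ s, α := by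
      rw [hs, Finset.sum_filter]
      refine Finset.sum_le_sum fun i _ => ?_
      by_cases h2 : k i ≤ K
      · by_cases h3 : 1 ≤ k i
        · simp only [hu, h2, h3, if_true, and_self]; exact hxi i
        · have := hx i (by omega)
          simp [hu, this, h3]
      · simp [hu, h2]
    refine h1.trans ?_
    rw [Finset.sum_const, nsmul_eq_mul]
    have h4 : s.card ≤ K := by
      have := Finset.card_le_card_of_injOn (s := s) (t := Finset.Icc (1:ℤ) K) k
        (by intro i hi; simpa [hs] using hi) (fun a _ b _ h => hk h)
      simpa using this
    have : (s.card : ℝ) ≤ K := by exact_mod_cast h4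
    gcongr
  have hH : ∀ t, S.H (S.ev k x t) ≤ 4 * S.CH * ‖S.ev k w t‖ ^ 2 := by
    intro t
    have hC := S.CH_pos
    rcases lt_or_ge ‖S.ev k x t‖ S.ρ with h | h
    · rw [S.H_zero _ h]; positivity
    · have h1 : ‖S.ev k x t‖ ≤ 2 * ‖S.ev k w t‖ := by
        have h2 := norm_add_le (S.ev k u t) (S.ev k w t)
        rw [← huw] at h2
        have := hun t
        linarith
      refine (S.H_le _).trans ?_
      have : ‖S.ev k x t‖ ^ 2 ≤ (2 * ‖S.ev k w t‖) ^ 2 := by gcongr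
      nlinarith
  have hHi : ∫ t in (0:ℝ)..1, S.H (S.ev k x t) ≤ 4 * S.CH * ∑ i, ‖w i‖ ^ 2 := by
    have c1 := S.ev_cont k w
    have := int_mono (S.Hev_cont k x) (by fun_prop) hH
    rwa [intervalIntegral.integral_const_mul, S.norm_ev k hk] at this
  have hwK : (K:ℝ) * ∑ i, ‖w i‖ ^ 2 ≤ α ^ 2 := by
    rw [← hxα, Finset.mul_sum]
    refine Finset.sum_le_sum fun i _ => ?_
    by_cases h : k i ≤ K
    · simpa [hw, h] using hnn i
    · have : (K:ℝ) ≤ k i := by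
        push Not at h
        exact_mod_cast h.le
      simp only [hw, h, if_false]
      gcongr
  rw [S.Phi_eq k hk]
  have h5 : ∑ i, Real.pi * k i * ‖x i‖ ^ 2 = Real.pi * α ^ 2 := by
    rw [← hxα, Finset.mul_sum]
    exact Finset.sum_congr rfl fun i _ => by ring
  have hw0 : 0 ≤ ∑ i, ‖w i‖ ^ 2 := Finset.sum_nonneg fun i _ => by positivity
  have h6 : 4 * S.CH * ∑ i, ‖w i‖ ^ 2 ≤ Real.pi / 2 * K * ∑ i, ‖w i‖ ^ 2 := by gcongr
  have := Real.pi_pos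
  nlinarith

lemma Phi_neg (hk : Function.Injective k) (x : ι → E) (hx : ∀ i, 0 < k i → x i = 0) : S.Phi k x ≤ 0 := by
  rw [S.Phi_eq k hk]
  have h1 : ∑ i, Real.pi * k i * ‖x i‖ ^ 2 ≤ 0 := by
    refine Finset.sum_nonpos fun i _ => ?_
    rcases lt_or_ge 0 (k i) with h | h
    · simp [hx i h]
    · have : (k i : ℝ) ≤ 0 := by exact_mod_cast h
      have := Real.pi_pos
      have : 0 ≤ Real.pi * ‖x i‖ ^ 2 := by positivity
      nlinarith
  have h2 : 0 ≤ ∫ t in (0:ℝ)..1, S.H (S.ev k x t) :=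
    intervalIntegral.integral_nonneg zero_le_one fun t _ => S.H_nonneg _
  linarith

def kap : ℝ := min (S.b1 / 2 - Real.pi) (S.b2 / 2)

lemma kap_pos : 0 < S.kap := by
  have := S.b1l; have := S.b2l
  unfold kap
  exact lt_min (by linarith) (by linarith)

lemma Phi_up (hk : Function.Injective k) (x : ι → E) (hx : ∀ i, k i ≤ 0 ∨ (k i = 1 ∧ S.P (x i) = x i) ∨ x i = 0) :
    S.Phi k x ≤ - S.kap * (∑ i, ‖x i‖ ^ 2) + S.CG * Real.sqrt (∑ i, ‖x i‖ ^ 2) := by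
  have h1 : ∑ i, (Real.pi * k i * ‖x i‖ ^ 2 - (1/2) * ⟪S.B (x i), x i⟫) ≤ ∑ i, (- S.kap * ‖x i‖ ^ 2) := by
    refine Finset.sum_le_sum fun i _ => ?_
    rcases hx i with h | ⟨h, hp⟩ | h
    · have : (k i : ℝ) ≤ 0 := by exact_mod_cast h
      have hB := S.B_lower (x i)
      have hk2 : S.kap ≤ S.b2 / 2 := min_le_right _ _
      have := Real.pi_pos
      have h5 : 0 ≤ Real.pi * ‖x i‖ ^ 2 := by positivity
      have h6 : S.kap * ‖x i‖ ^ 2 ≤ S.b2 / 2 * ‖x i‖ ^ 2 := by gcongr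
      nlinarith
    · have hk2 : S.kap ≤ S.b1 / 2 - Real.pi := min_le_left _ _
      have h6 : S.kap * ‖x i‖ ^ 2 ≤ (S.b1 / 2 - Real.pi) * ‖x i‖ ^ 2 := by gcongr
      rw [B_apply, hp, h]
      simp [inner_smul_left]
      linarith
    · simp [h]
  have h2 : -(S.CG * Real.sqrt (∑ i, ‖x i‖ ^ 2)) ≤ ∫ t in (0:ℝ)..1, S.G (S.ev k x t) := by
    have h3 := S.int_norm_ev k hk x
    have c1 := S.ev_cont k x
    have h4 : ∫ t in (0:ℝ)..1, (-S.CG) * ‖S.ev k x t‖ ≤ ∫ t in (0:ℝ)..1, S.G (S.ev k x t) := by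
      refine int_mono (by fun_prop) (S.Gev_cont k x) fun t => ?_
      have := (abs_le.mp (S.G_bound (S.ev k x t))).1
      linarith
    rw [intervalIntegral.integral_const_mul] at h4
    have := S.CG0
    nlinarith
  rw [← Finset.mul_sum] at h1
  unfold Phi
  linarith

end HS

end parte

section partf
namespace HS
variable {E : Type*} [NormedAddCommGroup E] [InnerProductSpace ℝ E] [FiniteDimensional ℝ E]
  (S : HS E) {ι : Type} [Fintype ι] (k : ι → ℤ)

lemma sqrt_sum_eq (x : PiLp 2 (fun _ : ι => E)) : Real.sqrt (∑ i, ‖x i‖ ^ 2) = ‖x‖ := by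
  rw [← PiLp.norm_sq_eq_of_L2, Real.sqrt_sq (norm_nonneg _)]

theorem galerkin (hk : Function.Injective k) (i0 : ι) (hi0 : k i0 = 1) (N : ℝ) (hN : ∀ i, (k i : ℝ) ≤ N)
    (K : ℕ) (hK : 0 < K) (hKC : 4 * S.CH ≤ Real.pi / 2 * K)
    (α : ℝ) (hα : 0 < α) (hαK : K * α ≤ S.ρ / 2) :
    ∃ x : ι → E, (∀ i, S.gr k x i = 0) ∧ Real.pi / 2 * α ^ 2 ≤ S.Phi k x := by
  classical
  have hcoord : ∀ i, Continuous (fun x : (PiLp 2 (fun _ : ι => E)) => x i) := fun i => by fun_prop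
  let Φ : (PiLp 2 (fun _ : ι => E)) → ℝ := fun x => S.Phi k x.ofLp
  let g : (PiLp 2 (fun _ : ι => E)) → (PiLp 2 (fun _ : ι => E)) := fun x => WithLp.toLp 2 (S.gr k x.ofLp)
  obtain ⟨δ, hδ, hgap⟩ := S.gap
  have hN1 : 1 ≤ N := by have := hN i0; rw [hi0] at this; simpa using this
  let Pl : (PiLp 2 (fun _ : ι => E)) →ₗ[ℝ] (PiLp 2 (fun _ : ι => E)) :=
    { toFun := fun x => WithLp.toLp 2 (fun i => if k i ≤ 0 then x i else 0)
      map_add' := by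
        intro x y; ext i; by_cases h : k i ≤ 0 <;> simp [h]
      map_smul' := by
        intro c x; ext i; by_cases h : k i ≤ 0 <;> simp [h] }
  let Pm : (PiLp 2 (fun _ : ι => E)) →L[ℝ] (PiLp 2 (fun _ : ι => E)) := LinearMap.toContinuousLinearMap Pl
  have hPm : ∀ (x : (PiLp 2 (fun _ : ι => E))) i, Pm x i = if k i ≤ 0 then x i else 0 := fun x i => rfl
  let e : (PiLp 2 (fun _ : ι => E)) := WithLp.toLp 2 (fun i => if i = i0 then S.e1 else 0)
  have he : ∀ i, e i = if i = i0 then S.e1 else 0 := fun i => rfl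
  let l : (PiLp 2 (fun _ : ι => E)) →L[ℝ] ℝ := innerSL ℝ e
  have hl : ∀ x : (PiLp 2 (fun _ : ι => E)), l x = ⟪S.e1, x i0⟫ := by
    intro x
    simp only [l, innerSL_apply_apply, PiLp.inner_apply, he]
    rw [Finset.sum_eq_single i0]
    · simp
    · intro j _ hj; simp [hj]
    · simp
  let ν : (PiLp 2 (fun _ : ι => E)) → ℝ := fun x => Real.sqrt (∑ i, max (k i : ℝ) 0 * ‖x i‖ ^ 2)
  have hPk : ∀ y : (PiLp 2 (fun _ : ι => E)), Pm y = y → ∀ i, 0 < k i → y i = 0 := by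
    intro y hy i hi
    rw [← hy, hPm, if_neg (by omega)]
  have hmin := minimax Φ g (S.Phi_cont k (x := fun x : (PiLp 2 (fun _ : ι => E)) => x.ofLp) hcoord) ?_ (2 * (Real.pi * N + S.LG)) ?_ ?_
    ((S.CG + 1) / δ) ?_ Pm ?_ e ?_ l ?_ ?_ ν ?_ ?_ α (Real.pi / 2 * α ^ 2) hα
    (by have := Real.pi_pos; positivity) ?_ (S.CG / S.kap) ?_
  · obtain ⟨x, hx, hβ⟩ := hmin
    refine ⟨x.ofLp, fun i => ?_, hβ⟩
    have : (g x) i = 0 := by rw [hx]; rfl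
    exact this
  · -- g continuous
    have : Continuous (fun x : (PiLp 2 (fun _ : ι => E)) => S.gr k x.ofLp) :=
      continuous_pi fun i => S.gr_cont k (x := fun x : (PiLp 2 (fun _ : ι => E)) => x.ofLp) hcoord i
    exact (PiLp.continuous_toLp 2 _).comp this
  · have := Real.pi_pos; have := S.LG0; positivity
  · intro x h
    have := S.Phi_desc k hk N hN x.ofLp h.ofLp
    rw [PiLp.inner_apply, PiLp.norm_sq_eq_of_L2]
    have h2 : 2 * (Real.pi * N + S.LG) / 2 = Real.pi * N + S.LG := by ring
    rw [h2]
    exact this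
  · intro x hx
    let y : (PiLp 2 (fun _ : ι => E)) := WithLp.toLp 2 (fun i => (2 * Real.pi * k i) • x i - S.B (x i))
    let c : (PiLp 2 (fun _ : ι => E)) := WithLp.toLp 2 (fun i => S.co (fun t => S.G' (S.ev k x.ofLp t)) (k i))
    have h1 : g x = y - c := by ext i; rfl
    have hc : ‖c‖ ≤ S.CG := by
      have : ‖c‖ ^ 2 ≤ S.CG ^ 2 := by
        rw [PiLp.norm_sq_eq_of_L2]; exact S.co_bound k hk x.ofLp
      exact (pow_le_pow_iff_left₀ (norm_nonneg _) S.CG0.le two_ne_zero).mp this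
    have hy : δ * ‖x‖ ≤ ‖y‖ := by
      have : (δ * ‖x‖) ^ 2 ≤ ‖y‖ ^ 2 := by
        rw [mul_pow, PiLp.norm_sq_eq_of_L2, PiLp.norm_sq_eq_of_L2, Finset.mul_sum]
        refine Finset.sum_le_sum fun i _ => ?_
        rw [← mul_pow]
        have := hgap (k i) (x i)
        exact pow_le_pow_left₀ (by positivity) this 2
      exact (pow_le_pow_iff_left₀ (by positivity) (norm_nonneg _) two_ne_zero).mp this
    rw [div_le_iff₀ hδ] at hx
    have := norm_sub_norm_le y c
    rw [h1]
    linarith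
  · intro x; ext i; simp only [hPm]; by_cases h : k i ≤ 0 <;> simp [h]
  · ext i; simp only [hPm, he]
    by_cases h : i = i0
    · subst h; simp [hi0]
    · simp [h]
  · rw [hl, he]; simp [S.e1n]
  · intro x; rw [hl, hPm, hi0]; simp
  · exact Real.continuous_sqrt.comp (by fun_prop)
  · intro y s hy hs
    have h1 : ∑ i, max (k i : ℝ) 0 * ‖(y + s • e) i‖ ^ 2 = s ^ 2 := by
      rw [Finset.sum_eq_single i0]
      · simp [hPk y hy i0 (by omega), he, hi0, norm_smul, S.e1n]
      · intro j _ hj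
        rcases lt_or_ge 0 (k j) with h | h
        · simp [hPk y hy j h, he, hj]
        · have : (k j : ℝ) ≤ 0 := by exact_mod_cast h
          simp [max_eq_right this]
      · simp
    simp only [ν]
    rw [h1, Real.sqrt_sq hs]
  · intro x hx hν
    have hx0 : ∀ i, k i ≤ 0 → x i = 0 := by
      intro i hi
      have : Pm x i = 0 := by rw [hx]; rfl
      rwa [hPm, if_pos hi] at this
    refine S.Phi_low k hk K hK hKC α hα hαK x.ofLp hx0 ?_
    have h1 : ∑ i, max (k i : ℝ) 0 * ‖x i‖ ^ 2 = α ^ 2 := by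
      rw [← hν]
      exact (Real.sq_sqrt (Finset.sum_nonneg fun i _ => mul_nonneg (le_max_right _ _) (sq_nonneg _))).symm
    rw [← h1]
    refine Finset.sum_congr rfl fun i _ => ?_
    rcases lt_or_ge 0 (k i) with h | h
    · have : (0:ℝ) ≤ k i := by exact_mod_cast h.le
      rw [max_eq_left this]
    · simp [hx0 i h]
  · intro y s hy hs hcase
    have hv : ∀ i, (y + s • e) i = y i + s • e i := fun i => rfl
    by_cases hs0 : s = 0
    · refine S.Phi_neg k hk _ fun i hi => ?_
      have := hPk y hy i hi
      subst hs0
      simpa using this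
    · have hup := S.Phi_up k hk (y + s • e).ofLp (fun i => by
        rcases lt_or_ge 0 (k i) with h | h
        · right
          by_cases hi : i = i0
          · left; subst hi
            refine ⟨hi0, ?_⟩
            rw [hv, hPk y hy i h, he]
            simp [S.Pe1]
          · right
            rw [hv, hPk y hy i h, he]; simp [hi]
        · left; exact h)
      rw [sqrt_sum_eq, ← PiLp.norm_sq_eq_of_L2] at hup
      refine hup.trans ?_
      have hbig : S.CG / S.kap ≤ ‖y + s • e‖ := by
        rcases hcase with h | h | h
        · exact absurd h hs0
        · refine h.trans ?_
          have : ‖y‖ ^ 2 ≤ ‖y + s • e‖ ^ 2 := by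
            rw [PiLp.norm_sq_eq_of_L2, PiLp.norm_sq_eq_of_L2]
            refine Finset.sum_le_sum fun i _ => ?_
            by_cases hi : i = i0
            · subst hi; rw [hPk y hy i (by omega)]; simp
            · rw [hv, he]; simp [hi]
          exact (pow_le_pow_iff_left₀ (norm_nonneg _) (norm_nonneg _) two_ne_zero).mp this
        · refine h.trans ?_
          have h2 : ‖(y + s • e) i0‖ = s := by
            rw [hv, hPk y hy i0 (by omega), he]; simp [norm_smul, S.e1n, abs_of_nonneg hs]
          refine h2.symm.trans_le ?_
          exact PiLp.norm_apply_le (y + s • e) i0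
      rw [div_le_iff₀ S.kap_pos] at hbig
      have := norm_nonneg (y + s • e)
      nlinarith

end HS

end partf

section partg
namespace HS
variable {E : Type*} [NormedAddCommGroup E] [InnerProductSpace ℝ E] [FiniteDimensional ℝ E]
  (S : HS E)

lemma co_add (F G : ℝ → E) (hF : Continuous F) (hG : Continuous G) (l : ℤ) :
    S.co (fun t => F t + G t) l = S.co F l + S.co G l := by
  unfold co
  simp only [map_add]
  exact intervalIntegral.integral_add ((S.rot_cont' (by fun_prop) hF).intervalIntegrable _ _)
    ((S.rot_cont' (by fun_prop) hG).intervalIntegrable _ _)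

theorem galerkin2 : ∃ β M C : ℝ, 0 < β ∧ 0 ≤ C ∧ ∀ N : ℕ, 1 ≤ N → ∃ X : ℝ → E, Continuous X ∧
    (∀ t, X (t + 1) = X t) ∧ (∀ t, 0 ≤ t → t ≤ 1 → ‖X t‖ ≤ M) ∧
    (∀ ε s t : ℝ, 0 < ε → 0 ≤ s → s ≤ t → t ≤ 1 → ‖X t - X s‖ ≤ ε * C + (t - s) / ε) ∧
    (∀ l : ℤ, |l| ≤ N → (2 * Real.pi * l) • S.co X l = S.co (fun t => S.H' (X t)) l) ∧
    β ≤ ∫ t in (0:ℝ)..1, ((1/2) * ⟪S.H' (X t), X t⟫ - S.H (X t)) := by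
  obtain ⟨δ, hδ, hgap⟩ := S.gap
  obtain ⟨K, hK⟩ := exists_nat_ge (max 1 (4 * S.CH / (Real.pi / 2)))
  have hK1 : (1:ℝ) ≤ K := (le_max_left _ _).trans hK
  have hK2 : 4 * S.CH ≤ Real.pi / 2 * K := by
    have h1 := (le_max_right _ _).trans hK
    rw [div_le_iff₀ (by have := Real.pi_pos; positivity)] at h1
    linarith
  have hK0 : 0 < K := by exact_mod_cast (by linarith : (0:ℝ) < K)
  set α := S.ρ / (2 * K) with hα
  have hα0 : 0 < α := by have := S.ρ0; positivity
  have hαK : K * α ≤ S.ρ / 2 := by rw [hα]; apply le_of_eq; field_simp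
  set C := 2 * ‖S.B‖ ^ 2 * (S.CG / δ) ^ 2 + 2 * S.CG ^ 2 with hC
  refine ⟨Real.pi / 2 * α ^ 2, S.CG / δ + (C + 1), C, by have := Real.pi_pos; positivity, by positivity, ?_⟩
  intro N hN
  let ι := ↥(Finset.Icc (-(N:ℤ)) N)
  let k : ι → ℤ := Subtype.val
  have hk : Function.Injective k := Subtype.val_injective
  let i0 : ι := ⟨1, by simp; omega⟩
  obtain ⟨x, hx, hβ⟩ := S.galerkin k hk i0 rfl N (by
    intro i
    have := (Finset.mem_Icc.mp i.2).2
    show ((i.1 : ℤ) : ℝ) ≤ N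
    exact_mod_cast this) K hK0 hK2 α hα0 hαK
  have hx' : ∀ i, (2 * Real.pi * k i) • x i = S.B (x i) + S.co (fun t => S.G' (S.ev k x t)) (k i) := by
    intro i
    have := hx i
    unfold gr at this
    rw [sub_sub, sub_eq_zero] at this
    exact this
  set c : ι → E := fun i => S.co (fun t => S.G' (S.ev k x t)) (k i) with hc
  have hcb : ∑ i, ‖c i‖ ^ 2 ≤ S.CG ^ 2 := S.co_bound k hk x
  have hxc : ∀ i, ‖x i‖ ≤ ‖c i‖ / δ := by
    intro i
    rw [le_div_iff₀ hδ]
    have h1 := hgap (k i) (x i)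
    rw [hx' i] at h1
    simp only [add_sub_cancel_left] at h1
    linarith
  have hxb : ∑ i, ‖x i‖ ^ 2 ≤ (S.CG / δ) ^ 2 := by
    have h1 : ∑ i, ‖x i‖ ^ 2 ≤ ∑ i, (1 / δ ^ 2) * ‖c i‖ ^ 2 := by
      refine Finset.sum_le_sum fun i _ => ?_
      have := pow_le_pow_left₀ (norm_nonneg _) (hxc i) 2
      rw [div_pow] at this
      rw [one_div, inv_mul_eq_div]; exact this
    rw [← Finset.mul_sum] at h1
    refine h1.trans ?_
    rw [div_pow, one_div, inv_mul_eq_div]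
    gcongr
  have hxC : ∑ i, ‖(2 * Real.pi * k i) • x i‖ ^ 2 ≤ C := by
    have h1 : ∑ i, ‖(2 * Real.pi * k i) • x i‖ ^ 2 ≤ ∑ i, (2 * ‖S.B‖ ^ 2 * ‖x i‖ ^ 2 + 2 * ‖c i‖ ^ 2) := by
      refine Finset.sum_le_sum fun i _ => ?_
      rw [hx' i]
      have h2 : ‖S.B (x i) + c i‖ ≤ ‖S.B‖ * ‖x i‖ + ‖c i‖ :=
        (norm_add_le _ _).trans (by gcongr; exact S.B.le_opNorm _)
      have h3 := pow_le_pow_left₀ (norm_nonneg _) h2 2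
      nlinarith [sq_nonneg (‖S.B‖ * ‖x i‖ - ‖c i‖)]
    rw [Finset.sum_add_distrib, ← Finset.mul_sum, ← Finset.mul_sum] at h1
    refine h1.trans ?_
    rw [hC]
    gcongr
  have hmod := S.ev_modulus k hk x C hxC
  have hXc := S.ev_cont k x
  have hcoH : ∀ i, S.co (fun t => S.H' (S.ev k x t)) (k i) = (2 * Real.pi * k i) • x i := by
    intro i
    unfold H'
    rw [S.co_add (fun t => S.B (S.ev k x t)) _ (S.B.continuous.comp hXc) (S.G'ev_cont k x), hx' i]
    congr 1
    have : (fun t => S.B (S.ev k x t)) = S.ev k (fun i => S.B (x i)) := by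
      funext t; exact S.ev_B k x t
    rw [this, S.co_ev k hk]
  refine ⟨S.ev k x, hXc, S.ev_period k x, ?_, ?_, ?_, ?_⟩
  · intro t ht0 ht1
    have h1 : ∀ s ∈ Set.Icc (0:ℝ) 1, ‖S.ev k x t‖ ≤ ‖S.ev k x s‖ + (C + 1) := by
      intro s hs
      have h2 : ‖S.ev k x t - S.ev k x s‖ ≤ C + 1 := by
        rcases le_total s t with h | h
        · have := hmod 1 one_pos s t hs.1 h ht1
          linarith [hs.1]
        · have := hmod 1 one_pos t s ht0 h hs.2
          rw [norm_sub_rev] at this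
          linarith [hs.2]
      have := norm_sub_norm_le (S.ev k x t) (S.ev k x s)
      linarith
    have h3 : ∫ s in (0:ℝ)..1, ‖S.ev k x t‖ ≤ ∫ s in (0:ℝ)..1, (‖S.ev k x s‖ + (C + 1)) :=
      intervalIntegral.integral_mono_on zero_le_one (continuous_const.intervalIntegrable _ _)
        (Continuous.intervalIntegrable (by fun_prop) _ _) h1
    rw [intervalIntegral.integral_add (Continuous.intervalIntegrable (by fun_prop) _ _)
      (continuous_const.intervalIntegrable _ _)] at h3
    simp only [intervalIntegral.integral_const, sub_zero, one_smul] at h3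
    have h4 := S.int_norm_ev k hk x
    have h5 : Real.sqrt (∑ i, ‖x i‖ ^ 2) ≤ S.CG / δ :=
      Real.sqrt_le_iff.mpr ⟨by have := S.CG0; positivity, hxb⟩
    linarith
  · intro ε s t hε hs hst ht
    exact hmod ε hε s t hs hst ht
  · intro l hl
    let i : ι := ⟨l, by rw [Finset.mem_Icc]; exact abs_le.mp hl⟩
    have := hcoH i
    have h2 := S.co_ev k hk x i
    have hki : k i = l := rfl
    rw [hki] at this h2
    rw [this, h2]
  · refine hβ.trans (le_of_eq ?_)
    rw [S.Phi_eq k hk, intervalIntegral.integral_sub, intervalIntegral.integral_const_mul,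
      S.inner_ev k (fun t => S.H' (S.ev k x t)) (S.H'_cont.comp hXc)]
    · congr 1
      rw [Finset.mul_sum]
      refine Finset.sum_congr rfl fun i _ => ?_
      have := hcoH i
      rw [this, inner_smul_left]
      simp
      ring
    · have := S.H'_cont.comp hXc
      simp only [Function.comp_def] at this
      exact Continuous.intervalIntegrable (by fun_prop) _ _
    · exact (S.Hev_cont k x).intervalIntegrable _ _

end HS

lemma int_tendsto {E F : Type*} [NormedAddCommGroup E] [InnerProductSpace ℝ E] [FiniteDimensional ℝ E]
    [NormedAddCommGroup F] [NormedSpace ℝ F]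
    (Ψ : ℝ → E → F) (hΨ : Continuous (Function.uncurry Ψ)) (X : ℕ → ℝ → E) (hX : ∀ n, Continuous (X n))
    (x : ℝ → E) (M : ℝ) (hM : ∀ n t, ‖X n t‖ ≤ M) (hlim : ∀ t, Filter.Tendsto (fun n => X n t) Filter.atTop (nhds (x t))) :
    Filter.Tendsto (fun n => ∫ t in (0:ℝ)..1, Ψ t (X n t)) Filter.atTop (nhds (∫ t in (0:ℝ)..1, Ψ t (x t))) := by
  obtain ⟨C, hC⟩ := ((isCompact_Icc (a := (0:ℝ)) (b := 1)).prod (isCompact_closedBall (0:E) M)).exists_bound_of_continuousOn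
    hΨ.continuousOn
  refine intervalIntegral.tendsto_integral_filter_of_dominated_convergence (fun _ => C) ?_ ?_ ?_ ?_
  · filter_upwards with n
    exact Continuous.aestronglyMeasurable (hΨ.comp (continuous_id.prodMk (hX n)))
  · filter_upwards with n
    filter_upwards with t ht
    rw [Set.uIoc_of_le zero_le_one] at ht
    exact hC (t, X n t) ⟨⟨ht.1.le, ht.2⟩, by simpa using hM n t⟩
  · exact intervalIntegrable_const
  · filter_upwards with t _
    have : Continuous (Ψ t) := hΨ.comp (continuous_const.prodMk continuous_id)
    exact (this.tendsto _).comp (hlim t)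

/-- Arzela–Ascoli for periodic curves. -/
lemma ascoli {E : Type*} [NormedAddCommGroup E] [InnerProductSpace ℝ E] [FiniteDimensional ℝ E]
    (X : ℕ → ℝ → E) (hX : ∀ n, Continuous (X n)) (hp : ∀ n t, X n (t + 1) = X n t) (M C : ℝ) (hC0 : 0 ≤ C)
    (hM : ∀ n t, 0 ≤ t → t ≤ 1 → ‖X n t‖ ≤ M)
    (hC : ∀ n (ε s t : ℝ), 0 < ε → 0 ≤ s → s ≤ t → t ≤ 1 → ‖X n t - X n s‖ ≤ ε * C + (t - s) / ε) :
    ∃ (x : ℝ → E) (φ : ℕ → ℕ), StrictMono φ ∧ Continuous x ∧ (∀ t, x (t + 1) = x t) ∧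
      (∀ t, Filter.Tendsto (fun n => X (φ n) t) Filter.atTop (nhds (x t))) ∧ (∀ n t, ‖X n t‖ ≤ M) := by
  have hfr : ∀ n t, X n (Int.fract t) = X n t := by
    intro n t
    have hper : Function.Periodic (X n) 1 := hp n
    rw [Int.fract]
    have := hper.sub_int_mul_eq (x := t) ⌊t⌋
    simpa using this
  have hM' : ∀ n t, ‖X n t‖ ≤ M := by
    intro n t
    rw [← hfr]
    exact hM n _ (Int.fract_nonneg t) (Int.fract_lt_one t).le
  let F : ℕ → BoundedContinuousFunction (Set.Icc (0:ℝ) 1) E := fun n =>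
    BoundedContinuousFunction.mkOfCompact ⟨fun t => X n t, (hX n).comp continuous_subtype_val⟩
  have hF : ∀ n t, F n t = X n t := fun n t => rfl
  have hcomp := BoundedContinuousFunction.arzela_ascoli (closedBall (0:E) M) (isCompact_closedBall _ _)
    (Set.range F) (by
      rintro f t ⟨n, rfl⟩
      simpa [hF] using hM' n t) (by
      intro t0
      rw [Metric.equicontinuousAt_iff]
      intro ε hε
      set ε' := ε / (4 * (C + 1)) with hε'
      have h0 : 0 < ε' := by positivity
      refine ⟨ε' * ε / 4, by positivity, ?_⟩
      rintro t ht ⟨_, n, rfl⟩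
      have key : ∀ s t : Set.Icc (0:ℝ) 1, dist s t < ε' * ε / 4 → (s:ℝ) ≤ t → dist (X n s) (X n t) < ε := by
        intro s t hd hst
        have h1 := hC n ε' s t h0 s.2.1 hst t.2.2
        rw [dist_comm, dist_eq_norm]
        rw [Subtype.dist_eq, dist_comm, Real.dist_eq, abs_of_nonneg (by linarith)] at hd
        have h2 : ((t:ℝ) - s) / ε' < ε / 4 := by
          rw [div_lt_iff₀ h0]; linarith
        have h3 : ε' * C ≤ ε / 4 := by
          rw [hε', div_mul_eq_mul_div, div_le_div_iff₀ (by positivity) (by positivity)]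
          nlinarith
        linarith
      show dist (X n t0) (X n t) < ε
      rcases le_total (t0:ℝ) t with h | h
      · exact key t0 t (by rwa [dist_comm]) h
      · rw [dist_comm]; exact key t t0 ht h)
  obtain ⟨g, -, φ, hφ, hg⟩ := hcomp.tendsto_subseq (x := F) (fun n => subset_closure ⟨n, rfl⟩)
  let x : ℝ → E := fun t => g ⟨Int.fract t, Int.fract_nonneg t, (Int.fract_lt_one t).le⟩
  have hu : TendstoUniformly (fun n => X (φ n)) x Filter.atTop := by
    rw [Metric.tendstoUniformly_iff]
    intro ε hε
    rw [Metric.tendsto_atTop] at hg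
    obtain ⟨n0, hn0⟩ := hg ε hε
    filter_upwards [Filter.eventually_ge_atTop n0] with n hn t
    rw [dist_comm, ← hfr]
    refine lt_of_le_of_lt ?_ (hn0 n hn)
    exact BoundedContinuousFunction.dist_coe_le_dist (f := F (φ n)) (g := g) ⟨Int.fract t, _⟩
  refine ⟨x, φ, hφ, hu.continuous (Filter.Frequently.of_forall fun n => hX _), ?_, fun t => hu.tendsto_at t, hM'⟩
  intro t
  simp [x]


end partg

section parth

lemma fourier_const (φ : ℝ → ℝ) (hφ : Continuous φ) (hp : ∀ t, φ (t + 1) = φ t)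
    (hc : ∀ n : ℤ, n ≠ 0 → ∫ t in (0:ℝ)..1, Real.cos (2 * Real.pi * n * t) * φ t = 0)
    (hs : ∀ n : ℤ, n ≠ 0 → ∫ t in (0:ℝ)..1, Real.sin (2 * Real.pi * n * t) * φ t = 0) (t : ℝ) :
    φ t = φ 0 := by
  have : Fact (0 < (1:ℝ)) := ⟨one_pos⟩
  have hper : Function.Periodic (fun t => (φ t : ℂ)) 1 := fun t => by simp [hp]
  let f : C(AddCircle (1:ℝ), ℂ) := ⟨hper.lift, by
    refine continuous_coinduced_dom.mpr ?_
    show Continuous (fun t => (φ t : ℂ))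
    fun_prop⟩
  have hf : ∀ t : ℝ, f (t : AddCircle (1:ℝ)) = (φ t : ℂ) := fun t => rfl
  have hco : ∀ n : ℤ, n ≠ 0 → fourierCoeff f n = 0 := by
    intro n hn
    rw [fourierCoeff_eq_intervalIntegral f n 0]
    simp only [zero_add, one_div, inv_one, one_smul]
    have h1 : ∀ t : ℝ, (@fourier (1:ℝ) (-n) (t : AddCircle (1:ℝ))) • f (t : AddCircle (1:ℝ)) =
        ((Real.cos (2 * Real.pi * n * t) * φ t : ℝ) : ℂ) -
        Complex.I * ((Real.sin (2 * Real.pi * n * t) * φ t : ℝ) : ℂ) := by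
      intro t
      rw [hf, fourier_coe_apply, smul_eq_mul]
      have : (2 * (Real.pi:ℂ) * Complex.I * ((-n : ℤ) : ℂ) * t / ((1:ℝ):ℂ)) =
          ((-(2 * Real.pi * n * t) : ℝ) : ℂ) * Complex.I := by push_cast; ring
      rw [this, Complex.exp_mul_I, ← Complex.ofReal_cos, ← Complex.ofReal_sin, Real.cos_neg, Real.sin_neg]
      push_cast
      ring
    simp only [h1]
    rw [intervalIntegral.integral_sub, intervalIntegral.integral_const_mul,
      intervalIntegral.integral_ofReal, intervalIntegral.integral_ofReal, hc n hn, hs n hn]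
    · simp
    · exact Continuous.intervalIntegrable (by fun_prop) _ _
    · exact Continuous.intervalIntegrable (by fun_prop) _ _
  have hsum : Summable (fourierCoeff f) := summable_of_ne_finset_zero (s := {0}) (fun n hn => hco n (by simpa using hn))
  have hval : ∀ t : ℝ, (φ t : ℂ) = fourierCoeff f 0 := by
    intro t
    have h1 := has_pointwise_sum_fourier_series_of_summable hsum (t : AddCircle (1:ℝ))
    have h2 := hasSum_single (f := fun i => fourierCoeff f i • fourier i (t : AddCircle (1:ℝ))) 0
      (fun n hn => by simp [hco n hn])
    have h3 := h1.unique h2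
    rw [hf] at h3
    simpa using h3
  have := (hval t).trans (hval 0).symm
  exact_mod_cast this

namespace HS
variable {E : Type*} [NormedAddCommGroup E] [InnerProductSpace ℝ E] [FiniteDimensional ℝ E]
  (S : HS E)

lemma co_zero_const (D : ℝ → E) (hD : Continuous D) (hp : ∀ t, D (t + 1) = D t)
    (h : ∀ n : ℤ, n ≠ 0 → S.co D n = 0) (t : ℝ) : D t = D 0 := by
  have hcs : ∀ n : ℤ, S.co D n = (∫ t in (0:ℝ)..1, Real.cos (2 * Real.pi * n * t) • D t) -
      S.J (∫ t in (0:ℝ)..1, Real.sin (2 * Real.pi * n * t) • D t) := by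
    intro n
    rw [← ContinuousLinearMap.intervalIntegral_comp_comm, ← intervalIntegral.integral_sub]
    · unfold co
      congr 1
      funext t
      rw [rot_apply, Real.cos_neg, Real.sin_neg, map_smul]
      module
    all_goals exact Continuous.intervalIntegrable (by fun_prop) _ _
  have hneg : ∀ n : ℤ, S.co D (-n) = (∫ t in (0:ℝ)..1, Real.cos (2 * Real.pi * n * t) • D t) +
      S.J (∫ t in (0:ℝ)..1, Real.sin (2 * Real.pi * n * t) • D t) := by
    intro n
    rw [hcs]
    have h1 : ∀ t : ℝ, 2 * Real.pi * ((-n : ℤ) : ℝ) * t = -(2 * Real.pi * n * t) := by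
      intro t; push_cast; ring
    simp only [h1, Real.cos_neg, Real.sin_neg, neg_smul, intervalIntegral.integral_neg, map_neg, sub_neg_eq_add]
  have hC : ∀ n : ℤ, n ≠ 0 → ∫ t in (0:ℝ)..1, Real.cos (2 * Real.pi * n * t) • D t = 0 := by
    intro n hn
    have h1 := hcs n
    have h2 := hneg n
    rw [h n hn] at h1
    rw [h (-n) (neg_ne_zero.mpr hn)] at h2
    have h3 : (2:ℝ) • ∫ t in (0:ℝ)..1, Real.cos (2 * Real.pi * n * t) • D t = 0 := by
      rw [two_smul]
      have e1 := eq_of_sub_eq_zero h1.symm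
      rw [← e1] at h2
      exact h2.symm
    simpa using h3
  have hS : ∀ n : ℤ, n ≠ 0 → ∫ t in (0:ℝ)..1, Real.sin (2 * Real.pi * n * t) • D t = 0 := by
    intro n hn
    have h1 := hcs n
    rw [h n hn, hC n hn] at h1
    have h2 : S.J (∫ t in (0:ℝ)..1, Real.sin (2 * Real.pi * n * t) • D t) = 0 := by
      simpa using h1.symm
    have h3 := S.J2 (∫ t in (0:ℝ)..1, Real.sin (2 * Real.pi * n * t) • D t)
    rw [h2, map_zero] at h3
    simpa using h3.symm
  refine ext_inner_left ℝ fun e => ?_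
  have key : ∀ (a : ℝ → ℝ), Continuous a → (∫ t in (0:ℝ)..1, a t • D t = 0) →
      ∫ t in (0:ℝ)..1, a t * ⟪e, D t⟫ = 0 := by
    intro a ha h0
    have := ContinuousLinearMap.intervalIntegral_comp_comm (innerSL ℝ e) (f := fun t => a t • D t)
      (μ := MeasureTheory.volume) (a := 0) (b := 1) (Continuous.intervalIntegrable (by fun_prop) _ _)
    rw [h0, map_zero] at this
    simpa [inner_smul_right] using this
  exact fourier_const (fun t => ⟪e, D t⟫) (by fun_prop) (fun t => by simp only [hp])
    (fun n hn => key _ (by fun_prop) (hC n hn)) (fun n hn => key _ (by fun_prop) (hS n hn)) t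

theorem orbit : ∃ x : ℝ → E, (∀ t, x (t + 1) = x t) ∧ (∀ t, HasDerivAt x (S.J (S.H' (x t))) t) ∧
    0 < ∫ t in (0:ℝ)..1, ((1/2) * ⟪S.H' (x t), x t⟫ - S.H (x t)) := by
  obtain ⟨β, M, C, hβ, hC0, hG⟩ := S.galerkin2
  choose X hX hXp hXM hXC hXco hXβ using fun n : ℕ => hG (n + 1) (by omega)
  obtain ⟨x, φ, hφ, hx, hxp, hlim, hM⟩ := ascoli X hX hXp M C hC0 hXM hXC
  have hH' := S.H'_cont
  have hH := S.H_cont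
  have hco : ∀ l : ℤ, (2 * Real.pi * l) • S.co x l = S.co (fun t => S.H' (x t)) l := by
    intro l
    have h1 : Filter.Tendsto (fun n => S.co (X (φ n)) l) Filter.atTop (nhds (S.co x l)) :=
      int_tendsto (fun t z => S.rot (-(2 * Real.pi * l * t)) z)
        (S.rot_cont' (by fun_prop) continuous_snd) (fun n => X (φ n)) (fun n => hX _) x M (fun n => hM _) hlim
    have h2 : Filter.Tendsto (fun n => S.co (fun t => S.H' (X (φ n) t)) l) Filter.atTop
        (nhds (S.co (fun t => S.H' (x t)) l)) :=
      int_tendsto (fun t z => S.rot (-(2 * Real.pi * l * t)) (S.H' z))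
        (S.rot_cont' (by fun_prop) (by fun_prop)) (fun n => X (φ n)) (fun n => hX _) x M (fun n => hM _) hlim
    have h3 := h1.const_smul (2 * Real.pi * l)
    refine tendsto_nhds_unique (h3.congr' ?_) h2
    filter_upwards [Filter.eventually_ge_atTop l.natAbs] with n hn
    refine hXco (φ n) l ?_
    have h4 := hφ.id_le n
    simp only [id] at h4
    push_cast
    rw [Int.abs_eq_natAbs]
    exact_mod_cast (by omega : l.natAbs ≤ φ n + 1)
  have hact : β ≤ ∫ t in (0:ℝ)..1, ((1/2) * ⟪S.H' (x t), x t⟫ - S.H (x t)) := by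
    have h1 := int_tendsto (fun _ z => (1/2) * ⟪S.H' z, z⟫ - S.H z)
      (by
        show Continuous (fun p : ℝ × E => (1/2) * ⟪S.H' p.2, p.2⟫ - S.H p.2)
        fun_prop) (fun n => X (φ n)) (fun n => hX _) x M (fun n => hM _) hlim
    exact ge_of_tendsto' h1 fun n => hXβ _
  set h : ℝ → E := fun t => S.H' (x t) with hh
  have hhc : Continuous h := by fun_prop
  have hhp : ∀ t, h (t + 1) = h t := fun t => by simp only [hh, hxp]
  have hint0 : ∫ t in (0:ℝ)..1, h t = 0 := by
    have := hco 0
    simp [co, rot_zero] at this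
    exact this.symm
  set y : ℝ → E := fun t => ∫ s in (0:ℝ)..t, S.J (h s) with hy
  have hJh : Continuous (fun s => S.J (h s)) := by fun_prop
  have hyd : ∀ t, HasDerivAt y (S.J (h t)) t := fun t =>
    (hJh.integral_hasStrictDerivAt 0 t).hasDerivAt
  have hyc : Continuous y := continuous_iff_continuousAt.mpr fun t => (hyd t).continuousAt
  have hy0 : y 0 = 0 := by simp [hy]
  have hy1 : y 1 = 0 := by
    simp only [hy]
    rw [ContinuousLinearMap.intervalIntegral_comp_comm _ (hhc.intervalIntegrable _ _), hint0, map_zero]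
  have hyp : ∀ t, y (t + 1) = y t := by
    intro t
    have hper : Function.Periodic (fun s => S.J (h s)) 1 := fun s => by simp only [hhp]
    have h1 : y (t + 1) = y t + ∫ s in t..(t+1), S.J (h s) :=
      (intervalIntegral.integral_add_adjacent_intervals (hJh.intervalIntegrable _ _)
        (hJh.intervalIntegrable _ _)).symm
    have h2 := hper.intervalIntegral_add_eq t 0
    rw [zero_add] at h2
    rw [h1, h2]
    have : ∫ s in (0:ℝ)..1, S.J (h s) = y 1 := rfl
    rw [this, hy1, add_zero]
  have hyco : ∀ l : ℤ, (2 * Real.pi * l) • S.co y l = S.co h l := by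
    intro l
    have hd : ∀ t ∈ Set.uIcc (0:ℝ) 1, HasDerivAt (fun t => S.rot (-(2 * Real.pi * l * t)) (y t))
        (S.J (S.rot (-(2 * Real.pi * l * t)) (h t) - (2 * Real.pi * l) • S.rot (-(2 * Real.pi * l * t)) (y t))) t := by
      intro t _
      simp only [rot_apply]
      have h1 : HasDerivAt (fun t : ℝ => -(2 * Real.pi * l * t)) (-(2 * Real.pi * l)) t := by
        have := ((hasDerivAt_id t).const_mul (2 * Real.pi * l)).fun_neg
        simpa using this
      have h2 := (h1.cos.smul (hyd t)).add (h1.sin.smul (S.J.hasFDerivAt.comp_hasDerivAt t (hyd t)))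
      refine h2.congr_deriv ?_
      simp only [map_sub, map_add, map_smul, S.J2]
      simp only [Function.comp_apply]
      module
    have c1 : Continuous (fun t => S.rot (-(2 * Real.pi * l * t)) (h t)) := S.rot_cont' (by fun_prop) hhc
    have c2 : Continuous (fun t => S.rot (-(2 * Real.pi * l * t)) (y t)) := S.rot_cont' (by fun_prop) hyc
    have h1 := intervalIntegral.integral_eq_sub_of_hasDerivAt hd
      (Continuous.intervalIntegrable (by fun_prop) _ _)
    rw [hy0, hy1, map_zero, map_zero, sub_zero, ContinuousLinearMap.intervalIntegral_comp_comm _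
      (Continuous.intervalIntegrable (by fun_prop) _ _), intervalIntegral.integral_sub
      (Continuous.intervalIntegrable (by fun_prop) _ _) (Continuous.intervalIntegrable (by fun_prop) _ _),
      intervalIntegral.integral_smul] at h1
    have h2 := congrArg S.J h1
    rw [S.J2, map_zero, neg_eq_zero, sub_eq_zero] at h2
    exact h2.symm
  have hcoD : ∀ n : ℤ, n ≠ 0 → S.co (fun t => x t - y t) n = 0 := by
    intro n hn
    have h1 : S.co (fun t => x t - y t) n = S.co x n - S.co y n := by
      unfold co
      simp only [map_sub]
      exact intervalIntegral.integral_sub ((S.rot_cont' (by fun_prop) hx).intervalIntegrable _ _)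
        ((S.rot_cont' (by fun_prop) hyc).intervalIntegrable _ _)
    have h2 : (2 * Real.pi * n) • (S.co x n - S.co y n) = 0 := by
      rw [smul_sub, hco n, hyco n, sub_self]
    rw [h1]
    refine (smul_eq_zero.mp h2).resolve_left ?_
    have : (n:ℝ) ≠ 0 := by exact_mod_cast hn
    have := Real.pi_pos.ne'
    positivity
  have hconst := S.co_zero_const (fun t => x t - y t) (by fun_prop) (fun t => by simp only [hxp, hyp]) hcoD
  refine ⟨x, hxp, fun t => ?_, lt_of_lt_of_le hβ hact⟩
  have hxy : x = fun t => y t + x 0 := by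
    funext t
    have := hconst t
    simp only [hy0, sub_zero] at this
    rw [← this]; abel
  have h5 := (hyd t).add_const (x 0)
  rw [← hxy] at h5
  exact h5

end HS

end parth

section parti

lemma exists_kappa (m l s0 : ℝ) (hl : 0 < l) (hm : l * s0 < m) : ∃ κ : ℝ → ℝ, ContDiff ℝ (⊤ : ℕ∞) κ ∧
    Antitone κ ∧ (∀ s, 0 ≤ κ s) ∧ (∀ s ≤ s0, κ s = m - l * s) ∧ (∃ s1, ∀ s, s1 ≤ s → κ s = 0) := by
  set w := m / l - s0 with hw
  have hw0 : 0 < w := by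
    rw [hw, sub_pos, lt_div_iff₀ hl]; linarith
  have hlw : l * (s0 + w) = m := by rw [hw]; field_simp; ring
  have hth : ∀ s, s0 + w ≤ s → Real.smoothTransition ((s - s0) / w) = 1 := fun s hs =>
    Real.smoothTransition.one_of_one_le (by rw [one_le_div hw0]; linarith)
  refine ⟨fun s => (m - l * s) * (1 - Real.smoothTransition ((s - s0) / w)), ?_, ?_, ?_, ?_, s0 + w, ?_⟩
  · have h1 : ContDiff ℝ (⊤ : ℕ∞) (fun s : ℝ => Real.smoothTransition ((s - s0) / w)) :=
      (Real.smoothTransition.contDiff (n := ⊤)).comp ((contDiff_id.sub contDiff_const).div_const w)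
    exact (contDiff_const.sub (contDiff_const.mul contDiff_id)).mul (contDiff_const.sub h1)
  · intro s t hst
    simp only
    rcases le_or_gt (s0 + w) t with h | h
    · rw [hth t h, sub_self, mul_zero]
      rcases le_or_gt (s0 + w) s with h' | h'
      · rw [hth s h', sub_self, mul_zero]
      · refine mul_nonneg ?_ (by linarith [Real.smoothTransition.le_one ((s - s0) / w)])
        nlinarith
    · have h1 : Real.smoothTransition ((s - s0) / w) ≤ Real.smoothTransition ((t - s0) / w) :=
        Real.smoothTransition.monotone (by gcongr)
      have h2 := Real.smoothTransition.le_one ((t - s0) / w)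
      refine mul_le_mul (by nlinarith) (by linarith) (by linarith) (by nlinarith)
  · intro s
    simp only
    rcases le_or_gt (s0 + w) s with h' | h'
    · rw [hth s h', sub_self, mul_zero]
    · refine mul_nonneg ?_ (by linarith [Real.smoothTransition.le_one ((s - s0) / w)])
      nlinarith
  · intro s hs
    have : Real.smoothTransition ((s - s0) / w) = 0 :=
      Real.smoothTransition.zero_of_nonpos (div_nonpos_of_nonpos_of_nonneg (by linarith) hw0.le)
    simp [this]
  · intro s hs
    simp [hth s hs]

set_option maxHeartbeats 2000000 in
/-- Hofer–Zehnder: existence of fast orbits, finite-dimensional version. -/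
theorem hz_abs {E : Type*} [NormedAddCommGroup E] [InnerProductSpace ℝ E] [FiniteDimensional ℝ E]
    (J P : E →L[ℝ] E) (J2 : ∀ x, J (J x) = -x) (Js : ∀ x y, ⟪J x, y⟫ = -⟪x, J y⟫)
    (PP : ∀ x, P (P x) = P x) (Ps : ∀ x y, ⟪P x, y⟫ = ⟪x, P y⟫) (PJ : ∀ x, P (J x) = J (P x))
    (e1 : E) (e1n : ‖e1‖ = 1) (Pe1 : P e1 = e1)
    (F : E → ℝ) (F' : E → E) (hFc : ContDiff ℝ (⊤ : ℕ∞) F) (hF' : ∀ z, HasFDerivAt F (innerSL ℝ (F' z)) z)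
    (m r r' R : ℝ) (hr : 0 < r) (hr' : r' < r) (hr0 : 0 ≤ r') (hm : Real.pi * r ^ 2 < m)
    (hF0 : ∀ z, 0 ≤ F z) (hFm : ∀ z, F z ≤ m) (hFb : ∀ z, F z < m → ‖P z‖ ≤ r' ∧ ‖z‖ ≤ R)
    (z0 : E) (ρ : ℝ) (hρ : 0 < ρ) (hz0 : ∀ z, ‖z - z0‖ < ρ → F z = 0) :
    ∃ x : ℝ → E, (∀ t, x (t + 1) = x t) ∧ (∀ t, HasDerivAt x (J (F' (x t))) t) ∧
      (∃ t₁ t₂, x t₁ ≠ x t₂) ∧ ∀ t, F (x t) < m := by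
  have hpi := Real.pi_pos
  have hm0 : 0 < m := lt_trans (by positivity) hm
  have hR0 : 0 ≤ R := (norm_nonneg _).trans (hFb z0 (by rw [hz0 z0 (by simpa using hρ)]; exact hm0)).2
  -- parameters
  obtain ⟨l, hl1, hl2⟩ := exists_between (lt_min ((lt_div_iff₀ (by positivity)).mpr hm) (by linarith : Real.pi < 2 * Real.pi))
  have hlm : l * r ^ 2 < m := by
    have := lt_of_lt_of_le hl2 (min_le_left _ _)
    rwa [lt_div_iff₀ (by positivity)] at this
  have hl2π : l < 2 * Real.pi := lt_of_lt_of_le hl2 (min_le_right _ _)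
  have hl0 : 0 < l := hpi.trans hl1
  obtain ⟨κ, hκc, hκa, hκ0, hκ1, S1, hκ2⟩ := exists_kappa m l (r ^ 2) hl0 hlm
  have hrr : 0 < r ^ 2 - r' ^ 2 := by nlinarith
  set η := min (1/2) ((r ^ 2 - r' ^ 2) / (2 * (R ^ 2 + 1))) with hη
  have hη0 : 0 < η := lt_min (by norm_num) (by positivity)
  have hη1 : η ≤ 1/2 := min_le_left _ _
  have hηR : η * R ^ 2 ≤ (r ^ 2 - r' ^ 2) / 2 := by
    have h1 : η ≤ (r ^ 2 - r' ^ 2) / (2 * (R ^ 2 + 1)) := min_le_right _ _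
    rw [le_div_iff₀ (by positivity)] at h1
    nlinarith
  set s1 := r' ^ 2 + (r ^ 2 - r' ^ 2) / 2 with hs1
  have hs1r : s1 < r ^ 2 := by rw [hs1]; linarith
  -- quadratic form
  let A : E →L[ℝ] E := P + η • (ContinuousLinearMap.id ℝ E - P)
  have hA : ∀ z, A z = P z + η • (z - P z) := fun z => by simp [A]
  have hAs : ∀ x y, ⟪A x, y⟫ = ⟪x, A y⟫ := by
    intro x y
    simp only [hA, inner_add_left, inner_add_right, inner_smul_left, inner_smul_right,
      inner_sub_left, inner_sub_right, Ps]
    simp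
  have hAJ : ∀ x, A (J x) = J (A x) := by
    intro x; simp only [hA, map_add, map_smul, map_sub, PJ]
  let q : E → ℝ := fun z => ⟪A z, z⟫
  have hPz : ∀ z, ⟪P z, z⟫ = ‖P z‖ ^ 2 := by
    intro z
    rw [← real_inner_self_eq_norm_sq, Ps (z) (P z), PP, real_inner_comm]
  have hzP : ∀ z, ‖z‖ ^ 2 = ‖P z‖ ^ 2 + ‖z - P z‖ ^ 2 := by
    intro z
    rw [@norm_sub_sq_real, real_inner_comm, hPz]; ring
  have hq : ∀ z, q z = ‖P z‖ ^ 2 + η * ‖z - P z‖ ^ 2 := by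
    intro z
    have h1 : ⟪z - P z, z⟫ = ‖z - P z‖ ^ 2 := by
      have := hzP z
      rw [inner_sub_left, real_inner_self_eq_norm_sq, hPz]; linarith
    simp only [q, hA, inner_add_left, inner_smul_left, h1, hPz]
    simp
  have hq0 : ∀ z, 0 ≤ q z := fun z => by rw [hq]; positivity
  have hqc : Continuous q := by fun_prop
  have hqd : ∀ z, HasFDerivAt q (innerSL ℝ ((2:ℝ) • A z)) z := by
    intro z
    have h1 := (A.hasFDerivAt (x := z)).inner ℝ (hasFDerivAt_id z)
    refine h1.congr_fderiv ?_
    ext v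
    simp [inner_smul_left]
    rw [hAs v z, real_inner_comm v]
    ring
  have hqsm : ContDiff ℝ (⊤ : ℕ∞) q := A.contDiff.inner ℝ contDiff_id
  have hqlow : ∀ z, η * ‖z‖ ^ 2 ≤ q z := by
    intro z; rw [hq, hzP z]
    nlinarith [sq_nonneg ‖P z‖]
  have hFq : ∀ z, F z < m → q z ≤ s1 := by
    intro z hz
    obtain ⟨h1, h2⟩ := hFb z hz
    rw [hq, hs1]
    have h3 : ‖P z‖ ^ 2 ≤ r' ^ 2 := pow_le_pow_left₀ (norm_nonneg _) h1 2
    have h4 : ‖z - P z‖ ^ 2 ≤ R ^ 2 := by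
      have := pow_le_pow_left₀ (norm_nonneg _) h2 2
      nlinarith [hzP z, sq_nonneg ‖P z‖]
    nlinarith
  have hFeq : ∀ z, s1 < q z → F z = m := fun z hz => by
    by_contra h
    exact absurd (hFq z (lt_of_le_of_ne (hFm z) h)) (not_le.mpr hz)
  -- the perturbation
  let g0 : E → ℝ := fun z => F z - m + κ (q z)
  have hg0c : ContDiff ℝ (⊤ : ℕ∞) g0 := (hFc.sub contDiff_const).add (hκc.comp hqsm)
  have hg0s : HasCompactSupport g0 := by
    refine HasCompactSupport.intro (K := closedBall 0 (Real.sqrt ((max S1 (r ^ 2)) / η))) (isCompact_closedBall _ _) ?_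
    intro z hz
    rw [mem_closedBall_zero_iff, not_le] at hz
    have h0 : 0 ≤ max S1 (r ^ 2) / η := div_nonneg ((sq_nonneg r).trans (le_max_right _ _)) hη0.le
    have h1 : max S1 (r ^ 2) / η < ‖z‖ ^ 2 := (Real.sqrt_lt h0 (norm_nonneg _)).mp hz
    rw [div_lt_iff₀ hη0] at h1
    have h2 : max S1 (r ^ 2) < q z := lt_of_lt_of_le (by linarith) (hqlow z)
    have h3 := hFeq z (hs1r.trans (lt_of_le_of_lt (le_max_right _ _) h2))
    have h4 := hκ2 (q z) ((le_max_left _ _).trans h2.le)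
    simp [g0, h3, h4]
  let g0' : E → E := fun z => F' z + (deriv κ (q z) * 2) • A z
  have hκd : ∀ s, HasDerivAt κ (deriv κ s) s := fun s =>
    ((hκc.differentiable (by simp)) s).hasDerivAt
  have hg0d : ∀ z, HasFDerivAt g0 (innerSL ℝ (g0' z)) z := by
    intro z
    have h1 := ((hF' z).sub_const m).add ((hκd (q z)).comp_hasFDerivAt z (hqd z))
    refine h1.congr_fderiv ?_
    ext v
    simp [g0', inner_add_left, inner_smul_left]
    ring
  have hnorm : ∀ z w, ‖g0' z - g0' w‖ = ‖fderiv ℝ g0 z - fderiv ℝ g0 w‖ := by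
    intro z w
    rw [(hg0d z).fderiv, (hg0d w).fderiv, ← map_sub, innerSL_apply_norm]
  obtain ⟨LG, hLG⟩ : ∃ C : ℝ≥0, LipschitzWith C (fderiv ℝ g0) :=
    ContDiff.lipschitzWith_of_hasCompactSupport (𝕂 := ℝ) (n := 1) (hg0s.fderiv ℝ)
      ((hg0c.fderiv_right (m := (⊤ : ℕ∞)) (by simp)).of_le (by simp)) one_ne_zero
  obtain ⟨CG, hCG⟩ := (hg0c.continuous_fderiv (by simp)).bounded_above_of_compact_support (hg0s.fderiv ℝ)
  have hCG' : ∀ z, ‖g0' z‖ ≤ CG := by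
    intro z
    have := hCG z
    rwa [(hg0d z).fderiv, innerSL_apply_norm] at this
  -- the full Hamiltonian
  let Hb : E → ℝ := fun z => l * q z + g0 z
  have hHb0 : ∀ z, 0 ≤ Hb z := by
    intro z
    simp only [Hb, g0]
    rcases (hFm z).lt_or_eq with h | h
    · rw [hκ1 (q z) ((hFq z h).trans hs1r.le)]; linarith [hF0 z]
    · rw [h]; have := hκ0 (q z); have := mul_nonneg hl0.le (hq0 z); linarith
  have hHbF : ∀ z, q z ≤ r ^ 2 → Hb z = F z := by
    intro z hz
    simp only [Hb, g0]
    rw [hκ1 _ hz]; ring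
  have hAq : ∀ z, (1/2:ℝ) * ⟪(2 * l) • P z + (2 * l * η) • (z - P z), z⟫ = l * q z := by
    intro z
    have : (2 * l) • P z + (2 * l * η) • (z - P z) = (2 * l) • A z := by
      rw [hA]; module
    rw [this, inner_smul_left]
    simp only [q]
    simp
    ring
  let c0 : E := (2 * l) • A z0
  have hqadd : ∀ z, q (z + z0) = q z + 2 * ⟪A z0, z⟫ + q z0 := by
    intro z
    simp only [q, map_add, inner_add_left, inner_add_right]
    rw [hAs z z0, real_inner_comm (A z0) z]; ring
  let S : HS E :=
    { J := J, P := P, J2 := J2, Js := Js, PP := PP, Ps := Ps, PJ := PJ, e1 := e1, e1n := e1n, Pe1 := Pe1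
      b1 := 2 * l, b2 := 2 * l * η
      b1l := by linarith
      b1u := by linarith
      b2l := by positivity
      b2u := by nlinarith
      G := fun z => g0 (z + z0) + ⟪c0, z⟫ + l * q z0
      G' := fun z => g0' (z + z0) + c0
      hG := by
        intro z
        have h1 : HasFDerivAt (fun z => g0 (z + z0)) (innerSL ℝ (g0' (z + z0))) z := by
          have := (hg0d (z + z0)).comp z ((hasFDerivAt_id z).add_const z0)
          exact this.congr_fderiv (by ext v; rfl)
        have h2 := (h1.add (innerSL ℝ c0).hasFDerivAt).add_const (l * q z0)
        refine h2.congr_fderiv ?_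
        exact (map_add (innerSL ℝ) _ _).symm
      LG := LG + 1
      LG0 := by positivity
      hLG := by
        intro z w
        rw [add_sub_add_right_eq_sub, hnorm]
        have := hLG.dist_le_mul (z + z0) (w + z0)
        rw [dist_eq_norm, dist_eq_norm, add_sub_add_right_eq_sub] at this
        nlinarith [norm_nonneg (z - w)]
      CG := CG + ‖c0‖ + 1
      CG0 := by
        have := (norm_nonneg _).trans (hCG' 0)
        positivity
      hCG := by
        intro z
        refine (norm_add_le _ _).trans ?_
        linarith [hCG' (z + z0)]
      ρ := ρ
      ρ0 := hρ
      Hnn := by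
        intro z
        have := hHb0 (z + z0)
        simp only [Hb, hqadd] at this
        rw [hAq]
        simp only [c0, inner_smul_left]
        simp
        linarith
      Hz := by
        intro z hz
        have h1 : F (z + z0) = 0 := hz0 _ (by simpa using hz)
        have h2 : Hb (z + z0) = 0 := by
          rw [hHbF _ ((hFq _ (by rw [h1]; exact hm0)).trans hs1r.le), h1]
        simp only [Hb, hqadd] at h2
        rw [hAq]
        simp only [c0, inner_smul_left]
        simp
        linarith }
  have hSH : ∀ z, S.H z = Hb (z + z0) := by
    intro z
    have h1 : S.H z = (1/2:ℝ) * ⟪(2 * l) • P z + (2 * l * η) • (z - P z), z⟫ + (g0 (z + z0) + ⟪c0, z⟫ + l * q z0) := by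
      rw [HS.H, HS.B_apply]
    rw [h1, hAq]
    simp only [Hb, hqadd, c0, inner_smul_left]
    simp
    ring
  let Hb' : E → E := fun z => (2 * l) • A z + g0' z
  have hSH' : ∀ z, S.H' z = Hb' (z + z0) := by
    intro z
    have h1 : S.H' z = ((2 * l) • P z + (2 * l * η) • (z - P z)) + (g0' (z + z0) + c0) := by
      rw [HS.H', HS.B_apply]
    rw [h1]
    simp only [Hb', c0, map_add]
    rw [hA z]
    module
  have hHbd : ∀ z, HasFDerivAt Hb (innerSL ℝ (Hb' z)) z := by
    intro z
    refine (((hqd z).const_mul l).add (hg0d z)).congr_fderiv ?_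
    ext v
    simp [Hb', inner_add_left, inner_smul_left]
    ring
  have hHb'c : Continuous Hb' := by
    have h1 : Continuous S.H' := S.H'_cont
    have h2 : Hb' = fun z => S.H' (z - z0) := by funext z; rw [hSH']; simp
    rw [h2]; fun_prop
  have hHbc : Continuous Hb := continuous_iff_continuousAt.mpr fun z => (hHbd z).continuousAt
  obtain ⟨x, hxp, hxd, hxa⟩ := S.orbit
  let ξ : ℝ → E := fun t => x t + z0
  have hξp : ∀ t, ξ (t + 1) = ξ t := fun t => by simp only [ξ, hxp]
  have hξd : ∀ t, HasDerivAt ξ (J (Hb' (ξ t))) t := by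
    intro t
    have := (hxd t).add_const z0
    rw [hSH'] at this
    exact this
  have hξc : Continuous ξ := continuous_iff_continuousAt.mpr fun t => (hξd t).continuousAt
  have hact : 0 < ∫ t in (0:ℝ)..1, ((1/2) * ⟪Hb' (ξ t), ξ t⟫ - Hb (ξ t)) := by
    have h0 : ∫ t in (0:ℝ)..1, J (Hb' (ξ t)) = 0 := by
      rw [intervalIntegral.integral_eq_sub_of_hasDerivAt (fun t _ => hξd t)
        (Continuous.intervalIntegrable (by fun_prop) _ _)]
      have := hξp 0
      rw [zero_add] at this
      rw [this, sub_self]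
    have h1 : ∫ t in (0:ℝ)..1, ⟪Hb' (ξ t), z0⟫ = 0 := by
      have h2 := ContinuousLinearMap.intervalIntegral_comp_comm (innerSL ℝ (J z0)) (f := fun t => J (Hb' (ξ t)))
        (μ := MeasureTheory.volume) (a := 0) (b := 1) (Continuous.intervalIntegrable (by fun_prop) _ _)
      rw [h0, map_zero] at h2
      simp only [innerSL_apply_apply] at h2
      refine (intervalIntegral.integral_congr fun t _ => ?_).trans h2
      rw [Js, J2, inner_neg_right, neg_neg, real_inner_comm]
    have h3 : ∀ t, (1/2) * ⟪Hb' (ξ t), ξ t⟫ - Hb (ξ t) =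
        ((1/2) * ⟪S.H' (x t), x t⟫ - S.H (x t)) + (1/2) * ⟪Hb' (ξ t), z0⟫ := by
      intro t
      rw [hSH, hSH']
      simp only [ξ, inner_add_right]
      ring
    have hxc : Continuous x := continuous_iff_continuousAt.mpr fun t => (hxd t).continuousAt
    have c1 := S.H'_cont
    have c2 := S.H_cont
    simp only [h3]
    rw [intervalIntegral.integral_add (Continuous.intervalIntegrable (by fun_prop) _ _)
      (Continuous.intervalIntegrable (by fun_prop) _ _), intervalIntegral.integral_const_mul, h1]
    simpa using hxa
  have hJself : ∀ v, ⟪v, J v⟫ = 0 := by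
    intro v
    have h1 := Js v v
    rw [real_inner_comm] at h1
    linarith
  have hF'0 : ∀ z, F z = m → F' z = 0 := by
    intro z hz
    have h1 : IsLocalMax F z := Filter.Eventually.of_forall fun w => by simp only [hz]; exact hFm w
    have h2 := h1.hasFDerivAt_eq_zero (hF' z)
    have h3 : ⟪F' z, F' z⟫ = 0 := by
      have := congrArg (fun φ : E →L[ℝ] ℝ => φ (F' z)) h2
      simpa using this
    exact inner_self_eq_zero.mp h3
  -- no orbit outside
  have hin : ∀ t, q (ξ t) ≤ s1 := by
    by_contra hcon
    push Not at hcon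
    obtain ⟨t0, ht0⟩ := hcon
    set c := q (ξ t0) with hc
    have hHout : ∀ z, s1 < q z → Hb' z = (2 * (l + deriv κ (q z))) • A z := by
      intro z hz
      simp only [Hb', g0']
      rw [hF'0 z (hFeq z hz)]
      module
    have hqd' : ∀ t, s1 < q (ξ t) → HasDerivAt (fun t => q (ξ t)) 0 t := by
      intro t ht
      have h1 := (hqd (ξ t)).comp_hasDerivAt t (hξd t)
      refine h1.congr_deriv ?_
      rw [hHout _ ht]
      simp [inner_smul_left, inner_smul_right, hJself]
    have hclopen : IsClopen {t | q (ξ t) = c} := by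
      refine ⟨isClosed_eq (hqc.comp hξc) continuous_const, ?_⟩
      rw [Metric.isOpen_iff]
      intro t ht
      have hop : IsOpen {t | s1 < q (ξ t)} := isOpen_lt continuous_const (hqc.comp hξc)
      rw [Metric.isOpen_iff] at hop
      obtain ⟨ε, hε, hsub⟩ := hop t (by simp only [Set.mem_ofPred_eq] at ht ⊢; rw [ht]; exact ht0)
      refine ⟨ε, hε, fun u hu => ?_⟩
      have h2 := (convex_ball t ε).is_const_of_fderivWithin_eq_zero (𝕜 := ℝ) (f := fun t => q (ξ t))
        (fun v hv => (hqd' v (hsub hv)).differentiableAt.differentiableWithinAt)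
        (fun v hv => by
          rw [fderivWithin_of_isOpen isOpen_ball hv, (hqd' v (hsub hv)).hasFDerivAt.fderiv]
          ext; simp) hu (mem_ball_self hε)
      simp only [Set.mem_ofPred_eq] at ht ⊢
      rw [← ht]; exact h2
    have hall : ∀ t, q (ξ t) = c := by
      intro t
      have := hclopen.eq_univ ⟨t0, rfl⟩
      have h3 : t ∈ {t | q (ξ t) = c} := by rw [this]; trivial
      exact h3
    have hval : ∀ t, (1/2) * ⟪Hb' (ξ t), ξ t⟫ - Hb (ξ t) = deriv κ c * c - κ c := by
      intro t
      have hgt : s1 < q (ξ t) := by rw [hall]; exact ht0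
      have hqt : ⟪A (ξ t), ξ t⟫ = c := hall t
      rw [hHout _ hgt]
      simp only [Hb, g0]
      rw [hFeq _ hgt, inner_smul_left, hqt, hall t]
      simp
      ring
    simp only [hval] at hact
    simp at hact
    have h5 : deriv κ c ≤ 0 := hκa.deriv_nonpos
    have h6 := hκ0 c
    have h7 : 0 ≤ c := hq0 _
    have := mul_nonpos_of_nonpos_of_nonneg h5 h7
    linarith
  have hHF' : ∀ t, Hb' (ξ t) = F' (ξ t) := by
    intro t
    have hev : Hb =ᶠ[nhds (ξ t)] F := by
      have hop : IsOpen {z | q z < r ^ 2} := isOpen_lt hqc continuous_const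
      filter_upwards [hop.mem_nhds (lt_of_le_of_lt (hin t) hs1r)] with z hz
      exact hHbF z hz.le
    have h1 := ((hF' (ξ t)).congr_of_eventuallyEq hev).unique (hHbd (ξ t))
    have h2 : ∀ v, ⟪F' (ξ t), v⟫ = ⟪Hb' (ξ t), v⟫ := fun v => by
      have := congrArg (fun φ : E →L[ℝ] ℝ => φ v) h1
      simpa using this
    exact (ext_inner_right ℝ h2).symm
  have hnc : ∃ t₁ t₂, ξ t₁ ≠ ξ t₂ := by
    by_contra hcon
    push Not at hcon
    have h1 : ∀ t, Hb' (ξ t) = 0 := by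
      intro t
      have h2 : HasDerivAt ξ 0 t := by
        have : ξ = fun _ => ξ 0 := by funext s; exact hcon s 0
        rw [this]; exact hasDerivAt_const t _
      have h3 := (hξd t).unique h2
      have h4 := J2 (Hb' (ξ t))
      rw [h3, map_zero] at h4
      simpa using h4.symm
    simp only [h1, inner_zero_left, mul_zero, zero_sub] at hact
    rw [intervalIntegral.integral_neg] at hact
    have := intervalIntegral.integral_nonneg (μ := MeasureTheory.volume) (zero_le_one (α := ℝ)) (fun t _ => hHb0 (ξ t))
    linarith
  have hξdF : ∀ t, HasDerivAt ξ (J (F' (ξ t))) t := fun t => by rw [← hHF']; exact hξd t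
  refine ⟨ξ, hξp, hξdF, hnc, ?_⟩
  -- energy
  have hen : ∀ t s, F (ξ t) = F (ξ s) := by
    have hd : ∀ t, HasDerivAt (fun t => F (ξ t)) 0 t := by
      intro t
      have h1 := (hF' (ξ t)).comp_hasDerivAt t (hξdF t)
      refine h1.congr_deriv ?_
      simp [hJself]
    intro t s
    exact is_const_of_deriv_eq_zero (fun t => (hd t).differentiableAt) (fun t => (hd t).deriv) t s
  intro t
  by_contra hcon
  have hFt : F (ξ t) = m := le_antisymm (hFm _) (not_lt.mp hcon)
  obtain ⟨t1, t2, h12⟩ := hnc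
  refine h12 ?_
  have hd : ∀ s, HasDerivAt ξ 0 s := by
    intro s
    have := hξdF s
    rwa [hF'0 _ ((hen s t).trans hFt), map_zero] at this
  exact is_const_of_deriv_eq_zero (fun t => (hd t).differentiableAt) (fun t => (hd t).deriv) t1 t2


end parti


/-! ### Linear algebra of the projections -/

section projsec

variable {b : ℕ × Bool → Z} {J : Z →L[ℝ] Z}

def projL (b : ℕ × Bool → Z) (n : ℕ) : Z →L[ℝ] Z :=
  ∑ j ∈ Finset.range n, ((innerSL ℝ (b (j, true))).smulRight (b (j, true)) +
    (innerSL ℝ (b (j, false))).smulRight (b (j, false)))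

lemma projL_apply (b : ℕ × Bool → Z) (n : ℕ) (z : Z) : projL b n z = proj b n z := by
  simp [projL, proj]

lemma IsHilbertBasis.dense (hb : IsHilbertBasis b) : Dense (Submodule.span ℝ (Set.range b) : Set Z) :=
  Submodule.dense_iff_topologicalClosure_eq_top.mpr hb.2

lemma inner_b (hb : IsHilbertBasis b) (i j : ℕ × Bool) : ⟪b i, b j⟫ = if i = j then (1:ℝ) else 0 :=
  orthonormal_iff_ite.mp hb.1 i j

lemma projL_b (hb : IsHilbertBasis b) (n k : ℕ) (s : Bool) :
    projL b n (b (k, s)) = if k < n then b (k, s) else 0 := by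
  rw [projL_apply, proj]
  simp only [inner_b hb, Prod.mk.injEq]
  have : ∀ j ∈ Finset.range n, ((if j = k ∧ true = s then (1:ℝ) else 0) • b (j, true) +
      (if j = k ∧ false = s then (1:ℝ) else 0) • b (j, false)) = if j = k then b (k, s) else 0 := by
    intro j _
    by_cases h : j = k
    · subst h; cases s <;> simp
    · simp [h]
  rw [Finset.sum_congr rfl this]
  simp

lemma projL_symm (b : ℕ × Bool → Z) (n : ℕ) (x y : Z) : ⟪projL b n x, y⟫ = ⟪x, projL b n y⟫ := by
  simp only [projL_apply, proj, sum_inner, inner_sum, inner_add_left, inner_add_right,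
    real_inner_smul_left, real_inner_smul_right]
  refine Finset.sum_congr rfl fun j _ => ?_
  rw [real_inner_comm x (b (j, true)), real_inner_comm x (b (j, false))]
  ring

lemma projL_idem (hb : IsHilbertBasis b) (n : ℕ) (x : Z) : projL b n (projL b n x) = projL b n x := by
  have : (projL b n).comp (projL b n) = projL b n := by
    refine ContinuousLinearMap.ext_on hb.dense ?_
    rintro _ ⟨⟨k, s⟩, rfl⟩
    simp only [ContinuousLinearMap.comp_apply, projL_b hb]
    split_ifs with h
    · rw [projL_b hb, if_pos h]
    · simp
  exact congrArg (fun L : Z →L[ℝ] Z => L x) this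

lemma projL_mono (hb : IsHilbertBasis b) {k n : ℕ} (hkn : k ≤ n) (x : Z) :
    projL b n (projL b k x) = projL b k x := by
  have : (projL b n).comp (projL b k) = projL b k := by
    refine ContinuousLinearMap.ext_on hb.dense ?_
    rintro _ ⟨⟨j, s⟩, rfl⟩
    simp only [ContinuousLinearMap.comp_apply, projL_b hb]
    split_ifs with h
    · rw [projL_b hb, if_pos (h.trans_le hkn)]
    · simp
  exact congrArg (fun L : Z →L[ℝ] Z => L x) this

lemma projL_J (hb : IsHilbertBasis b) (hJ : IsJ b J) (n : ℕ) (x : Z) :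
    projL b n (J x) = J (projL b n x) := by
  have : (projL b n).comp J = J.comp (projL b n) := by
    refine ContinuousLinearMap.ext_on hb.dense ?_
    rintro _ ⟨⟨j, s⟩, rfl⟩
    cases s <;> simp only [ContinuousLinearMap.comp_apply, projL_b hb, (hJ j).1, (hJ j).2, map_neg] <;>
      split_ifs <;> simp [(hJ j).1, (hJ j).2]
  exact congrArg (fun L : Z →L[ℝ] Z => L x) this

lemma J_sq (hb : IsHilbertBasis b) (hJ : IsJ b J) (x : Z) : J (J x) = -x := by
  have : J.comp J = -ContinuousLinearMap.id ℝ Z := by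
    refine ContinuousLinearMap.ext_on hb.dense ?_
    rintro _ ⟨⟨j, s⟩, rfl⟩
    cases s <;> simp [(hJ j).1, (hJ j).2]
  simpa using congrArg (fun L : Z →L[ℝ] Z => L x) this

lemma J_skew (hb : IsHilbertBasis b) (hJ : IsJ b J) (x y : Z) : ⟪J x, y⟫ = -⟪x, J y⟫ := by
  have h1 : ∀ i, ∀ y, ⟪J (b i), y⟫ = -⟪b i, J y⟫ := by
    rintro ⟨i, s⟩ y
    have : innerSL ℝ (J (b (i, s))) = -((innerSL ℝ (b (i, s))).comp J) := by
      refine ContinuousLinearMap.ext_on hb.dense ?_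
      rintro _ ⟨⟨j, s'⟩, rfl⟩
      cases s <;> cases s' <;> simp [(hJ j).1, (hJ j).2, (hJ i).1, (hJ i).2, inner_b hb]
    simpa using congrArg (fun L : Z →L[ℝ] ℝ => L y) this
  have : (innerSL ℝ y).comp J = -(innerSL ℝ (J y)) := by
    refine ContinuousLinearMap.ext_on hb.dense ?_
    rintro _ ⟨i, rfl⟩
    have := h1 i y
    rw [real_inner_comm, real_inner_comm (J y)] at this
    simpa using this
  have h2 := congrArg (fun L : Z →L[ℝ] ℝ => L x) this
  simp at h2
  rw [real_inner_comm, h2, real_inner_comm]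

lemma J_self (hb : IsHilbertBasis b) (hJ : IsJ b J) (x : Z) : ⟪x, J x⟫ = 0 := by
  have h1 := J_skew hb hJ x x
  rw [real_inner_comm] at h1
  linarith

/-- The finite-dimensional space `Z^n`. -/
def EE (b : ℕ × Bool → Z) (n : ℕ) : Submodule ℝ Z := (projL b n : Z →ₗ[ℝ] Z).range

lemma mem_EE (b : ℕ × Bool → Z) (n : ℕ) (z : Z) : projL b n z ∈ EE b n := ⟨z, rfl⟩

lemma EE_proj (hb : IsHilbertBasis b) {n : ℕ} {z : Z} (hz : z ∈ EE b n) : projL b n z = z := by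
  obtain ⟨w, rfl⟩ := hz
  exact projL_idem hb n w

instance EE_fd (b : ℕ × Bool → Z) (n : ℕ) : FiniteDimensional ℝ (EE b n) := by
  have hfin : (b '' {p | p.1 < n}).Finite := by
    refine Set.Finite.image _ ?_
    refine ((Finset.range n ×ˢ (Finset.univ : Finset Bool)).finite_toSet).subset ?_
    rintro ⟨j, s⟩ hj
    have : j < n := hj
    simpa using this
  have hle : EE b n ≤ Submodule.span ℝ (b '' {p | p.1 < n}) := by
    rintro _ ⟨w, rfl⟩
    change projL b n w ∈ _
    rw [projL_apply]
    refine Submodule.sum_mem _ fun j hj => ?_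
    have hj' := Finset.mem_range.mp hj
    exact Submodule.add_mem _
      (Submodule.smul_mem _ _ (Submodule.subset_span ⟨(j, true), hj', rfl⟩))
      (Submodule.smul_mem _ _ (Submodule.subset_span ⟨(j, false), hj', rfl⟩))
  have := FiniteDimensional.span_of_finite ℝ hfin
  exact Submodule.finiteDimensional_of_le hle

lemma span_exists_proj (hb : IsHilbertBasis b) {u : Z} (hu : u ∈ Submodule.span ℝ (Set.range b)) :
    ∃ n₀, ∀ n ≥ n₀, projL b n u = u := by
  induction hu using Submodule.span_induction with
  | mem x hx =>
    obtain ⟨⟨k, s⟩, rfl⟩ := hx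
    exact ⟨k + 1, fun n hn => by rw [projL_b hb, if_pos (by omega)]⟩
  | zero => exact ⟨0, fun n _ => map_zero _⟩
  | add x y _ _ hx hy =>
    obtain ⟨n1, h1⟩ := hx
    obtain ⟨n2, h2⟩ := hy
    exact ⟨max n1 n2, fun n hn => by
      rw [map_add, h1 n ((le_max_left _ _).trans hn), h2 n ((le_max_right _ _).trans hn)]⟩
  | smul a x _ hx =>
    obtain ⟨n1, h1⟩ := hx
    exact ⟨n1, fun n hn => by rw [map_smul, h1 n hn]⟩

end projsec

/-! ### Upper bound -/

lemma far_of_frontier {O : Set Z} (hO : IsOpen O) {d : ℝ} {x y : Z} (hx : x ∈ O) (hy : y ∉ O)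
    (h : ∀ y ∈ frontier O, d ≤ dist x y) : d ≤ dist x y := by
  by_contra hlt
  push Not at hlt
  have hseg : IsPreconnected (segment ℝ x y) := (convex_segment x y).isPreconnected
  have hnf : ∀ w ∈ segment ℝ x y, w ∉ frontier O := by
    intro w hw hf
    have h1 := h w hf
    have h2 : dist x w ≤ dist x y := by
      have := dist_add_dist_of_mem_segment hw
      linarith [dist_nonneg (x := w) (y := y)]
    linarith
  rw [hO.frontier_eq] at hnf
  have hcov : segment ℝ x y ⊆ O ∪ (closure O)ᶜ := by
    intro w hw
    by_cases hwO : w ∈ O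
    · exact Or.inl hwO
    · exact Or.inr fun hc => hnf w hw ⟨hc, hwO⟩
  obtain ⟨w, _, h1, h2⟩ := hseg O (closure O)ᶜ hO isClosed_closure.isOpen_compl hcov
    ⟨x, left_mem_segment ℝ x y, hx⟩
    ⟨y, right_mem_segment ℝ x y, fun hc => hnf y (right_mem_segment ℝ x y) ⟨hc, hy⟩⟩
  exact h2 (subset_closure h1)

set_option maxHeartbeats 1000000 in
lemma upper {b : ℕ × Bool → Z} {J : Z →L[ℝ] Z} (hb : IsHilbertBasis b) (hJ : IsJ b J)
    {O : Set Z} (hO : IsOpen O) {m : ℝ} {f : Z → ℝ} (hf : IsAdmissible O m f)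
    {r r' : ℝ} (hr : 0 < r) (hr' : r' < r) (hr0 : 0 ≤ r') (hm : Real.pi * r ^ 2 < m)
    (hbd : ∀ z ∈ O, f z < m → ‖projL b 1 z‖ ≤ r') : IsFastFunction b J O f := by
  classical
  obtain ⟨hm0, hfs, hf01, ⟨U, hUo, hUne, hUO, hU0⟩, hfr, hbdd, d, hd, hdd⟩ := hf
  obtain ⟨R, hR⟩ := hbdd.exists_norm_le
  let g : Z → ℝ := fun z => if z ∈ O then f z else m
  have hgO : ∀ z ∈ O, g z = f z := fun z hz => by simp [g, hz]
  have hgn : ∀ z, z ∉ O → g z = m := fun z hz => by simp [g, hz]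
  have hgm : ∀ z, g z ≤ m := fun z => by
    by_cases hz : z ∈ O
    · rw [hgO z hz]; exact (hf01 z hz).2
    · rw [hgn z hz]
  have hg0 : ∀ z, 0 ≤ g z := fun z => by
    by_cases hz : z ∈ O
    · rw [hgO z hz]; exact (hf01 z hz).1
    · rw [hgn z hz]; exact hm0.le
  have hglt : ∀ z, g z < m → z ∈ O ∧ f z < m := by
    intro z hz
    by_cases hzO : z ∈ O
    · exact ⟨hzO, by rwa [hgO z hzO] at hz⟩
    · rw [hgn z hzO] at hz; exact absurd hz (lt_irrefl _)
  have hgev : ∀ z ∈ O, g =ᶠ[nhds z] f := fun z hz => by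
    filter_upwards [hO.mem_nhds hz] with w hw using hgO w hw
  have hgc : ContDiff ℝ (⊤ : ℕ∞) g := by
    rw [contDiff_iff_contDiffAt]
    intro z
    by_cases hz : z ∈ O
    · exact (hfs.contDiffAt (hO.mem_nhds hz)).congr_of_eventuallyEq (hgev z hz)
    · have hev : g =ᶠ[nhds z] fun _ => m := by
        filter_upwards [ball_mem_nhds z hd] with w hw
        by_contra hne
        obtain ⟨h1, h2⟩ := hglt w (lt_of_le_of_ne (hgm w) hne)
        have := far_of_frontier hO h1 hz (hdd w ⟨h1, h2⟩)
        rw [mem_ball] at hw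
        linarith
      exact contDiffAt_const.congr_of_eventuallyEq hev
  have hgd : ∀ z, HasFDerivAt g (innerSL ℝ (gradient g z)) z := fun z =>
    ((hgc.differentiable (by simp)) z).hasGradientAt.hasFDerivAt
  -- a point in the zero set
  obtain ⟨u, huU, hus⟩ := hb.dense.inter_open_nonempty U hUo hUne
  obtain ⟨n₀, hn₀⟩ := span_exists_proj hb hus
  obtain ⟨ρ, hρ, hρU⟩ := Metric.isOpen_iff.mp hUo u huU
  refine ⟨max n₀ 1, fun n hn => ?_⟩
  have hn0 : n₀ ≤ n := (le_max_left _ _).trans hn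
  have hn1 : 1 ≤ n := (le_max_right _ _).trans hn
  let E := EE b n
  have hJE : ∀ x : E, J x ∈ E := fun x => by
    rw [← EE_proj hb x.2, ← projL_J hb hJ]; exact mem_EE b n _
  have hPE : ∀ x : E, projL b 1 x ∈ E := fun x => by
    rw [← projL_mono hb hn1]; exact mem_EE b n _
  let JE : E →L[ℝ] E := (J.comp E.subtypeL).codRestrict E hJE
  let PE : E →L[ℝ] E := ((projL b 1).comp E.subtypeL).codRestrict E hPE
  have hJv : ∀ x : E, (JE x : Z) = J x := fun x => rfl
  have hPv : ∀ x : E, (PE x : Z) = projL b 1 x := fun x => rfl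
  have he : b (0, true) ∈ E := by
    have := mem_EE b n (b (0, true))
    rwa [projL_b hb, if_pos (by omega)] at this
  have huE : u ∈ E := by rw [← hn₀ n hn0]; exact mem_EE b n u
  let F' : E → E := fun z => ⟨projL b n (gradient g z), mem_EE b n _⟩
  obtain ⟨x, hxp, hxd, hxn, hxm⟩ := hz_abs JE PE
    (fun x => Subtype.ext (by simp only [hJv, J_sq hb hJ]; rfl))
    (fun x y => by simp only [Submodule.coe_inner, hJv]; exact J_skew hb hJ _ _)
    (fun x => Subtype.ext (by simp only [hPv, projL_idem hb]))
    (fun x y => by simp only [Submodule.coe_inner, hPv]; exact projL_symm b 1 _ _)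
    (fun x => Subtype.ext (by simp only [hPv, hJv, projL_J hb hJ]))
    ⟨b (0, true), he⟩ (by simpa using hb.1.1 (0, true))
    (Subtype.ext (by simp [hPv, projL_b hb]))
    (fun z => g z) F' (hgc.comp E.subtypeL.contDiff)
    (fun z => by
      have h1 := (hgd (z : Z)).comp z E.subtypeL.hasFDerivAt
      refine h1.congr_fderiv ?_
      ext v
      simp only [ContinuousLinearMap.comp_apply, innerSL_apply_apply, Submodule.coe_inner,
        Submodule.subtypeL_apply, F']
      rw [projL_symm, EE_proj hb v.2])
    m r r' R hr hr' hr0 hm (fun z => hg0 z) (fun z => hgm z)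
    (fun z hz => by
      obtain ⟨h1, h2⟩ := hglt z hz
      exact ⟨hbd z h1 h2, hR z ⟨h1, h2⟩⟩)
    ⟨u, huE⟩ ρ hρ (fun z hz => by
      have h1 : (z : Z) ∈ U := hρU (by rw [mem_ball, dist_eq_norm]; exact hz)
      simp only [hgO _ (hUO h1), hU0 _ h1])
  refine ⟨fun t => (x t : Z), ⟨fun t => (hglt _ (hxm t)).1, fun t => ?_, fun t => ?_⟩, ?_, 1, one_pos, le_rfl, ?_⟩
  · rw [← projL_apply]; exact EE_proj hb (x t).2
  · have h1 := (E.subtypeL.hasFDerivAt (x := x t)).comp_hasDerivAt t (hxd t)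
    have h2 : gradient f (x t : Z) = gradient g (x t : Z) := by
      rw [gradient, gradient, (hgev _ (hglt _ (hxm t)).1).fderiv_eq]
    rw [h2, ← projL_apply]
    exact h1
  · obtain ⟨t₁, t₂, h⟩ := hxn
    exact ⟨t₁, t₂, fun h' => h (Subtype.ext h')⟩
  · intro t
    exact congrArg Subtype.val (hxp t)


/-! ### Lower bound -/

lemma exists_profile (m a : ℝ) (hm : 0 < m) (ha : m < Real.pi * a) : ∃ (h : ℝ → ℝ) (s0 s1 : ℝ),
    0 < s0 ∧ s0 < s1 ∧ s1 < a ∧ ContDiff ℝ (⊤ : ℕ∞) h ∧ (∀ s, 0 ≤ h s) ∧ (∀ s, h s ≤ m) ∧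
    (∀ s ≤ s0, h s = 0) ∧ (∀ s, s1 ≤ s → h s = m) ∧ (∀ s, 0 ≤ deriv h s) ∧ (∀ s, deriv h s < Real.pi) := by
  have hpi := Real.pi_pos
  have h1 : m / (2 * Real.pi) < a / 2 := by
    rw [div_lt_div_iff₀ (by positivity) (by norm_num)]; linarith
  obtain ⟨ri, hri1, hri2⟩ := exists_between h1
  obtain ⟨ro, hro1, hro2⟩ := exists_between hri2
  have hri0 : 0 < ri := lt_trans (by positivity) hri1
  let φ : ContDiffBump (a / 2) := ⟨ri, ro, hri0, hro1⟩
  let χ : ℝ → ℝ := φ.normed MeasureTheory.volume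
  have hχc : Continuous χ := φ.continuous_normed
  have hχ0 : ∀ x, 0 ≤ χ x := φ.nonneg_normed
  have hsupp : Function.support χ = ball (a / 2) ro := φ.support_normed_eq
  have hχz : ∀ x, x ∉ ball (a / 2) ro → χ x = 0 := fun x hx => by
    rw [← hsupp] at hx; simpa using hx
  have hχu : ∀ x, m * χ x < Real.pi := by
    intro x
    have h2 : χ x ≤ 1 / MeasureTheory.volume.real (closedBall (a / 2) ri) :=
      φ.normed_le_div_measure_closedBall_rIn MeasureTheory.volume x
    rw [Real.volume_real_closedBall hri0.le] at h2
    have h3 : m < 2 * ri * Real.pi := by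
      rw [div_lt_iff₀ (by positivity)] at hri1; linarith
    have h4 : m * χ x ≤ m * (1 / (2 * ri)) := mul_le_mul_of_nonneg_left h2 hm.le
    refine lt_of_le_of_lt h4 ?_
    rw [mul_one_div, div_lt_iff₀ (by positivity)]; linarith
  let h : ℝ → ℝ := fun s => m * ∫ x in (a / 2 - ro)..s, χ x
  have hd : ∀ s, HasDerivAt h (m * χ s) s := fun s =>
    (intervalIntegral.integral_hasDerivAt_right (hχc.intervalIntegrable _ _)
      (hχc.stronglyMeasurableAtFilter _ _) hχc.continuousAt).const_mul m
  have hderiv : deriv h = fun s => m * χ s := funext fun s => (hd s).deriv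
  have hmono : Monotone h := monotone_of_deriv_nonneg (fun s => (hd s).differentiableAt)
    (fun s => by rw [hderiv]; exact mul_nonneg hm.le (hχ0 s))
  have hz : ∀ s ≤ a / 2 - ro, h s = 0 := by
    intro s hs
    have : ∫ x in (a / 2 - ro)..s, χ x = ∫ x in (a / 2 - ro)..s, (0:ℝ) := by
      refine intervalIntegral.integral_congr fun x hx => hχz x ?_
      rw [Set.uIcc_of_ge hs] at hx
      rw [mem_ball, Real.dist_eq, not_lt]
      refine le_trans ?_ (neg_le_abs _)
      linarith [hx.2]
    simp [h, this]
  have ho : ∀ s, a / 2 + ro ≤ s → h s = m := by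
    intro s hs
    have : ∫ x in (a / 2 - ro)..s, χ x = ∫ x, χ x := by
      refine intervalIntegral.integral_eq_integral_of_support_subset ?_
      rw [hsupp, Real.ball_eq_Ioo]
      exact fun x hx => ⟨hx.1, hx.2.le.trans hs⟩
    have h5 : ∫ x, χ x = 1 := φ.integral_normed
    simp [h, this, h5]
  refine ⟨h, a / 2 - ro, a / 2 + ro, by linarith, by linarith, by linarith, ?_, ?_, ?_, hz, ho, ?_, ?_⟩
  · rw [contDiff_infty_iff_deriv]
    refine ⟨fun s => (hd s).differentiableAt, ?_⟩
    rw [hderiv]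
    exact contDiff_const.mul (φ.contDiff_normed (n := ⊤))
  · intro s
    rw [← hz (min s (a / 2 - ro)) (min_le_right _ _)]
    exact hmono (min_le_left _ _)
  · intro s
    rw [← ho (max s (a / 2 + ro)) (le_max_right _ _)]
    exact hmono (le_max_left _ _)
  · intro s; rw [hderiv]; exact mul_nonneg hm.le (hχ0 s)
  · intro s; rw [hderiv]; exact hχu s

/-- Slow rotations have no short periods. -/
lemma rot_const {J : Z →L[ℝ] Z} (J2 : ∀ x, J (J x) = -x) (Jo : ∀ x, ⟪x, J x⟫ = 0)
    (u : ℝ → Z) (ω : ℝ) (hω0 : 0 ≤ ω) (hω : ω < 2 * Real.pi)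
    (hu : ∀ t, HasDerivAt u (ω • J (u t)) t) (T : ℝ) (hT : 0 < T) (hT1 : T ≤ 1)
    (hper : u (0 + T) = u 0) (hn : ∀ t, ‖u t‖ = ‖u 0‖) (t : ℝ) : u t = u 0 := by
  let v : ℝ → Z := fun t => Real.cos (ω * t) • u t - Real.sin (ω * t) • J (u t)
  have hv : ∀ t, HasDerivAt v 0 t := by
    intro t
    have hl : HasDerivAt (fun t : ℝ => ω * t) ω t := by
      simpa using (hasDerivAt_id t).const_mul ω
    have h1 := (hl.cos).smul (hu t)
    have h2 := (hl.sin).smul ((J.hasFDerivAt (x := u t)).comp_hasDerivAt t (hu t))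
    refine (h1.sub h2).congr_deriv ?_
    simp only [map_smul, J2, Function.comp]
    module
  have hvc : v T = v 0 := is_const_of_deriv_eq_zero (fun t => (hv t).differentiableAt)
    (fun t => (hv t).deriv) T 0
  have h3 : ‖u 0‖ ^ 2 = Real.cos (ω * T) * ‖u 0‖ ^ 2 := by
    have h4 := congrArg (fun w => ⟪u 0, w⟫) hvc
    rw [zero_add] at hper
    simp only [v, hper, inner_sub_right, inner_smul_right, Jo, real_inner_self_eq_norm_sq] at h4
    simp at h4
    linarith
  rcases eq_or_ne (u 0) 0 with h0 | h0
  · have := hn t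
    rw [h0, norm_zero, norm_eq_zero] at this
    rw [this, h0]
  · have hpos : 0 < ‖u 0‖ ^ 2 := by positivity
    have hc : Real.cos (ω * T) = 1 := by
      have : (1 - Real.cos (ω * T)) * ‖u 0‖ ^ 2 = 0 := by linarith
      rcases mul_eq_zero.mp this with h | h
      · linarith
      · exact absurd h hpos.ne'
    have hωT : ω * T = 0 := by
      have hlt : ω * T < 2 * Real.pi := by nlinarith
      exact (Real.cos_eq_one_iff_of_lt_of_lt (by nlinarith [mul_nonneg hω0 hT.le, Real.pi_pos]) hlt).mp hc
    have hω00 : ω = 0 := by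
      rcases mul_eq_zero.mp hωT with h | h
      · exact h
      · exact absurd h hT.ne'
    exact is_const_of_deriv_eq_zero (fun t => (hu t).differentiableAt)
      (fun t => by rw [(hu t).deriv, hω00, zero_smul]) t 0

lemma lower {b : ℕ × Bool → Z} {J : Z →L[ℝ] Z} (hb : IsHilbertBasis b) (hJ : IsJ b J)
    {O : Set Z} (hO : IsOpen O) (x0 : Z) (ε : ℝ) (hε : 0 < ε) (hsub : ball x0 ε ⊆ O)
    {m : ℝ} (hm : 0 < m) (hmε : m < Real.pi * ε ^ 2) :
    ∃ f, IsAdmissible O m f ∧ ¬ IsFastFunction b J O f := by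
  obtain ⟨h, s0, s1, hs0, hs01, hs1, hc, h0, hle, hz, ho, hd0, hdpi⟩ := exists_profile m (ε ^ 2) hm hmε
  have hs1' : Real.sqrt s1 < ε := by
    rw [Real.sqrt_lt' hε]; exact hs1
  let f : Z → ℝ := fun z => h (‖z - x0‖ ^ 2)
  have hout : ∀ y, y ∉ O → ε ≤ ‖y - x0‖ := by
    intro y hy
    by_contra hlt
    push Not at hlt
    exact hy (hsub (by rwa [mem_ball, dist_eq_norm]))
  have hfr : ∀ y ∈ frontier O, ε ≤ ‖y - x0‖ := fun y hy => hout y (by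
    rw [hO.frontier_eq] at hy; exact hy.2)
  have hlt : ∀ z, f z < m → ‖z - x0‖ < Real.sqrt s1 := by
    intro z hzm
    by_contra hge
    push Not at hge
    have : s1 ≤ ‖z - x0‖ ^ 2 := (Real.sqrt_le_left (norm_nonneg _)).mp hge
    exact absurd (ho _ this) hzm.ne
  refine ⟨f, ⟨hm, ?_, fun z _ => ⟨h0 _, hle _⟩, ?_, ?_, ?_, ε - Real.sqrt s1, by linarith, ?_⟩, ?_⟩
  · exact (hc.comp ((contDiff_id.sub contDiff_const).norm_sq ℝ)).contDiffOn
  · refine ⟨ball x0 (Real.sqrt s0), isOpen_ball, ⟨x0, mem_ball_self (Real.sqrt_pos.mpr hs0)⟩, ?_, ?_⟩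
    · exact (ball_subset_ball ((Real.sqrt_le_sqrt hs01.le).trans hs1'.le)).trans hsub
    · intro z hzb
      refine hz _ ?_
      rw [mem_ball, dist_eq_norm, Real.lt_sqrt (norm_nonneg _)] at hzb
      exact hzb.le
  · intro y hy
    refine ho _ (hs1.le.trans ?_)
    have := hfr y hy
    gcongr
  · refine (isBounded_ball (x := x0) (r := Real.sqrt s1)).subset ?_
    intro z hz
    rw [mem_ball, dist_eq_norm]
    exact hlt z hz.2
  · intro x hx y hy
    have h1 := hlt x hx.2
    have h2 := hfr y hy
    have h3 := dist_triangle_left y x0 x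
    rw [← dist_eq_norm] at h1 h2
    linarith
  · rintro ⟨n₀, hn₀⟩
    obtain ⟨z, ⟨hzO, hzp, hzd⟩, ⟨t₁, t₂, hne⟩, T, hT, hT1, hper⟩ := hn₀ n₀ le_rfl
    have hgrad : ∀ w, gradient f w = (2 * deriv h (‖w - x0‖ ^ 2)) • (w - x0) := by
      intro w
      refine HasGradientAt.gradient ?_
      rw [hasGradientAt_iff_hasFDerivAt]
      have e1 : HasFDerivAt (fun w : Z => w - x0) (ContinuousLinearMap.id ℝ Z) w :=
        (hasFDerivAt_id w).sub_const x0
      have e2 := (((hc.differentiable (by simp)) (‖w - x0‖ ^ 2)).hasDerivAt).comp_hasFDerivAt w e1.norm_sq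
      refine e2.congr_fderiv ?_
      ext v
      simp [inner_smul_left]
      ring
    let p := projL b n₀ x0
    let u : ℝ → Z := fun t => z t - p
    have hpu : ∀ t, projL b n₀ (z t - x0) = u t := by
      intro t
      rw [map_sub, projL_apply b n₀ (z t), hzp t]
    have hpu2 : ∀ t, projL b n₀ (u t) = u t := by
      intro t
      rw [← hpu, projL_idem hb]
    have hud : ∀ t, HasDerivAt u ((2 * deriv h (‖z t - x0‖ ^ 2)) • J (u t)) t := by
      intro t
      have h1 := (hzd t).sub_const p
      rw [hgrad, ← projL_apply, map_smul, hpu, map_smul] at h1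
      exact h1
    have hnu : ∀ t, ‖u t‖ = ‖u 0‖ := by
      have hsq : ∀ t, HasDerivAt (fun t => ‖u t‖ ^ 2) 0 t := by
        intro t
        refine (hud t).norm_sq.congr_deriv ?_
        rw [inner_smul_right, J_self hb hJ]; simp
      intro t
      have := is_const_of_deriv_eq_zero (fun t => (hsq t).differentiableAt) (fun t => (hsq t).deriv) t 0
      exact (pow_left_inj₀ (norm_nonneg _) (norm_nonneg _) two_ne_zero).mp this
    have hnz : ∀ t, ‖z t - x0‖ ^ 2 = ‖z 0 - x0‖ ^ 2 := by
      have key : ∀ t, ‖z t - x0‖ ^ 2 = ‖u t‖ ^ 2 + ‖p - x0‖ ^ 2 := by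
        intro t
        have e1 : z t - x0 = u t + (p - x0) := by simp [u]
        rw [e1, @norm_add_sq_real]
        have e2 : ⟪u t, p - x0⟫ = 0 := by
          rw [← hpu2, projL_symm, map_sub, projL_idem hb, sub_self, inner_zero_right]
        rw [e2]; ring
      intro t; rw [key, key 0, hnu]
    have hconst := rot_const (J := J) (J_sq hb hJ) (J_self hb hJ) u (2 * deriv h (‖z 0 - x0‖ ^ 2))
      (by linarith [hd0 (‖z 0 - x0‖ ^ 2)]) (by linarith [hdpi (‖z 0 - x0‖ ^ 2)])
      (fun t => by rw [← hnz t]; exact hud t) T hT hT1 (by simp only [u, hper]) hnu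
    apply hne
    have h1 := hconst t₁
    rw [← hconst t₂] at h1
    simpa [u] using h1

lemma cap_le {b : ℕ × Bool → Z} {J : Z →L[ℝ] Z} {O : Set Z} {M : ℝ} (hM : 0 ≤ M)
    (h : ∀ m f, M < m → IsAdmissible O m f → IsFastFunction b J O f) :
    cap b J O ≤ ENNReal.ofReal M :=
  sInf_le ⟨M, ⟨hM, h⟩, rfl⟩

lemma le_cap {b : ℕ × Bool → Z} {J : Z →L[ℝ] Z} (hb : IsHilbertBasis b) (hJ : IsJ b J)
    {O : Set Z} (hO : IsOpen O) (x0 : Z) (ε : ℝ) (hε : 0 < ε) (hsub : ball x0 ε ⊆ O) :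
    ENNReal.ofReal (Real.pi * ε ^ 2) ≤ cap b J O := by
  refine le_sInf ?_
  rintro _ ⟨m', ⟨hm0, hm'⟩, rfl⟩
  refine ENNReal.ofReal_le_ofReal ?_
  by_contra hlt
  push Not at hlt
  obtain ⟨m, h1, h2⟩ := exists_between hlt
  obtain ⟨f, hf, hnf⟩ := lower hb hJ hO x0 ε hε hsub (hm0.trans_lt h1) h2
  exact hnf (hm' m f h1 hf)

lemma norm_projL_le {b : ℕ × Bool → Z} (hb : IsHilbertBasis b) (n : ℕ) (z : Z) :
    ‖projL b n z‖ ≤ ‖z‖ := by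
  have h1 : ‖projL b n z‖ ^ 2 ≤ ‖z‖ * ‖projL b n z‖ := by
    rw [← real_inner_self_eq_norm_sq, projL_symm, projL_idem hb]
    exact real_inner_le_norm _ _
  rcases (norm_nonneg (projL b n z)).eq_or_lt with h | h
  · rw [← h]; exact norm_nonneg _
  · nlinarith

lemma norm_projL_one {b : ℕ × Bool → Z} (hb : IsHilbertBasis b) (z : Z) :
    ‖projL b 1 z‖ ^ 2 = ⟪b (0, true), z⟫ ^ 2 + ⟪b (0, false), z⟫ ^ 2 := by
  rw [← real_inner_self_eq_norm_sq, projL_symm, projL_idem hb, projL_apply, proj]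
  simp only [Finset.range_one, Finset.sum_singleton, inner_add_right, real_inner_smul_right]
  rw [real_inner_comm z, real_inner_comm z]
  ring

/-- Admissible functions are equal to `m` in a uniform neighbourhood of the boundary,
for the ball and the cylinder. -/
lemma pull_in {L : Z →L[ℝ] Z} (hL : ∀ z, L (L z) = L z) {O : Set Z} (hO : IsOpen O)
    {r : ℝ} (hr : 0 < r) (hout : ∀ z, r ≤ ‖L z‖ → z ∉ O)
    {m : ℝ} {f : Z → ℝ} (hf : IsAdmissible O m f) :
    ∃ r', 0 ≤ r' ∧ r' < r ∧ ∀ z ∈ O, f z < m → ‖L z‖ ≤ r' := by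
  obtain ⟨-, -, -, -, -, -, d, hd, hdd⟩ := hf
  refine ⟨max (r - d) 0, le_max_right _ _, max_lt (by linarith) hr, fun z hz hzm => ?_⟩
  rcases (norm_nonneg (L z)).eq_or_lt with h | h
  · rw [← h]; exact le_max_right _ _
  refine le_trans ?_ (le_max_left _ _)
  have hlr : ‖L z‖ < r := by
    by_contra hge
    exact hout z (not_lt.mp hge) hz
  have hy : z + (r / ‖L z‖ - 1) • L z ∉ O := by
    refine hout _ ?_
    rw [map_add, map_smul, hL]
    have : L z + (r / ‖L z‖ - 1) • L z = (r / ‖L z‖) • L z := by module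
    rw [this, norm_smul, Real.norm_of_nonneg (by positivity), div_mul_cancel₀ _ h.ne']
  have h1 := far_of_frontier hO hz hy (hdd z ⟨hz, hzm⟩)
  have h2 : 0 ≤ r / ‖L z‖ - 1 := by
    rw [sub_nonneg, one_le_div h]; exact hlr.le
  rw [dist_self_add_right, norm_smul, Real.norm_of_nonneg h2, sub_mul, div_mul_cancel₀ _ h.ne'] at h1
  linarith

/-- `c(B_r) = c(C_{r,1}) = π r²` for every `r > 0`, where `B_r` is the open
ball of radius `r` and `C_{r,1} = {z : p_1² + q_1² < r²}` is the symplectic cylinder over the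
first mode (indexed here by `j = 0`); moreover every bounded nonempty open set has
capacity in `(0, ∞)`. -/
theorem cap_ball_cylinder_and_bounded
    {Z : Type*} [NormedAddCommGroup Z] [InnerProductSpace ℝ Z] [CompleteSpace Z]
    (b : ℕ × Bool → Z) (J : Z →L[ℝ] Z) (hb : IsHilbertBasis b) (hJ : IsJ b J)
    (r : ℝ) (hr : 0 < r) :
    cap b J (Metric.ball (0 : Z) r) = ENNReal.ofReal (Real.pi * r ^ 2) ∧
    cap b J {z : Z | ⟪b (0, true), z⟫ ^ 2 + ⟪b (0, false), z⟫ ^ 2 < r ^ 2}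
      = ENNReal.ofReal (Real.pi * r ^ 2) ∧
    ∀ O : Set Z, IsOpen O → O.Nonempty → Bornology.IsBounded O →
      0 < cap b J O ∧ cap b J O < ⊤ := by
  have hpi := Real.pi_pos
  have hCeq : {z : Z | ⟪b (0, true), z⟫ ^ 2 + ⟪b (0, false), z⟫ ^ 2 < r ^ 2} =
      {z : Z | ‖projL b 1 z‖ < r} := by
    ext z
    change (_ : ℝ) < _ ↔ (_ : ℝ) < _
    rw [← norm_projL_one hb]
    exact sq_lt_sq₀ (norm_nonneg _) hr.le
  have hCo : IsOpen {z : Z | ‖projL b 1 z‖ < r} :=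
    isOpen_lt (by fun_prop) continuous_const
  refine ⟨le_antisymm ?_ ?_, le_antisymm ?_ ?_, ?_⟩
  · refine cap_le (by positivity) fun m f hm hf => ?_
    obtain ⟨r', h0, h1, h2⟩ := pull_in (L := ContinuousLinearMap.id ℝ Z) (fun _ => rfl) isOpen_ball hr
      (fun z hz hzb => by
        rw [mem_ball_zero_iff] at hzb
        exact absurd hzb (not_lt.mpr hz)) hf
    exact upper hb hJ isOpen_ball hf hr h1 h0 hm fun z hz hzm =>
      (norm_projL_le hb 1 z).trans (h2 z hz hzm)
  · exact le_cap hb hJ isOpen_ball 0 r hr subset_rfl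
  · rw [hCeq]
    refine cap_le (by positivity) fun m f hm hf => ?_
    obtain ⟨r', h0, h1, h2⟩ := pull_in (L := projL b 1) (projL_idem hb 1) hCo hr
      (fun z hz hzb => absurd hzb (not_lt.mpr hz)) hf
    exact upper hb hJ hCo hf hr h1 h0 hm h2
  · rw [hCeq]
    refine le_cap hb hJ hCo 0 r hr fun z hz => ?_
    rw [mem_ball_zero_iff] at hz
    exact (norm_projL_le hb 1 z).trans_lt hz
  · intro O hO hne hbd
    constructor
    · obtain ⟨x0, hx0⟩ := hne
      obtain ⟨ε, hε, hsub⟩ := Metric.isOpen_iff.mp hO x0 hx0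
      refine lt_of_lt_of_le ?_ (le_cap hb hJ hO x0 ε hε hsub)
      rw [ENNReal.ofReal_pos]; positivity
    · obtain ⟨R, hR⟩ := hbd.exists_norm_le
      have hR0 : 0 ≤ R := (norm_nonneg _).trans (hR _ hne.some_mem)
      refine lt_of_le_of_lt (cap_le (M := Real.pi * (R + 1) ^ 2) (by positivity) fun m f hm hf => ?_)
        ENNReal.ofReal_lt_top
      exact upper hb hJ hO hf (r := R + 1) (r' := R) (by linarith) (by linarith) hR0 hm
        fun z hz _ => (norm_projL_le hb 1 z).trans (hR z hz)

end Kuksin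
end
end

section
/- Let r, r', s be real numbers with 0 ≤ r ≤ s, 0 ≤ r' ≤ s and 0 ≤ 2s − r − r' < 1/4. There exists a constant C = C_{r,r',s} such that for all u ∈ H^r(T) and v ∈ H^{r'}(T), ‖φ(D)(uv)‖_{H^s(T)} ≤ C ‖u‖_{H^r(T)} ‖v‖_{H^{r'}(T)}. -/
open scoped BigOperators ComplexConjugate
open Complex

noncomputable section

namespace BBM

/-!  We work on the torus `𝕋 = ℝ/2πℤ` at the level of Fourier coefficients: a function
`u` on `𝕋` is identified with its sequence of Fourier coefficients `û : ℤ → ℂ`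
(`u(x) = Σ_k û(k) e^{ikx}`).  The product of two functions corresponds to the convolution
of their Fourier coefficients, and the Sobolev space `H^s(𝕋)` to the weighted `ℓ²` space
with weight `⟨k⟩^{2s} = (1+k²)^s`. -/

/-- Sobolev weight `⟨k⟩^{2s} = (1+k²)^s`. -/
def wt (s : ℝ) (k : ℤ) : ℝ := (1 + (k : ℝ) ^ 2) ^ s

/-- `u ∈ H^s(𝕋)`: square-summability of the Fourier coefficients against `⟨k⟩^{2s}`. -/
def MemHs (s : ℝ) (u : ℤ → ℂ) : Prop :=
  Summable fun k : ℤ => wt s k * ‖u k‖ ^ 2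

/-- The `H^s(𝕋)` norm, `‖u‖_{H^s} = (Σ_k ⟨k⟩^{2s} |û(k)|²)^{1/2}`. -/
def hsNorm (s : ℝ) (u : ℤ → ℂ) : ℝ :=
  Real.sqrt (∑' k : ℤ, wt s k * ‖u k‖ ^ 2)

/-- The symbol `φ(k) = k/(1+k²)` of the Fourier multiplier `φ(D)`. -/
def phiSymb (k : ℤ) : ℝ := (k : ℝ) / (1 + (k : ℝ) ^ 2)

/-- The Fourier multiplier `φ(D)`, `(φ(D)u)^(k) = φ(k) û(k)`. -/
def phiD (u : ℤ → ℂ) : ℤ → ℂ := fun k => (phiSymb k : ℂ) * u k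

/-- Fourier coefficients of the pointwise product `uv`: the convolution `û * v̂`. -/
def prodHat (u v : ℤ → ℂ) : ℤ → ℂ := fun k => ∑' l : ℤ, u l * v (k - l)

/-- Fourier coefficients of the free evolution `e^{-itφ(D)}u`. -/
def freeEvol (t : ℝ) (u : ℤ → ℂ) : ℤ → ℂ :=
  fun k => Complex.exp (-Complex.I * t * phiSymb k) * u k

/-- `u` is the sequence of Fourier coefficients of a real-valued function. -/
def IsRealSeq (u : ℤ → ℂ) : Prop := ∀ k : ℤ, u (-k) = conj (u k)

/-- The Duhamel (integral) form of the BBM equation at time `t`: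
`u(t) = e^{-itφ(D)}u₀ - (i/2) ∫₀ᵗ e^{-i(t-τ)φ(D)} φ(D)(u(τ)²) dτ`, coefficientwise. -/
def SolvesBBM (u₀ : ℤ → ℂ) (u : ℝ → ℤ → ℂ) (t : ℝ) : Prop :=
  ∀ k : ℤ, u t k = freeEvol t u₀ k -
    (Complex.I / 2) * ∫ τ in (0:ℝ)..t,
      Complex.exp (-Complex.I * (t - τ) * phiSymb k) * (phiSymb k : ℂ) *
        prodHat (u τ) (u τ) k

/-- `u ∈ C⁰([-T,T], H^s(𝕋))`: membership in `H^s` at every time together with continuity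
in time with respect to the `H^s` norm. -/
def ContHs (s T : ℝ) (u : ℝ → ℤ → ℂ) : Prop :=
  (∀ t ∈ Set.Icc (-T) T, MemHs s (u t)) ∧
  ∀ t₀ ∈ Set.Icc (-T) T, ∀ ε : ℝ, 0 < ε → ∃ δ : ℝ, 0 < δ ∧
    ∀ t ∈ Set.Icc (-T) T, |t - t₀| < δ →
      hsNorm s (fun k => u t k - u t₀ k) < ε

/-- `u` is a solution of the BBM equation in `X^s_T = C⁰([-T,T], H^s(𝕋))` with initial
data `u₀`. -/
def IsSolOn (s T : ℝ) (u₀ : ℤ → ℂ) (u : ℝ → ℤ → ℂ) : Prop :=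
  ContHs s T u ∧ ∀ t ∈ Set.Icc (-T) T, SolvesBBM u₀ u t



lemma wt_pos (s : ℝ) (k : ℤ) : 0 < wt s k := by
  unfold wt; positivity

lemma wt_one_le (s : ℝ) (hs : 0 ≤ s) (k : ℤ) : 1 ≤ wt s k := by
  unfold wt
  exact Real.one_le_rpow (by nlinarith [sq_nonneg (k : ℝ)]) hs

lemma wt_mono {a b : ℝ} (h : a ≤ b) (k : ℤ) : wt a k ≤ wt b k := by
  unfold wt
  exact Real.rpow_le_rpow_of_exponent_le (by nlinarith [sq_nonneg (k : ℝ)]) h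

lemma wt_summable {q : ℝ} (hq : q < -(1 / 2)) : Summable (wt q) := by
  have h : Summable fun k : ℤ => |(k : ℝ)| ^ (2 * q) := by
    have := Real.summable_abs_int_rpow (b := -(2 * q)) (by linarith)
    simpa using this
  refine Summable.of_norm_bounded_eventually h ?_
  have : ({0} : Set ℤ)ᶜ ∈ Filter.cofinite := (Set.finite_singleton 0).compl_mem_cofinite
  filter_upwards [this] with k hk
  have hk0 : (k : ℝ) ≠ 0 := by simpa using hk
  rw [Real.norm_of_nonneg (wt_pos q k).le, Real.rpow_mul (abs_nonneg _)]
  unfold wt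
  have h2 : |(k : ℝ)| ^ (2 : ℝ) = (k : ℝ) ^ 2 := by
    rw [Real.rpow_two, sq_abs]
  rw [h2]
  exact Real.rpow_le_rpow_of_nonpos (by positivity) (by linarith) (by linarith)

lemma peetre {ρ r r' : ℝ} (h0 : 0 ≤ ρ) (h1 : ρ ≤ r) (h2 : ρ ≤ r') (k l : ℤ) :
    wt ρ k ≤ 2 ^ ρ * (wt r l * wt r' (k - l)) := by
  have h3 : wt ρ k ≤ 2 ^ ρ * (wt ρ l * wt ρ (k - l)) := by
    unfold wt
    rw [← Real.mul_rpow (by positivity) (by positivity),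
      ← Real.mul_rpow (by positivity) (by positivity)]
    apply Real.rpow_le_rpow (by positivity) _ h0
    push_cast
    nlinarith [sq_nonneg ((l : ℝ) - (k - l)), sq_nonneg ((l : ℝ) * (k - l))]
  refine h3.trans ?_
  have := wt_mono h1 l
  have := wt_mono h2 (k - l)
  have := wt_pos ρ l
  have := wt_pos ρ (k - l)
  have := wt_pos r l
  gcongr

lemma cs {r r' : ℝ} {u v : ℤ → ℂ} (hu : MemHs r u) (hv : MemHs r' v) (k : ℤ) :
    (Summable fun l => √(wt r l * wt r' (k - l)) * ‖u l * v (k - l)‖) ∧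
    (∑' l, √(wt r l * wt r' (k - l)) * ‖u l * v (k - l)‖) ≤ hsNorm r u * hsNorm r' v := by
  have e : ∀ (r : ℝ) (u : ℤ → ℂ) (l : ℤ),
      (√(wt r l) * ‖u l‖) ^ (2 : ℝ) = wt r l * ‖u l‖ ^ 2 := by
    intro r u l
    rw [Real.rpow_two, mul_pow, Real.sq_sqrt (wt_pos r l).le]
  have hv' : Summable fun l : ℤ => wt r' (k - l) * ‖v (k - l)‖ ^ 2 :=
    (Equiv.subLeft k).summable_iff.mpr hv
  have ht : ∑' l : ℤ, wt r' (k - l) * ‖v (k - l)‖ ^ 2 = ∑' l : ℤ, wt r' l * ‖v l‖ ^ 2 :=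
    (Equiv.subLeft k).tsum_eq (fun l : ℤ => wt r' l * ‖v l‖ ^ 2)
  have := Real.summable_and_inner_le_Lp_mul_Lq_tsum_of_nonneg (p := 2) (q := 2)
    (f := fun l => √(wt r l) * ‖u l‖) (g := fun l => √(wt r' (k - l)) * ‖v (k - l)‖)
    Real.HolderConjugate.two_two (fun _ => by positivity) (fun _ => by positivity)
    (by simp only [e]; exact hu) (by simp only [e]; exact hv')
  simp only [e, ht, ← Real.sqrt_eq_rpow] at this
  have e2 : (fun l => √(wt r l * wt r' (k - l)) * ‖u l * v (k - l)‖) =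
      fun l => √(wt r l) * ‖u l‖ * (√(wt r' (k - l)) * ‖v (k - l)‖) := by
    funext l
    rw [Real.sqrt_mul (wt_pos r l).le, norm_mul]; ring
  rw [e2]
  exact this

lemma prod_bound {ρ r r' : ℝ} (h0 : 0 ≤ ρ) (h1 : ρ ≤ r) (h2 : ρ ≤ r') {u v : ℤ → ℂ}
    (hu : MemHs r u) (hv : MemHs r' v) (k : ℤ) :
    wt ρ k * ‖prodHat u v k‖ ^ 2 ≤ 2 ^ ρ * (hsNorm r u * hsNorm r' v) ^ 2 := by
  obtain ⟨hs, hle⟩ := cs hu hv k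
  have hp : ∀ l, √(wt ρ k) * ‖u l * v (k - l)‖ ≤
      √(2 ^ ρ) * (√(wt r l * wt r' (k - l)) * ‖u l * v (k - l)‖) := by
    intro l
    rw [← mul_assoc, ← Real.sqrt_mul (by positivity)]
    gcongr
    exact peetre h0 h1 h2 k l
  have hs2 := hs.mul_left (√(2 ^ ρ))
  have hs3 : Summable fun l => √(wt ρ k) * ‖u l * v (k - l)‖ :=
    Summable.of_nonneg_of_le (fun _ => by positivity) hp hs2
  have hw : √(wt ρ k) ≠ 0 := (Real.sqrt_pos.mpr (wt_pos ρ k)).ne'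
  have hs4 : Summable fun l => ‖u l * v (k - l)‖ := (summable_mul_left_iff hw).mp hs3
  have key : √(wt ρ k) * ‖prodHat u v k‖ ≤ √(2 ^ ρ) * (hsNorm r u * hsNorm r' v) := by
    calc _ ≤ √(wt ρ k) * ∑' l, ‖u l * v (k - l)‖ := by
          gcongr
          exact norm_tsum_le_tsum_norm hs4
      _ = ∑' l, √(wt ρ k) * ‖u l * v (k - l)‖ := tsum_mul_left.symm
      _ ≤ ∑' l, √(2 ^ ρ) * (√(wt r l * wt r' (k - l)) * ‖u l * v (k - l)‖) :=
          hs3.tsum_le_tsum hp hs2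
      _ = √(2 ^ ρ) * ∑' l, (√(wt r l * wt r' (k - l)) * ‖u l * v (k - l)‖) := tsum_mul_left
      _ ≤ _ := by gcongr
  have := pow_le_pow_left₀ (by positivity) key 2
  rwa [mul_pow, mul_pow _ (hsNorm r u * hsNorm r' v), Real.sq_sqrt (wt_pos ρ k).le,
    Real.sq_sqrt (by positivity)] at this

lemma phi_bound (s ρ : ℝ) (k : ℤ) : wt s k * phiSymb k ^ 2 ≤ wt (s - ρ - 1) k * wt ρ k := by
  have e : wt (s - ρ - 1) k * wt ρ k = wt s k * (1 + (k : ℝ) ^ 2)⁻¹ := by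
    unfold wt
    have hp : 0 < 1 + (k : ℝ) ^ 2 := by positivity
    rw [← Real.rpow_neg_one, ← Real.rpow_add hp, ← Real.rpow_add hp]
    congr 1; ring
  rw [e]
  have := wt_pos s k
  gcongr
  unfold phiSymb
  rw [div_pow, inv_eq_one_div, div_le_div_iff₀ (by positivity) (by positivity)]
  nlinarith [sq_nonneg (k : ℝ)]

lemma main_aux (ρ r r' s : ℝ) (h0 : 0 ≤ ρ) (h1 : ρ ≤ r) (h2 : ρ ≤ r') (h3 : s - ρ < 1 / 4) :
    ∃ C : ℝ, 0 < C ∧ ∀ u v : ℤ → ℂ, MemHs r u → MemHs r' v →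
      MemHs s (phiD (prodHat u v)) ∧
      hsNorm s (phiD (prodHat u v)) ≤ C * hsNorm r u * hsNorm r' v := by
  have hS : Summable (wt (s - ρ - 1)) := wt_summable (by linarith)
  have hSpos : 0 < ∑' k, wt (s - ρ - 1) k :=
    hS.tsum_pos (fun k => (wt_pos _ k).le) 0 (wt_pos _ 0)
  refine ⟨√((∑' k, wt (s - ρ - 1) k) * 2 ^ ρ), by positivity, fun u v hu hv => ?_⟩
  have hb : ∀ k, wt s k * ‖phiD (prodHat u v) k‖ ^ 2 ≤
      wt (s - ρ - 1) k * (2 ^ ρ * (hsNorm r u * hsNorm r' v) ^ 2) := by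
    intro k
    have hw := wt_pos (s - ρ - 1) k
    calc _ = wt s k * phiSymb k ^ 2 * ‖prodHat u v k‖ ^ 2 := by
          unfold phiD
          rw [norm_mul, mul_pow, Complex.norm_real, Real.norm_eq_abs, sq_abs]; ring
      _ ≤ wt (s - ρ - 1) k * wt ρ k * ‖prodHat u v k‖ ^ 2 :=
          mul_le_mul_of_nonneg_right (phi_bound s ρ k) (by positivity)
      _ = wt (s - ρ - 1) k * (wt ρ k * ‖prodHat u v k‖ ^ 2) := by ring
      _ ≤ _ :=
          mul_le_mul_of_nonneg_left (prod_bound h0 h1 h2 hu hv k) hw.le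
  have hm : MemHs s (phiD (prodHat u v)) :=
    Summable.of_nonneg_of_le (fun k => mul_nonneg (wt_pos s k).le (by positivity)) hb
      (hS.mul_right _)
  refine ⟨hm, ?_⟩
  have hle := hm.tsum_le_tsum hb (hS.mul_right _)
  rw [tsum_mul_right, ← mul_assoc] at hle
  have hn : 0 ≤ hsNorm r u * hsNorm r' v := mul_nonneg (Real.sqrt_nonneg _) (Real.sqrt_nonneg _)
  calc hsNorm s (phiD (prodHat u v)) ≤ _ := Real.sqrt_le_sqrt hle
    _ = _ := by rw [Real.sqrt_mul (by positivity), Real.sqrt_sq hn, mul_assoc]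

/-- Bilinear estimate: if `0 ≤ r ≤ s`, `0 ≤ r' ≤ s` and
`0 ≤ 2s - r - r' < 1/4`, then `‖φ(D)(uv)‖_{H^s} ≤ C ‖u‖_{H^r} ‖v‖_{H^{r'}}` for all
`u ∈ H^r(𝕋)`, `v ∈ H^{r'}(𝕋)`. -/
theorem bilinear_estimate_one
    (r r' s : ℝ) (hr0 : 0 ≤ r) (hrs : r ≤ s) (hr'0 : 0 ≤ r') (hr's : r' ≤ s)
    (hlow : 0 ≤ 2 * s - r - r') (hhigh : 2 * s - r - r' < 1 / 4) :
    ∃ C : ℝ, 0 < C ∧ ∀ u v : ℤ → ℂ, MemHs r u → MemHs r' v →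
      MemHs s (phiD (prodHat u v)) ∧
      hsNorm s (phiD (prodHat u v)) ≤ C * hsNorm r u * hsNorm r' v := by
  rcases le_total r r' with h | h
  · exact main_aux r r r' s hr0 le_rfl h (by linarith)
  · exact main_aux r' r r' s hr'0 h le_rfl (by linarith)

end BBM
end
end

section
/- Let r, s be real numbers with 0 ≤ s ≤ r and r > 1/2. There exists a constant C such that for all u ∈ H^r(T) and v ∈ H^s(T), ‖φ(D)(uv)‖_{H^{s+1}(T)} ≤ C ‖u‖_{H^r(T)} ‖v‖_{H^s(T)}. -/
open scoped BigOperators ComplexConjugate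
open Complex

noncomputable section

namespace BBM

lemma summable_wt_neg {r : ℝ} (hr : 1 / 2 < r) : Summable fun k : ℤ => wt (-r) k := by
  have h1 := Real.summable_abs_int_rpow (b := 2 * r) (by linarith)
  have h2 : Summable fun k : ℤ => (if k = 0 then (1 : ℝ) else 0) :=
    (hasSum_ite_eq (0 : ℤ) (1 : ℝ)).summable
  refine Summable.of_nonneg_of_le (fun k => (wt_pos _ k).le) (fun k => ?_) (h1.add h2)
  by_cases hk : k = 0
  · subst hk
    have : (0 : ℝ) ≤ |((0 : ℤ) : ℝ)| ^ (-(2 * r)) := by positivity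
    simp only [wt, if_true]
    simp only [Int.cast_zero, ne_eq, OfNat.ofNat_ne_zero, not_false_eq_true, zero_pow, add_zero,
      Real.one_rpow] at *
    linarith
  · have hk' : (0 : ℝ) < |(k : ℝ)| := by positivity
    simp only [wt, hk, if_false, add_zero]
    have : |(k : ℝ)| ^ (-(2 * r)) = ((k : ℝ) ^ 2) ^ (-r) := by
      rw [← sq_abs, ← Real.rpow_natCast, ← Real.rpow_mul hk'.le]
      congr 1; push_cast; ring
    rw [this]
    exact Real.rpow_le_rpow_of_nonpos (by positivity) (by linarith) (by linarith)

lemma cs_aux (w : ℤ → ℂ) (A B : ℤ → ℝ) (hA : ∀ l, 0 ≤ A l) (hB : ∀ l, 0 ≤ B l)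
    (sA : Summable A) (sB : Summable B) (h : ∀ l, ‖w l‖ ^ 2 ≤ A l * B l) :
    ‖∑' l, w l‖ ^ 2 ≤ (∑' l, A l) * ∑' l, B l := by
  have eA : ∀ l, Real.sqrt (A l) ^ (2 : ℝ) = A l := fun l => by
    rw [Real.rpow_two, Real.sq_sqrt (hA l)]
  have eB : ∀ l, Real.sqrt (B l) ^ (2 : ℝ) = B l := fun l => by
    rw [Real.rpow_two, Real.sq_sqrt (hB l)]
  obtain ⟨h1, h2⟩ := Real.summable_and_inner_le_Lp_mul_Lq_tsum_of_nonneg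
    (f := fun l => Real.sqrt (A l)) (g := fun l => Real.sqrt (B l))
    Real.HolderConjugate.two_two (fun l => Real.sqrt_nonneg _) (fun l => Real.sqrt_nonneg _)
    (by simpa only [eA] using sA) (by simpa only [eB] using sB)
  simp only [eA, eB, ← Real.sqrt_eq_rpow] at h2
  have h3 : ∀ l, ‖w l‖ ≤ Real.sqrt (A l) * Real.sqrt (B l) := fun l => by
    rw [← Real.sqrt_mul (hA l)]
    exact Real.le_sqrt_of_sq_le (h l)
  have h4 : ‖∑' l, w l‖ ≤ Real.sqrt (∑' l, A l) * Real.sqrt (∑' l, B l) :=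
    (tsum_of_norm_bounded h1.hasSum h3).trans h2
  calc ‖∑' l, w l‖ ^ 2 ≤ (Real.sqrt (∑' l, A l) * Real.sqrt (∑' l, B l)) ^ 2 := by gcongr
    _ = _ := by
      rw [mul_pow, Real.sq_sqrt (tsum_nonneg hA), Real.sq_sqrt (tsum_nonneg hB)]

lemma real_aux (r s a b c : ℝ) (hs0 : 0 ≤ s) (hsr : s ≤ r) (ha : 1 ≤ a) (hb : 1 ≤ b)
    (hc : 1 ≤ c) (h : c ≤ 2 * a + 2 * b) :
    c ^ s ≤ 4 ^ s * (2 * a ^ (-r) + b ^ (-r)) * (a ^ r * b ^ s) := by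
  have a0 : 0 < a := by linarith
  have b0 : 0 < b := by linarith
  have pa := Real.rpow_pos_of_pos a0 r
  have pb := Real.rpow_pos_of_pos b0 s
  have pb' := Real.rpow_pos_of_pos b0 (-r)
  have e1 : a ^ (-r) * a ^ r = 1 := by rw [← Real.rpow_add a0]; simp
  have p4 : (0 : ℝ) < 4 ^ s := by positivity
  rcases le_total a b with hab | hab
  · have h1 : c ^ s ≤ 4 ^ s * b ^ s := by
      rw [← Real.mul_rpow (by norm_num) b0.le]
      exact Real.rpow_le_rpow (by linarith) (by linarith) hs0
    have : 4 ^ s * (2 * a ^ (-r) + b ^ (-r)) * (a ^ r * b ^ s)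
      = 2 * (4 ^ s * b ^ s) * (a ^ (-r) * a ^ r) + 4 ^ s * b ^ (-r) * (a ^ r * b ^ s) := by ring
    rw [this, e1]
    have : 0 ≤ 4 ^ s * b ^ (-r) * (a ^ r * b ^ s) := by positivity
    have : 0 ≤ 4 ^ s * b ^ s := by positivity
    linarith
  · have h1 : c ^ s ≤ 4 ^ s * a ^ s := by
      rw [← Real.mul_rpow (by norm_num) a0.le]
      exact Real.rpow_le_rpow (by linarith) (by linarith) hs0
    have h2 : b ^ (r - s) ≤ a ^ (r - s) := Real.rpow_le_rpow b0.le hab (by linarith)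
    have h3 : a ^ s ≤ b ^ (-r) * (a ^ r * b ^ s) := by
      have e2 : a ^ r = a ^ s * a ^ (r - s) := by rw [← Real.rpow_add a0]; congr 1; ring
      have e3 : b ^ (-r) * b ^ s * b ^ (r - s) = 1 := by
        rw [← Real.rpow_add b0, ← Real.rpow_add b0]; ring_nf; simp
      calc a ^ s = a ^ s * (b ^ (-r) * b ^ s * b ^ (r - s)) := by rw [e3, mul_one]
        _ ≤ a ^ s * (b ^ (-r) * b ^ s * a ^ (r - s)) := by gcongr
        _ = _ := by rw [e2]; ring
    have h4 : 0 ≤ 4 ^ s * (2 * a ^ (-r)) * (a ^ r * b ^ s) := by positivity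
    have := mul_le_mul_of_nonneg_left h3 p4.le
    nlinarith

lemma wt_aux (r s : ℝ) (hs0 : 0 ≤ s) (hsr : s ≤ r) (k l : ℤ) :
    wt s k ≤ 4 ^ s * (2 * wt (-r) l + wt (-r) (k - l)) * (wt r l * wt s (k - l)) := by
  unfold wt
  apply real_aux r s _ _ _ hs0 hsr
  · nlinarith [sq_nonneg (l : ℝ)]
  · nlinarith [sq_nonneg ((k - l : ℤ) : ℝ)]
  · nlinarith [sq_nonneg (k : ℝ)]
  · push_cast
    nlinarith [sq_nonneg ((k : ℝ) - 2 * l)]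

/-- The shear equivalence. -/
def shear : ℤ × ℤ ≃ ℤ × ℤ where
  toFun p := (p.2, p.1 - p.2)
  invFun q := (q.1 + q.2, q.1)
  left_inv p := by ext <;> simp
  right_inv q := by ext <;> simp

lemma mult_aux (s : ℝ) (k : ℤ) (z : ℂ) :
    wt (s + 1) k * ‖(phiSymb k : ℂ) * z‖ ^ 2 ≤ wt s k * ‖z‖ ^ 2 := by
  have h0 : (0 : ℝ) < 1 + (k : ℝ) ^ 2 := by positivity
  have h1 : wt (s + 1) k = wt s k * (1 + (k : ℝ) ^ 2) := by
    unfold wt; rw [Real.rpow_add h0, Real.rpow_one]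
  have h2 : (1 + (k : ℝ) ^ 2) * phiSymb k ^ 2 ≤ 1 := by
    unfold phiSymb
    rw [div_pow, ← mul_div_assoc, div_le_one (by positivity)]
    nlinarith
  rw [norm_mul, Complex.norm_real, mul_pow, Real.norm_eq_abs, sq_abs, h1]
  have := mul_le_mul_of_nonneg_left h2 (mul_nonneg (wt_pos s k).le (sq_nonneg ‖z‖))
  linarith

/-- Bilinear estimate with smoothing: if `0 ≤ s ≤ r` and `r > 1/2`, then
`‖φ(D)(uv)‖_{H^{s+1}} ≤ C ‖u‖_{H^r} ‖v‖_{H^s}` for all `u ∈ H^r(𝕋)`, `v ∈ H^s(𝕋)`. -/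
theorem bilinear_estimate_two
    (r s : ℝ) (hs0 : 0 ≤ s) (hsr : s ≤ r) (hr : 1 / 2 < r) :
    ∃ C : ℝ, 0 < C ∧ ∀ u v : ℤ → ℂ, MemHs r u → MemHs s v →
      MemHs (s + 1) (phiD (prodHat u v)) ∧
      hsNorm (s + 1) (phiD (prodHat u v)) ≤ C * hsNorm r u * hsNorm s v := by
  have hg := summable_wt_neg hr
  set S : ℝ := ∑' k : ℤ, wt (-r) k with hS
  have hS0 : 0 < S := hg.tsum_pos (fun k => (wt_pos _ k).le) 0 (wt_pos _ 0)
  have p4 : (0 : ℝ) < 4 ^ s := by positivity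
  refine ⟨Real.sqrt (4 ^ s * (3 * S)), by positivity, fun u v hu hv => ?_⟩
  set F : ℤ → ℝ := fun k => wt r k * ‖u k‖ ^ 2 with hF
  set G : ℤ → ℝ := fun k => wt s k * ‖v k‖ ^ 2 with hG
  have hF0 : ∀ k, 0 ≤ F k := fun k => mul_nonneg (wt_pos _ _).le (sq_nonneg _)
  have hG0 : ∀ k, 0 ≤ G k := fun k => mul_nonneg (wt_pos _ _).le (sq_nonneg _)
  have sF : Summable F := hu
  have sG : Summable G := hv
  have sFG : Summable fun x : ℤ × ℤ => F x.1 * G x.2 := sF.mul_of_nonneg sG hF0 hG0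
  have sFG' : Summable fun p : ℤ × ℤ => F p.2 * G (p.1 - p.2) :=
    (shear.summable_iff (f := fun x : ℤ × ℤ => F x.1 * G x.2)).2 sFG
  have tFG : ∑' k : ℤ, ∑' l : ℤ, F l * G (k - l) = (∑' k, F k) * ∑' k, G k := by
    rw [← sFG'.tsum_prod (f := fun p : ℤ × ℤ => F p.2 * G (p.1 - p.2)),
      sF.tsum_mul_tsum sG sFG]
    exact shear.tsum_eq (fun x : ℤ × ℤ => F x.1 * G x.2)
  have key : ∀ k, wt (s + 1) k * ‖phiD (prodHat u v) k‖ ^ 2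
      ≤ 4 ^ s * (3 * S) * ∑' l : ℤ, F l * G (k - l) := by
    intro k
    refine (mult_aux s k _).trans ?_
    have hk := wt_pos s k
    have sg' : Summable fun l : ℤ => wt (-r) (k - l) :=
      ((Equiv.subLeft k).summable_iff (f := fun l : ℤ => wt (-r) l)).2 hg
    have tg' : ∑' l : ℤ, wt (-r) (k - l) = S := (Equiv.subLeft k).tsum_eq (fun l => wt (-r) l)
    have sA : Summable fun l : ℤ => (wt s k)⁻¹ * (4 ^ s * (2 * wt (-r) l + wt (-r) (k - l))) :=
      (((hg.mul_left 2).add sg').mul_left _).mul_left _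
    have tA : ∑' l : ℤ, (wt s k)⁻¹ * (4 ^ s * (2 * wt (-r) l + wt (-r) (k - l)))
        = (wt s k)⁻¹ * (4 ^ s * (3 * S)) := by
      rw [tsum_mul_left, tsum_mul_left, (hg.mul_left 2).tsum_add sg', tsum_mul_left, tg']
      ring
    have := cs_aux (fun l => u l * v (k - l)) _ (fun l => F l * G (k - l))
      (fun l => mul_nonneg (inv_nonneg.2 hk.le) (mul_nonneg p4.le
        (add_nonneg (mul_nonneg zero_le_two (wt_pos _ _).le) (wt_pos _ _).le)))
      (fun l => mul_nonneg (hF0 _) (hG0 _)) sA (sFG'.prod_factor k) (fun l => by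
        have h := wt_aux r s hs0 hsr k l
        have h' := mul_le_mul_of_nonneg_left h
          (mul_nonneg (inv_nonneg.2 hk.le) (mul_nonneg (sq_nonneg ‖u l‖) (sq_nonneg ‖v (k - l)‖)))
        rw [norm_mul, mul_pow]
        calc ‖u l‖ ^ 2 * ‖v (k - l)‖ ^ 2
            = (wt s k)⁻¹ * (‖u l‖ ^ 2 * ‖v (k - l)‖ ^ 2) * wt s k := by
              field_simp
          _ ≤ _ := h'
          _ = _ := by simp only [hF, hG]; ring)
    rw [tA] at this
    calc wt s k * ‖prodHat u v k‖ ^ 2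
        ≤ wt s k * ((wt s k)⁻¹ * (4 ^ s * (3 * S)) * ∑' l : ℤ, F l * G (k - l)) :=
          mul_le_mul_of_nonneg_left this hk.le
      _ = _ := by field_simp
  have sR : Summable fun k : ℤ => 4 ^ s * (3 * S) * ∑' l : ℤ, F l * G (k - l) :=
    (sFG'.prod).mul_left _
  have sL : MemHs (s + 1) (phiD (prodHat u v)) :=
    Summable.of_nonneg_of_le (fun k => mul_nonneg (wt_pos _ _).le (sq_nonneg _)) key sR
  refine ⟨sL, ?_⟩
  have hle := Summable.tsum_le_tsum key sL sR
  rw [tsum_mul_left, tFG] at hle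
  unfold hsNorm
  rw [mul_assoc, ← Real.sqrt_mul (tsum_nonneg hF0), ← Real.sqrt_mul (by positivity)]
  exact Real.sqrt_le_sqrt hle

end BBM
end
end
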